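/- There exists a function u : ℝ⁴ → ℝ of class C⁴ such that: (i) Δ²u = e^{u} on all of ℝ⁴, where Δ² = Δ∘Δ is the bi-Laplacian; (ii) u is radial in the first three coordinates, i.e. u(x₁,x₂,x₃,x₄) depends on (x₁,x₂,x₃) only through the Euclidean norm |(x₁,x₂,x₃)|; (iii) there is a constant C > 0 with |u(x₁,x₂,x₃,x₄)| ≤ C(1 + |(x₁,x₂,x₃)|) for all points, so u decays to −∞ at most linearly in the first three variables; (iv) u is periodic in the last coordinate x₄ with some period T > 0 and is not independent of x₄; and (v) ∫_{ℝ⁴} e^{u} = +∞. -/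

import Mathlib

open MeasureTheory

/-- The Laplacian on `Fin n → ℝ` (Euclidean coordinates): `Δu x = ∑ i, ∂²u/∂xᵢ² (x)`. -/
noncomputable def lapN {n : ℕ} (u : (Fin n → ℝ) → ℝ) (x : Fin n → ℝ) : ℝ :=
  ∑ i, iteratedDeriv 2 (fun t => u (Function.update x i t)) (x i)

namespace CylinderLiouville

open Real Set Filter Topology

/-- The squared distance to the `x₄`-axis. -/
noncomputable def radSq (x : Fin 4 → ℝ) : ℝ := x 0 ^ 2 + x 1 ^ 2 + x 2 ^ 2

/-- The distance to the `x₄`-axis. -/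
noncomputable def rad (x : Fin 4 → ℝ) : ℝ := √(radSq x)

/-- One period cell of the translation by `2π` in the last coordinate. -/
def cell : Set (Fin 4 → ℝ) := {x | x 3 ∈ Ioc (-π) π}

/-- The translation by one period in the last coordinate. -/
noncomputable def shift : Fin 4 → ℝ := Pi.single 3 (2 * π)

lemma radSq_nonneg (x : Fin 4 → ℝ) : 0 ≤ radSq x := by unfold radSq; positivity

lemma rad_nonneg (x : Fin 4 → ℝ) : 0 ≤ rad x := Real.sqrt_nonneg _

lemma rad_sq (x : Fin 4 → ℝ) : rad x ^ 2 = radSq x := Real.sq_sqrt (radSq_nonneg x)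

@[fun_prop]
lemma continuous_radSq : Continuous radSq := by unfold radSq; fun_prop

@[fun_prop]
lemma continuous_rad : Continuous rad := by unfold rad; fun_prop

lemma rad_eq_norm (x : Fin 4 → ℝ) : rad x = ‖!₂[x 0, x 1, x 2]‖ := by
  simp [EuclideanSpace.norm_eq, Fin.sum_univ_three, rad, radSq]

lemma rad_add_le (x y : Fin 4 → ℝ) : rad (x + y) ≤ rad x + rad y := by
  simp only [rad_eq_norm]
  refine le_trans (le_of_eq ?_) (norm_add_le _ _)
  congr 1
  ext i; fin_cases i <;> simp

lemma rad_neg (x : Fin 4 → ℝ) : rad (-x) = rad x := by simp [rad, radSq]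

lemma radSq_neg (x : Fin 4 → ℝ) : radSq (-x) = radSq x := by simp [radSq]

lemma rad_sub_comm (x y : Fin 4 → ℝ) : rad (x - y) = rad (y - x) := by
  rw [← rad_neg, neg_sub]

lemma rad_sub_le (x y : Fin 4 → ℝ) : rad (x - y) ≤ rad x + rad y := by
  rw [sub_eq_add_neg, ← rad_neg y]; exact rad_add_le _ _

lemma rad_le_sub_add (x y : Fin 4 → ℝ) : rad x ≤ rad (x - y) + rad y := by
  simpa using rad_add_le (x - y) y

lemma abs_le_rad (x : Fin 4 → ℝ) (i : Fin 4) (hi : i ≠ 3) : |x i| ≤ rad x := by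
  apply Real.abs_le_sqrt
  unfold radSq
  fin_cases i <;> simp at hi ⊢ <;> nlinarith [sq_nonneg (x 0), sq_nonneg (x 1), sq_nonneg (x 2)]

lemma rad_le_norm (x : Fin 4 → ℝ) : rad x ≤ 2 * ‖x‖ := by
  apply Real.sqrt_le_iff.2
  refine ⟨by positivity, ?_⟩
  have h : ∀ i, x i ^ 2 ≤ ‖x‖ ^ 2 := fun i => by
    rw [← sq_abs]; exact pow_le_pow_left₀ (abs_nonneg _) (norm_le_pi_norm x i) 2
  unfold radSq
  nlinarith [h 0, h 1, h 2, sq_nonneg ‖x‖]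

lemma shift_apply_three : shift 3 = 2 * π := by simp [shift]

lemma shift_apply_of_ne {i : Fin 4} (hi : i ≠ 3) : shift i = 0 := by simp [shift, hi]

lemma radSq_add_shift (x : Fin 4 → ℝ) : radSq (x + shift) = radSq x := by
  simp [radSq, shift_apply_of_ne]

lemma rad_add_shift (x : Fin 4 → ℝ) : rad (x + shift) = rad x := by
  simp [rad, radSq_add_shift]

lemma measurableSet_cell : MeasurableSet cell :=
  measurableSet_Ioc.preimage (measurable_pi_apply 3)

lemma isAddFundamentalDomain_cell :
    IsAddFundamentalDomain (AddSubgroup.zmultiples shift) cell (volume : Measure (Fin 4 → ℝ)) := by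
  refine IsAddFundamentalDomain.mk' measurableSet_cell.nullMeasurableSet fun x => ?_
  have hb : Function.Bijective (fun n : ℤ => (⟨n • shift, n, rfl⟩ : AddSubgroup.zmultiples shift)) := by
    refine ⟨fun m n h => ?_, fun ⟨_, n, hn⟩ => ⟨n, Subtype.ext hn⟩⟩
    have := congrFun (congrArg Subtype.val h) 3
    simpa [shift_apply_three, pi_pos.ne'] using this
  refine hb.existsUnique_iff.2 ?_
  have := existsUnique_add_zsmul_mem_Ioc (by positivity : 0 < 2 * π) (x 3) (-π)
  convert this using 2 with n
  simp only [cell, AddSubgroup.vadd_def, vadd_eq_add, mem_ofPred_eq, Pi.add_apply, Pi.smul_apply,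
    shift_apply_three]
  rw [add_comm, show -π + 2 * π = π by ring]

lemma isAddFundamentalDomain_sub_cell (x : Fin 4 → ℝ) :
    IsAddFundamentalDomain (AddSubgroup.zmultiples shift) ((fun z => x - z) ⁻¹' cell)
      (volume : Measure (Fin 4 → ℝ)) := by
  refine IsAddFundamentalDomain.mk'
    (measurableSet_cell.preimage (by fun_prop)).nullMeasurableSet fun z => ?_
  have hb : Function.Bijective (fun n : ℤ => (⟨n • shift, n, rfl⟩ : AddSubgroup.zmultiples shift)) := by
    refine ⟨fun m n h => ?_, fun ⟨_, n, hn⟩ => ⟨n, Subtype.ext hn⟩⟩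
    have := congrFun (congrArg Subtype.val h) 3
    simpa [shift_apply_three, pi_pos.ne'] using this
  refine hb.existsUnique_iff.2 ?_
  have := existsUnique_add_zsmul_mem_Ico (by positivity : 0 < 2 * π) (z 3) (x 3 - π)
  convert this using 2 with n
  simp only [cell, AddSubgroup.vadd_def, vadd_eq_add, mem_ofPred_eq, Pi.add_apply, Pi.smul_apply,
    shift_apply_three, mem_preimage, Pi.sub_apply, mem_Ioc, mem_Ico]
  constructor <;> rintro ⟨h1, h2⟩ <;> constructor <;> linarith

lemma periodic_vadd {h : (Fin 4 → ℝ) → ℝ} (hp : Function.Periodic h shift)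
    (g : AddSubgroup.zmultiples shift) (x : Fin 4 → ℝ) : h (g +ᵥ x) = h x := by
  obtain ⟨_, n, rfl⟩ := g
  simpa [AddSubgroup.vadd_def, add_comm] using hp.zsmul n x

lemma sub_preimage_preimage (x : Fin 4 → ℝ) (s : Set (Fin 4 → ℝ)) :
    (fun z => x - z) ⁻¹' ((fun z => x - z) ⁻¹' s) = s := by
  ext; simp

lemma setIntegral_cell_sub {h : (Fin 4 → ℝ) → ℝ} (hp : Function.Periodic h shift)
    (x : Fin 4 → ℝ) : ∫ z in cell, h (x - z) = ∫ z in cell, h z := by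
  have e : MeasurableEmbedding (fun z : Fin 4 → ℝ => x - z) :=
    (MeasurableEquiv.subLeft x).measurableEmbedding
  have := (Measure.measurePreserving_sub_left (volume : Measure (Fin 4 → ℝ))
    x).setIntegral_preimage_emb e h ((fun z => x - z) ⁻¹' cell)
  rw [sub_preimage_preimage] at this
  rw [this]
  exact (isAddFundamentalDomain_sub_cell x).setIntegral_eq isAddFundamentalDomain_cell
    (periodic_vadd hp)

lemma integrableOn_cell_sub {h : (Fin 4 → ℝ) → ℝ} (hp : Function.Periodic h shift)
    (hi : IntegrableOn h cell) (x : Fin 4 → ℝ) : IntegrableOn (fun z => h (x - z)) cell := by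
  have e : MeasurableEmbedding (fun z : Fin 4 → ℝ => x - z) :=
    (MeasurableEquiv.subLeft x).measurableEmbedding
  have := (Measure.measurePreserving_sub_left (volume : Measure (Fin 4 → ℝ))
    x).integrableOn_comp_preimage e (f := h) (s := (fun z => x - z) ⁻¹' cell)
  rw [sub_preimage_preimage] at this
  exact this.2 (((isAddFundamentalDomain_sub_cell x).integrableOn_iff isAddFundamentalDomain_cell
    (periodic_vadd hp)).2 hi)

lemma setIntegral_cell_add {h : (Fin 4 → ℝ) → ℝ} (hp : Function.Periodic h shift)
    (x : Fin 4 → ℝ) : ∫ z in cell, h (z + x) = ∫ z in cell, h z := by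
  have hp' : Function.Periodic (fun z => h (-z)) shift := fun z => by
    have := hp (-(z + shift))
    simp only [neg_add, neg_add_cancel_right] at this
    show h (-(z + shift)) = h (-z)
    rw [neg_add, this]
  have h1 := setIntegral_cell_sub hp' (-x)
  have h2 := setIntegral_cell_sub hp 0
  simp only [neg_sub, sub_neg_eq_add, zero_sub] at h1 h2
  rw [h1, h2]

lemma ae_apply_ne_zero (i : Fin 4) : ∀ᵐ z : Fin 4 → ℝ, z i ≠ 0 := by
  rw [ae_iff]
  simpa [volume_pi] using Measure.pi_hyperplane (fun _ : Fin 4 => (volume : Measure ℝ)) i 0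

lemma ae_radSq_pos : ∀ᵐ z : Fin 4 → ℝ, 0 < radSq z := by
  filter_upwards [ae_apply_ne_zero 0] with z hz
  unfold radSq; positivity

/-- The exponentially decaying weight, singular on the axis, that dominates all our integrands. -/
noncomputable def weight (c : ℝ) (z : Fin 4 → ℝ) : ℝ := exp (-c * rad z) * (1 + (radSq z)⁻¹)

lemma weight_nonneg (c : ℝ) (z : Fin 4 → ℝ) : 0 ≤ weight c z := by
  have := radSq_nonneg z
  unfold weight; positivity

lemma measurable_weight (c : ℝ) : Measurable (weight c) := by
  unfold weight
  have := continuous_rad.measurable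
  have := continuous_radSq.measurable
  fun_prop

lemma integrable_comp_abs_of_integrableOn {f : ℝ → ℝ} (hf : IntegrableOn f (Ioi 0)) :
    Integrable (fun t => f |t|) := by
  have h1 : IntegrableOn (fun t => f |t|) (Ioi 0) :=
    hf.congr_fun (fun t ht => by simp [abs_of_pos (mem_Ioi.1 ht)]) measurableSet_Ioi
  have h2 : IntegrableOn (fun t => f |t|) (Iio 0) := by
    have := (Measure.measurePreserving_neg (volume : Measure ℝ)).integrableOn_comp_preimage
      (MeasurableEquiv.neg ℝ).measurableEmbedding (f := fun t => f |t|) (s := Ioi 0)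
    simpa [Function.comp_def] using this.2 h1
  rw [← integrableOn_univ, ← Iio_union_Ici (a := (0 : ℝ))]
  exact h2.union ((integrableOn_Ici_iff_integrableOn_Ioi (by simp)).2 h1)

lemma integrable_exp_neg_mul_abs_mul {c : ℝ} (hc : 0 < c) :
    Integrable (fun t : ℝ => exp (-c * |t|) * (1 + (t ^ 2) ^ (-(1 / 3) : ℝ))) := by
  have h0 := integrableOn_rpow_mul_exp_neg_mul_rpow (s := 0) (p := 1) (b := c)
    (by norm_num) one_pos hc
  have h1 := integrableOn_rpow_mul_exp_neg_mul_rpow (s := -(2 / 3)) (p := 1) (b := c)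
    (by norm_num) one_pos hc
  refine (integrable_comp_abs_of_integrableOn (h0.add h1)).congr (ae_of_all _ fun t => ?_)
  have : (t ^ 2) ^ (-(1 / 3) : ℝ) = |t| ^ (-(2 / 3) : ℝ) := by
    rw [← sq_abs, ← rpow_natCast, ← rpow_mul (abs_nonneg _)]; norm_num
  simp only [Pi.add_apply, rpow_zero, one_mul, rpow_one, this]
  ring

lemma inv_radSq_le (z : Fin 4 → ℝ) (h0 : z 0 ≠ 0) (h1 : z 1 ≠ 0) (h2 : z 2 ≠ 0) :
    (radSq z)⁻¹ ≤ (z 0 ^ 2) ^ (-(1 / 3) : ℝ) * (z 1 ^ 2) ^ (-(1 / 3) : ℝ) *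
      (z 2 ^ 2) ^ (-(1 / 3) : ℝ) := by
  have hq : 0 < radSq z := by unfold radSq; positivity
  have key : ∀ t : ℝ, t ≠ 0 → t ^ 2 ≤ radSq z →
      (radSq z) ^ (-(1 / 3) : ℝ) ≤ (t ^ 2) ^ (-(1 / 3) : ℝ) := fun t ht h =>
    rpow_le_rpow_of_nonpos (by positivity) h (by norm_num)
  have e : (radSq z)⁻¹ = (radSq z) ^ (-(1 / 3) : ℝ) * (radSq z) ^ (-(1 / 3) : ℝ) *
      (radSq z) ^ (-(1 / 3) : ℝ) := by
    rw [← rpow_add hq, ← rpow_add hq, ← rpow_neg_one]; norm_num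
  rw [e]
  have k0 := key _ h0 (by unfold radSq; nlinarith [sq_nonneg (z 1), sq_nonneg (z 2)])
  have k1 := key _ h1 (by unfold radSq; nlinarith [sq_nonneg (z 0), sq_nonneg (z 2)])
  have k2 := key _ h2 (by unfold radSq; nlinarith [sq_nonneg (z 1), sq_nonneg (z 0)])
  gcongr

lemma integrable_weight_mul {c : ℝ} (hc : 0 < c) :
    Integrable (fun z : Fin 4 → ℝ => weight c z * (1 + z 3 ^ 2)⁻¹) := by
  let φ : Fin 4 → ℝ → ℝ := fun i => if i = 3 then fun t => (1 + t ^ 2)⁻¹ else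
    fun t => exp (-(c / 3) * |t|) * (1 + (t ^ 2) ^ (-(1 / 3) : ℝ))
  have hφ : ∀ i, Integrable (φ i) := fun i => by
    by_cases hi : i = 3
    · simp only [φ, hi, if_true]; exact integrable_inv_one_add_sq
    · simp only [φ, hi, if_false]; exact integrable_exp_neg_mul_abs_mul (by positivity)
  have hI : Integrable (fun z : Fin 4 → ℝ => ∏ i, φ i (z i)) :=
    Integrable.fintype_prod_dep hφ
  refine hI.mono' (((measurable_weight c).mul (by fun_prop)).aestronglyMeasurable) ?_
  filter_upwards [ae_apply_ne_zero 0, ae_apply_ne_zero 1, ae_apply_ne_zero 2] with z h0 h1 h2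
  have hw := weight_nonneg c z
  rw [norm_of_nonneg (by positivity)]
  have hprod : ∏ i, φ i (z i) = φ 0 (z 0) * φ 1 (z 1) * φ 2 (z 2) * φ 3 (z 3) :=
    Fin.prod_univ_four _
  rw [hprod]
  simp only [φ, show (0 : Fin 4) ≠ 3 by decide, show (1 : Fin 4) ≠ 3 by decide,
    show (2 : Fin 4) ≠ 3 by decide, if_true, if_false]
  refine mul_le_mul_of_nonneg_right ?_ (by positivity)
  have hE : exp (-c * rad z) ≤ exp (-(c / 3) * |z 0|) * exp (-(c / 3) * |z 1|) *
      exp (-(c / 3) * |z 2|) := by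
    rw [← exp_add, ← exp_add, exp_le_exp]
    nlinarith [abs_le_rad z 0 (by decide), abs_le_rad z 1 (by decide), abs_le_rad z 2 (by decide)]
  have hA := inv_radSq_le z h0 h1 h2
  set A := (z 0 ^ 2) ^ (-(1 / 3) : ℝ)
  set B := (z 1 ^ 2) ^ (-(1 / 3) : ℝ)
  set D := (z 2 ^ 2) ^ (-(1 / 3) : ℝ)
  have a0 : 0 ≤ A := by positivity
  have b0 : 0 ≤ B := by positivity
  have d0 : 0 ≤ D := by positivity
  have h3 : 1 + (radSq z)⁻¹ ≤ (1 + A) * (1 + B) * (1 + D) := by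
    have : 0 ≤ A + B + D + A * B + A * D + B * D := by positivity
    nlinarith
  calc weight c z ≤ (exp (-(c / 3) * |z 0|) * exp (-(c / 3) * |z 1|) *
      exp (-(c / 3) * |z 2|)) * ((1 + A) * (1 + B) * (1 + D)) := by
        have := radSq_nonneg z
        unfold weight; gcongr
    _ = _ := by ring

lemma integrableOn_weight {c : ℝ} (hc : 0 < c) : IntegrableOn (weight c) cell := by
  refine Integrable.mono' ((integrable_weight_mul hc).integrableOn.const_mul (1 + π ^ 2))
    (measurable_weight c).aestronglyMeasurable ?_
  filter_upwards [ae_restrict_mem measurableSet_cell] with z hz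
  have hw := weight_nonneg c z
  rw [norm_of_nonneg hw]
  have h1 : z 3 ^ 2 ≤ π ^ 2 := sq_le_sq' hz.1.le hz.2
  have : 1 ≤ (1 + π ^ 2) * (1 + z 3 ^ 2)⁻¹ := by
    rw [← div_eq_mul_inv, le_div_iff₀ (by positivity)]; linarith
  nlinarith

end CylinderLiouville

namespace CylinderLiouville
open Real Set Filter Topology

/-- The regularized radius `√(r² + a)`. -/
noncomputable def reg (a : ℝ) (z : Fin 4 → ℝ) : ℝ := √(radSq z + a)

/-- The regularized expression `2 cosh r - 2 cos y`. -/
noncomputable def sden (a : ℝ) (z : Fin 4 → ℝ) : ℝ := 2 * cosh (reg a z) - 2 * cos (z 3)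

/-- The (regularized) logarithmic kernel. -/
noncomputable def ker (a : ℝ) (z : Fin 4 → ℝ) : ℝ := log (sden a z)

/-- The first partial derivatives of the kernel. -/
noncomputable def dker (a : ℝ) (i : Fin 4) (z : Fin 4 → ℝ) : ℝ :=
  if i = 3 then 2 * sin (z 3) / sden a z
  else 2 * z i * (sinh (reg a z) / reg a z) / sden a z

/-- The unmixed second partial derivatives of the kernel. -/
noncomputable def ddker (a : ℝ) (i : Fin 4) (z : Fin 4 → ℝ) : ℝ :=
  if i = 3 then 2 * cos (z 3) / sden a z - 4 * sin (z 3) ^ 2 / sden a z ^ 2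
  else 2 * (sinh (reg a z) / reg a z) / sden a z
    + 2 * z i ^ 2 * ((reg a z * cosh (reg a z) - sinh (reg a z)) / reg a z ^ 3) / sden a z
    - 4 * z i ^ 2 * (sinh (reg a z) / reg a z) ^ 2 / sden a z ^ 2

lemma one_add_sq_div_two_le_cosh (t : ℝ) : 1 + t ^ 2 / 2 ≤ cosh t := by
  have h1 : cosh t = 1 + 2 * sinh (t / 2) ^ 2 := by
    have := cosh_two_mul (t / 2)
    rw [show 2 * (t / 2) = t by ring, cosh_sq] at this
    linarith
  have h2 : (t / 2) ^ 2 ≤ sinh (t / 2) ^ 2 := by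
    rw [sq_le_sq]
    rcases le_total 0 t with h | h
    · have := self_le_sinh_iff.2 (show 0 ≤ t / 2 by linarith)
      rw [abs_of_nonneg (by linarith), abs_of_nonneg (by linarith)]; exact this
    · have := sinh_le_self_iff.2 (show t / 2 ≤ 0 by linarith)
      rw [abs_of_nonpos (by linarith), abs_of_nonpos (by linarith)]; linarith
  nlinarith

lemma sinh_le_mul_cosh {t : ℝ} (ht : 0 ≤ t) : sinh t ≤ t * cosh t := by
  have hd : ∀ x : ℝ, HasDerivAt (fun t => t * cosh t - sinh t) (x * sinh x) x := fun x => by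
    refine (((hasDerivAt_id x).mul (hasDerivAt_cosh x)).sub (hasDerivAt_sinh x)).congr_deriv ?_
    simp
  have : MonotoneOn (fun t => t * cosh t - sinh t) (Ici 0) := by
    refine monotoneOn_of_deriv_nonneg (convex_Ici 0)
      (fun x _ => (hd x).continuousAt.continuousWithinAt)
      (fun x _ => (hd x).differentiableAt.differentiableWithinAt) fun x hx => ?_
    rw [(hd x).deriv]
    rw [interior_Ici] at hx
    exact mul_nonneg hx.le (sinh_nonneg_iff.2 hx.le)
  have h := this self_mem_Ici ht ht
  simp at h
  linarith

variable {a : ℝ} {z : Fin 4 → ℝ}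

lemma reg_nonneg (a : ℝ) (z : Fin 4 → ℝ) : 0 ≤ reg a z := Real.sqrt_nonneg _

lemma reg_sq (h : 0 < radSq z + a) : reg a z ^ 2 = radSq z + a := Real.sq_sqrt h.le

lemma reg_pos (h : 0 < radSq z + a) : 0 < reg a z := Real.sqrt_pos.2 h

lemma reg_zero (z : Fin 4 → ℝ) : reg 0 z = rad z := by simp [reg, rad]

lemma radSq_add_le_sden (h : 0 < radSq z + a) : radSq z + a ≤ sden a z := by
  have := one_add_sq_div_two_le_cosh (reg a z)
  rw [reg_sq h] at this
  have := cos_le_one (z 3)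
  unfold sden; linarith

lemma sden_pos (h : 0 < radSq z + a) : 0 < sden a z := h.trans_le (radSq_add_le_sden h)

lemma cosh_reg_le (a : ℝ) (z : Fin 4 → ℝ) : cosh (reg a z) ≤ sden a z / 2 + 1 := by
  have := cos_le_one (z 3)
  unfold sden; linarith

lemma sinh_sq_add_sin_sq (a : ℝ) (z : Fin 4 → ℝ) :
    4 * (sinh (reg a z) ^ 2 + sin (z 3) ^ 2)
      = sden a z * (2 * cosh (reg a z) + 2 * cos (z 3)) := by
  rw [sinh_sq, sin_sq]; unfold sden; ring

lemma sinh_sq_add_sin_sq_le (h : 0 < radSq z + a) :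
    4 * (sinh (reg a z) ^ 2 + sin (z 3) ^ 2) ≤ sden a z ^ 2 + 4 * sden a z := by
  rw [sinh_sq_add_sin_sq]
  have := cos_le_one (z 3)
  have := cosh_reg_le a z
  nlinarith [sden_pos h]

lemma sq_apply_le_radSq (i : Fin 4) (hi : i ≠ 3) : z i ^ 2 ≤ radSq z := by
  rw [← rad_sq, sq_le_sq, abs_of_nonneg (rad_nonneg z)]; exact abs_le_rad z i hi

lemma abs_dker_le (ha : 0 ≤ a) (h : 0 < radSq z + a) (i : Fin 4) :
    |dker a i z| ≤ 2 + (sden a z)⁻¹ := by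
  have hs := sden_pos h
  have hs' := inv_pos.2 hs
  have hb := sinh_sq_add_sin_sq_le h
  have key : ∀ t : ℝ, 4 * t ^ 2 ≤ sden a z ^ 2 + 4 * sden a z →
      |2 * t / sden a z| ≤ 2 + (sden a z)⁻¹ := by
    intro t ht
    apply abs_le_of_sq_le_sq _ (by positivity)
    rw [div_pow, div_le_iff₀ (by positivity), ← mul_pow, add_mul, inv_mul_cancel₀ hs.ne']
    nlinarith
  unfold dker
  split_ifs with hi
  · exact key _ (by nlinarith [sq_nonneg (sinh (reg a z))])
  · have h1 := sq_apply_le_radSq (z := z) i hi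
    have hr := reg_pos h
    have h2 : (z i * (sinh (reg a z) / reg a z)) ^ 2 ≤ sinh (reg a z) ^ 2 := by
      rw [mul_pow, div_pow, mul_div_assoc', div_le_iff₀ (by positivity), reg_sq h]
      nlinarith [sq_nonneg (sinh (reg a z))]
    have := key (z i * (sinh (reg a z) / reg a z)) (by nlinarith [sq_nonneg (sin (z 3))])
    rwa [← mul_assoc] at this

lemma abs_ddker_le (ha : 0 ≤ a) (h : 0 < radSq z + a) (i : Fin 4) :
    |ddker a i z| ≤ 3 + 8 * (sden a z)⁻¹ := by
  have hs := sden_pos h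
  have hs' := inv_pos.2 hs
  have hb := sinh_sq_add_sin_sq_le h
  have hr := reg_pos h
  have hc := cosh_reg_le a z
  have hsn : 0 ≤ sinh (reg a z) := sinh_nonneg_iff.2 hr.le
  unfold ddker
  split_ifs with hi
  · have h1 : |2 * cos (z 3) / sden a z| ≤ 2 * (sden a z)⁻¹ := by
      rw [abs_div, abs_mul, abs_of_pos hs, abs_two, div_eq_mul_inv]
      have := abs_cos_le_one (z 3)
      gcongr; linarith
    have h2 : |4 * sin (z 3) ^ 2 / sden a z ^ 2| ≤ 1 + 4 * (sden a z)⁻¹ := by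
      rw [abs_of_nonneg (by positivity), div_le_iff₀ (by positivity)]
      have : (1 + 4 * (sden a z)⁻¹) * sden a z ^ 2 = sden a z ^ 2 + 4 * sden a z := by
        field_simp
      rw [this]; nlinarith [sq_nonneg (sinh (reg a z))]
    exact (abs_sub _ _).trans (by linarith)
  · have hq := sq_apply_le_radSq (z := z) i hi
    have hq2 : z i ^ 2 ≤ reg a z ^ 2 := by rw [reg_sq h]; linarith
    have hl := sinh_le_mul_cosh hr.le
    have h0 : sinh (reg a z) / reg a z ≤ sden a z / 2 + 1 := by
      refine le_trans ?_ hc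
      rw [div_le_iff₀ hr]; linarith
    have h0' : 0 ≤ sinh (reg a z) / reg a z := by positivity
    have h1 : |2 * (sinh (reg a z) / reg a z) / sden a z| ≤ 1 + 2 * (sden a z)⁻¹ := by
      rw [abs_of_nonneg (by positivity), div_le_iff₀ hs, add_mul, mul_assoc,
        inv_mul_cancel₀ hs.ne']
      linarith
    have h2' : z i ^ 2 * ((reg a z * cosh (reg a z) - sinh (reg a z)) / reg a z ^ 3)
        ≤ sden a z / 2 + 1 := by
      refine le_trans ?_ hc
      rw [mul_div_assoc', div_le_iff₀ (by positivity)]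
      calc _ ≤ reg a z ^ 2 * (reg a z * cosh (reg a z) - sinh (reg a z)) := by
            gcongr
        _ ≤ reg a z ^ 2 * (reg a z * cosh (reg a z)) := by gcongr; exact sub_le_self _ hsn
        _ = _ := by ring
    have h2'' : 0 ≤ z i ^ 2 * ((reg a z * cosh (reg a z) - sinh (reg a z)) / reg a z ^ 3) :=
      mul_nonneg (by positivity) (div_nonneg (by linarith) (by positivity))
    have h2 : |2 * z i ^ 2 * ((reg a z * cosh (reg a z) - sinh (reg a z)) / reg a z ^ 3)
        / sden a z| ≤ 1 + 2 * (sden a z)⁻¹ := by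
      rw [mul_assoc, abs_of_nonneg (by positivity), div_le_iff₀ hs, add_mul, mul_assoc,
        inv_mul_cancel₀ hs.ne']
      linarith
    have h3 : |4 * z i ^ 2 * (sinh (reg a z) / reg a z) ^ 2 / sden a z ^ 2|
        ≤ 1 + 4 * (sden a z)⁻¹ := by
      rw [abs_of_nonneg (by positivity), div_le_iff₀ (by positivity)]
      have : (1 + 4 * (sden a z)⁻¹) * sden a z ^ 2 = sden a z ^ 2 + 4 * sden a z := by
        field_simp
      rw [this]
      have h2 : z i ^ 2 * (sinh (reg a z) / reg a z) ^ 2 ≤ sinh (reg a z) ^ 2 := by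
        rw [div_pow, mul_div_assoc', div_le_iff₀ (by positivity)]
        nlinarith [sq_nonneg (sinh (reg a z))]
      nlinarith [sq_nonneg (sin (z 3))]
    refine (abs_sub _ _).trans ?_
    refine (add_le_add_left (abs_add_le _ _) _).trans ?_
    linarith

lemma inv_sden_le (ha : 0 ≤ a) (h : 0 < radSq z) : (sden a z)⁻¹ ≤ (radSq z)⁻¹ := by
  apply inv_anti₀ h
  linarith [radSq_add_le_sden (a := a) (z := z) (by linarith)]

lemma reg_le (ha1 : a ≤ 1) : reg a z ≤ rad z + 1 := by
  unfold reg
  rw [Real.sqrt_le_left (by linarith [rad_nonneg z])]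
  nlinarith [rad_sq z, rad_nonneg z]

lemma sden_le (ha1 : a ≤ 1) : sden a z ≤ 4 * exp (rad z + 1) := by
  have h1 : cosh (reg a z) ≤ exp (reg a z) := by
    rw [cosh_eq]
    have : exp (-reg a z) ≤ exp (reg a z) := exp_le_exp.2 (by linarith [reg_nonneg a z])
    linarith
  have h2 : exp (reg a z) ≤ exp (rad z + 1) := exp_le_exp.2 (reg_le ha1)
  have h3 : 1 ≤ exp (rad z + 1) := one_le_exp (by linarith [rad_nonneg z])
  have := neg_one_le_cos (z 3)
  unfold sden; linarith

lemma ker_le (ha1 : a ≤ 1) (h : 0 < radSq z + a) : ker a z ≤ rad z + 3 := by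
  unfold ker
  rw [log_le_iff_le_exp (sden_pos h)]
  refine (sden_le ha1).trans ?_
  have h2 : (4 : ℝ) ≤ exp 2 := by
    have := add_one_le_exp (1 : ℝ)
    have h : exp 2 = exp 1 * exp 1 := by rw [← exp_add]; norm_num
    nlinarith
  calc _ ≤ exp 2 * exp (rad z + 1) := by gcongr
    _ = exp (rad z + 3) := by rw [← exp_add]; ring_nf

lemma abs_ker_le (ha : 0 ≤ a) (ha1 : a ≤ 1) (h : 0 < radSq z) :
    |ker a z| ≤ rad z + 3 + (radSq z)⁻¹ := by
  have hs := sden_pos (a := a) (z := z) (by linarith)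
  have h0 := rad_nonneg z
  rw [abs_le]
  constructor
  · have h1 := one_sub_inv_le_log_of_pos hs
    have h2 := inv_sden_le ha h
    unfold ker; linarith
  · have := ker_le (z := z) ha1 (by linarith)
    have := inv_pos.2 h
    linarith

/-- A common majorant of the kernel and its derivatives. -/
noncomputable def kerBound (z : Fin 4 → ℝ) : ℝ := 8 * (1 + rad z) * (1 + (radSq z)⁻¹)

lemma kerBound_nonneg (z : Fin 4 → ℝ) : 0 ≤ kerBound z := by
  have := rad_nonneg z; have := radSq_nonneg z
  unfold kerBound; positivity

lemma abs_ker_le_kerBound (ha : 0 ≤ a) (ha1 : a ≤ 1) (h : 0 < radSq z) :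
    |ker a z| ≤ kerBound z := by
  have := abs_ker_le ha ha1 h
  have h0 := rad_nonneg z
  have := inv_pos.2 h
  unfold kerBound; nlinarith

lemma abs_dker_le_kerBound (ha : 0 ≤ a) (h : 0 < radSq z) (i : Fin 4) :
    |dker a i z| ≤ kerBound z := by
  have := abs_dker_le ha (z := z) (by linarith) i
  have := inv_sden_le ha h
  have h0 := rad_nonneg z
  have := inv_pos.2 h
  unfold kerBound; nlinarith

lemma abs_ddker_le_kerBound (ha : 0 ≤ a) (h : 0 < radSq z) (i : Fin 4) :
    |ddker a i z| ≤ kerBound z := by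
  have := abs_ddker_le ha (z := z) (by linarith) i
  have := inv_sden_le ha h
  have h0 := rad_nonneg z
  have := inv_pos.2 h
  unfold kerBound; nlinarith

lemma kerBound_mul_exp_le {c : ℝ} (hc : 0 < c) (z : Fin 4 → ℝ) :
    kerBound z * exp (-c * rad z) ≤ 8 * (1 + 2 / c) * weight (c / 2) z := by
  have h0 := rad_nonneg z
  have hq : 0 ≤ (radSq z)⁻¹ := inv_nonneg.2 (radSq_nonneg z)
  have h1 : 1 + rad z ≤ (1 + 2 / c) * exp (c / 2 * rad z) := by
    have e1 := add_one_le_exp (c / 2 * rad z)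
    have e2 : 1 ≤ exp (c / 2 * rad z) := one_le_exp (by positivity)
    have e3 : rad z = 2 / c * (c / 2 * rad z) := by field_simp
    have e4 : 2 / c * (c / 2 * rad z) ≤ 2 / c * exp (c / 2 * rad z) := by gcongr; linarith
    linarith
  unfold kerBound weight
  calc 8 * (1 + rad z) * (1 + (radSq z)⁻¹) * exp (-c * rad z)
      ≤ 8 * ((1 + 2 / c) * exp (c / 2 * rad z)) * (1 + (radSq z)⁻¹) * exp (-c * rad z) := by
        gcongr
    _ = 8 * (1 + 2 / c) * ((exp (c / 2 * rad z) * exp (-c * rad z)) * (1 + (radSq z)⁻¹)) := by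
        ring
    _ = _ := by rw [← exp_add]; ring_nf

lemma integrableOn_kerBound {c : ℝ} (hc : 0 < c) :
    IntegrableOn (fun z => kerBound z * exp (-c * rad z)) cell := by
  refine Integrable.mono' ((integrableOn_weight (half_pos hc)).const_mul (8 * (1 + 2 / c))) ?_ ?_
  · refine Measurable.aestronglyMeasurable ?_
    unfold kerBound
    have := continuous_rad.measurable; have := continuous_radSq.measurable
    fun_prop
  · refine Eventually.of_forall fun z => ?_
    rw [norm_of_nonneg (mul_nonneg (kerBound_nonneg z) (exp_pos _).le)]
    exact kerBound_mul_exp_le hc z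

@[fun_prop]
lemma continuous_reg (a : ℝ) : Continuous (reg a) := by unfold reg; fun_prop

@[fun_prop]
lemma continuous_sden (a : ℝ) : Continuous (sden a) := by
  unfold sden
  have := continuous_cosh
  fun_prop

lemma continuous_reg_param (z : Fin 4 → ℝ) : Continuous fun a => reg a z := by
  unfold reg; fun_prop

lemma measurable_ker (a : ℝ) : Measurable (ker a) := by
  unfold ker; exact measurable_log.comp (continuous_sden a).measurable

lemma measurable_dker (a : ℝ) (i : Fin 4) : Measurable (dker a i) := by
  have := (continuous_sden a).measurable; have := (continuous_reg a).measurable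
  have := continuous_sinh.measurable
  unfold dker
  split_ifs <;> fun_prop

lemma measurable_ddker (a : ℝ) (i : Fin 4) : Measurable (ddker a i) := by
  have := (continuous_sden a).measurable; have := (continuous_reg a).measurable
  have := continuous_sinh.measurable; have := continuous_cosh.measurable
  unfold ddker
  split_ifs <;> fun_prop

lemma continuousAt_sden_param (z : Fin 4 → ℝ) : Continuous fun a => sden a z := by
  unfold sden
  have := continuous_reg_param z
  have := continuous_cosh
  fun_prop

lemma tendsto_ker (h : 0 < radSq z) : Tendsto (fun a => ker a z) (𝓝 0) (𝓝 (ker 0 z)) := by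
  have h0 : 0 < radSq z + 0 := by linarith
  exact ((continuousAt_sden_param z).continuousAt.log (sden_pos h0).ne')

lemma tendsto_dker (h : 0 < radSq z) (i : Fin 4) :
    Tendsto (fun a => dker a i z) (𝓝 0) (𝓝 (dker 0 i z)) := by
  have h0 : 0 < radSq z + 0 := by linarith
  have h1 := (sden_pos h0).ne'
  have h2 := (reg_pos h0).ne'
  have c1 := (continuousAt_sden_param z).continuousAt (x := (0 : ℝ))
  have c2 := (continuous_reg_param z).continuousAt (x := (0 : ℝ))
  have c3 : ContinuousAt (fun a => sinh (reg a z)) 0 :=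
    continuous_sinh.continuousAt.comp c2
  unfold dker
  split_ifs
  · exact (continuousAt_const.div c1 h1)
  · exact (continuousAt_const.mul (c3.div c2 h2)).div c1 h1

lemma tendsto_ddker (h : 0 < radSq z) (i : Fin 4) :
    Tendsto (fun a => ddker a i z) (𝓝 0) (𝓝 (ddker 0 i z)) := by
  have h0 : 0 < radSq z + 0 := by linarith
  have h1 := (sden_pos h0).ne'
  have h2 := (reg_pos h0).ne'
  have c1 := (continuousAt_sden_param z).continuousAt (x := (0 : ℝ))
  have c2 := (continuous_reg_param z).continuousAt (x := (0 : ℝ))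
  have c3 : ContinuousAt (fun a => sinh (reg a z)) 0 :=
    continuous_sinh.continuousAt.comp c2
  have c4 : ContinuousAt (fun a => cosh (reg a z)) 0 :=
    continuous_cosh.continuousAt.comp c2
  unfold ddker
  split_ifs
  · exact (continuousAt_const.div c1 h1).sub
      (continuousAt_const.div (c1.pow 2) (pow_ne_zero 2 h1))
  · exact ((((continuousAt_const.mul (c3.div c2 h2)).div c1 h1).add
      ((continuousAt_const.mul (((c2.mul c4).sub c3).div (c2.pow 3) (pow_ne_zero 3 h2))).div
        c1 h1))).sub ((continuousAt_const.mul ((c3.div c2 h2).pow 2)).div (c1.pow 2)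
        (pow_ne_zero 2 h1))

lemma sum_ddker (h : 0 < radSq z) :
    ∑ i, ddker 0 i z = 4 * (sinh (rad z) / rad z) / sden 0 z := by
  have h0 : 0 < radSq z + 0 := by linarith
  have h1 := (sden_pos h0).ne'
  have h2 := (reg_pos h0).ne'
  have hs := sinh_sq_add_sin_sq 0 z
  have hq := reg_sq h0
  rw [reg_zero] at *
  simp only [Fin.sum_univ_four, ddker, reg_zero, Fin.isValue, if_true, Fin.reduceEq, if_false]
  have e : ∀ A B : ℝ, ∀ s : ℝ, 2 * A / s + 2 * z 0 ^ 2 * B / s - 4 * z 0 ^ 2 * A ^ 2 / s ^ 2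
    + (2 * A / s + 2 * z 1 ^ 2 * B / s - 4 * z 1 ^ 2 * A ^ 2 / s ^ 2)
    + (2 * A / s + 2 * z 2 ^ 2 * B / s - 4 * z 2 ^ 2 * A ^ 2 / s ^ 2)
    = 6 * A / s + 2 * (radSq z * B) / s - 4 * (radSq z * A ^ 2) / s ^ 2 := by
    intro A B s; unfold radSq; ring
  rw [e]
  have hq' : radSq z = rad z ^ 2 := by linarith
  have e1 : radSq z * (sinh (rad z) / rad z) ^ 2 = sinh (rad z) ^ 2 := by
    rw [hq']; field_simp
  have e2 : radSq z * ((rad z * cosh (rad z) - sinh (rad z)) / rad z ^ 3)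
      = cosh (rad z) - sinh (rad z) / rad z := by
    rw [hq']; field_simp
  rw [e1, e2]
  have e3 : 4 * sin (z 3) ^ 2 = sden 0 z * (2 * cosh (rad z) + 2 * cos (z 3))
      - 4 * sinh (rad z) ^ 2 := by linarith
  rw [e3]
  generalize sinh (rad z) / rad z = A
  field_simp
  ring

lemma hasFDerivAt_radSq (z : Fin 4 → ℝ) :
    HasFDerivAt radSq (∑ i, (if i = 3 then 0 else 2 * z i) •
      (ContinuousLinearMap.proj (R := ℝ) (φ := fun _ : Fin 4 => ℝ) i)) z := by
  have h : ∀ i : Fin 4, HasFDerivAt (fun z : Fin 4 → ℝ => z i)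
    (ContinuousLinearMap.proj (R := ℝ) (φ := fun _ : Fin 4 => ℝ) i) z :=
    fun i => hasFDerivAt_apply i z
  refine ((((h 0).pow 2).add ((h 1).pow 2)).add ((h 2).pow 2)).congr_fderiv ?_
  simp [Fin.sum_univ_four]

lemma hasFDerivAt_reg (h : 0 < radSq z + a) :
    HasFDerivAt (reg a) (∑ i, (if i = 3 then 0 else z i / reg a z) •
      (ContinuousLinearMap.proj (R := ℝ) (φ := fun _ : Fin 4 => ℝ) i)) z := by
  refine (((hasFDerivAt_radSq z).add_const a).sqrt h.ne').congr_fderiv ?_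
  rw [Finset.smul_sum]
  refine Finset.sum_congr rfl fun i _ => ?_
  rw [smul_smul]
  congr 1
  split_ifs
  · simp
  · have := (reg_pos h).ne'
    unfold reg at *
    field_simp

lemma hasFDerivAt_ker (h : 0 < radSq z + a) :
    HasFDerivAt (ker a) (∑ i, dker a i z •
      (ContinuousLinearMap.proj (R := ℝ) (φ := fun _ : Fin 4 => ℝ) i)) z := by
  have h3 : HasFDerivAt (fun z : Fin 4 → ℝ => z 3)
    (ContinuousLinearMap.proj (R := ℝ) (φ := fun _ : Fin 4 => ℝ) 3) z := hasFDerivAt_apply 3 z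
  refine ((((hasFDerivAt_reg h).cosh.const_mul 2).sub (h3.cos.const_mul 2)).log
    (sden_pos h).ne').congr_fderiv ?_
  have hs := (sden_pos h).ne'
  ext w
  simp [dker, Fin.sum_univ_four]
  change (sden a z)⁻¹ * _ = _
  field_simp

lemma hasDerivAt_dker (h : 0 < radSq z + a) (i : Fin 4) :
    HasDerivAt (fun t => dker a i (Function.update z i t)) (ddker a i z) (z i) := by
  have hu : HasDerivAt (Function.update z i) (Pi.single i 1) (z i) := hasDerivAt_update z i (z i)
  have hself : Function.update z i (z i) = z := Function.update_eq_self i z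
  have hr : HasDerivAt (fun t => reg a (Function.update z i t))
      (if i = 3 then 0 else z i / reg a z) (z i) := by
    have h' := hasFDerivAt_reg h
    rw [← hself] at h'
    refine (h'.comp_hasDerivAt (z i) hu).congr_deriv ?_
    rw [hself]
    fin_cases i <;> simp [Fin.sum_univ_four]
  have hsd : HasDerivAt (fun t => sden a (Function.update z i t))
      (sden a z * dker a i z) (z i) := by
    have h3 : HasDerivAt (fun t => Function.update z i t 3) (if i = 3 then 1 else 0) (z i) := by
      refine (hasDerivAt_pi.1 hu 3).congr_deriv ?_
      simp [Pi.single_apply, eq_comm]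
    refine ((hr.cosh.const_mul 2).sub (h3.cos.const_mul 2)).congr_deriv ?_
    have := (sden_pos h).ne'
    rw [hself]
    unfold dker
    split_ifs
    · field_simp; ring
    · field_simp; ring
  have hs := (sden_pos h).ne'
  have hr0 := (reg_pos h).ne'
  unfold dker at *
  unfold ddker
  split_ifs at * with hi
  · subst hi
    simp only [Function.update_self]
    refine (((hasDerivAt_sin (z 3)).const_mul 2).div hsd (by rwa [hself])).congr_deriv ?_
    rw [hself]
    field_simp
    ring
  · simp only [Function.update_self]
    refine ((((hasDerivAt_id (z i)).const_mul 2).mul (hr.sinh.div hr (by rwa [hself]))).div hsd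
      (by rwa [hself])).congr_deriv ?_
    simp only [hself, id, Pi.mul_apply, Pi.div_apply]
    field_simp
    ring

lemma reg_add_shift (a : ℝ) (z : Fin 4 → ℝ) : reg a (z + shift) = reg a z := by
  simp [reg, radSq_add_shift]

lemma periodic_sden (a : ℝ) : Function.Periodic (sden a) shift := fun z => by
  simp [sden, reg_add_shift, shift_apply_three]

lemma periodic_ker (a : ℝ) : Function.Periodic (ker a) shift := fun z => by
  simp [ker, periodic_sden a z]

lemma periodic_dker (a : ℝ) (i : Fin 4) : Function.Periodic (dker a i) shift := fun z => by
  unfold dker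
  split_ifs with hi
  · simp [periodic_sden a z, shift_apply_three]
  · simp [periodic_sden a z, reg_add_shift, shift_apply_of_ne hi]

lemma periodic_ddker (a : ℝ) (i : Fin 4) : Function.Periodic (ddker a i) shift := fun z => by
  unfold ddker
  split_ifs with hi
  · simp [periodic_sden a z, shift_apply_three]
  · simp [periodic_sden a z, reg_add_shift, shift_apply_of_ne hi]

lemma sden_neg (a : ℝ) (z : Fin 4 → ℝ) : sden a (-z) = sden a z := by
  simp [sden, reg, radSq_neg]

lemma ker_neg (a : ℝ) (z : Fin 4 → ℝ) : ker a (-z) = ker a z := by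
  simp [ker, sden_neg]

end CylinderLiouville

namespace CylinderLiouville
open Real Set Filter Topology

/-- Continuous periodic functions of size `O(exp (-c r))`. -/
structure Decays (c : ℝ) (f : (Fin 4 → ℝ) → ℝ) : Prop where
  cont : Continuous f
  periodic : Function.Periodic f shift
  bound : ∃ C, 0 ≤ C ∧ ∀ x, |f x| ≤ C * exp (-c * rad x)

/-- Periodic kernels with at most the singularity and growth of `kerBound`. -/
structure IsKernel (k : (Fin 4 → ℝ) → ℝ) : Prop where
  meas : Measurable k
  periodic : Function.Periodic k shift
  bound : ∀ z, 0 < radSq z → |k z| ≤ kerBound z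

lemma isKernel_ker {a : ℝ} (ha : 0 ≤ a) (ha1 : a ≤ 1) : IsKernel (ker a) :=
  ⟨measurable_ker a, periodic_ker a, fun _ h => abs_ker_le_kerBound ha ha1 h⟩

lemma isKernel_dker {a : ℝ} (ha : 0 ≤ a) (i : Fin 4) : IsKernel (dker a i) :=
  ⟨measurable_dker a i, periodic_dker a i, fun _ h => abs_dker_le_kerBound ha h i⟩

lemma isKernel_ddker {a : ℝ} (ha : 0 ≤ a) (i : Fin 4) : IsKernel (ddker a i) :=
  ⟨measurable_ddker a i, periodic_ddker a i, fun _ h => abs_ddker_le_kerBound ha h i⟩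

/-- Convolution over one period cell. -/
noncomputable def conv (k f : (Fin 4 → ℝ) → ℝ) (x : Fin 4 → ℝ) : ℝ := ∫ z in cell, k z * f (x - z)

lemma exp_neg_rad_sub_le {c : ℝ} (hc : 0 ≤ c) (x z : Fin 4 → ℝ) :
    exp (-c * rad (x - z)) ≤ exp (c * rad x) * exp (-c * rad z) := by
  rw [← exp_add]
  apply exp_le_exp.2
  have := rad_le_sub_add z x
  rw [rad_sub_comm] at this
  nlinarith

variable {c : ℝ} {f g k : (Fin 4 → ℝ) → ℝ}

lemma Decays.bound_sub (hc : 0 ≤ c) (hf : Decays c f) : ∃ C, 0 ≤ C ∧ ∀ R x z, rad x ≤ R →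
    |f (x - z)| ≤ C * exp (c * R) * exp (-c * rad z) := by
  obtain ⟨C, hC, h⟩ := hf.bound
  refine ⟨C, hC, fun R x z hx => (h _).trans ?_⟩
  rw [mul_assoc]
  gcongr
  refine (exp_neg_rad_sub_le hc x z).trans ?_
  gcongr

lemma ae_cell_radSq_pos : ∀ᵐ z : Fin 4 → ℝ ∂(volume.restrict cell), 0 < radSq z :=
  ae_restrict_of_ae ae_radSq_pos

lemma IsKernel.norm_mul_le (hk : IsKernel k) {C R t : ℝ} {z : Fin 4 → ℝ}
    (hz : 0 < radSq z) (ht : |t| ≤ C * exp (c * R) * exp (-c * rad z)) :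
    ‖k z * t‖ ≤ C * exp (c * R) * (kerBound z * exp (-c * rad z)) := by
  rw [norm_mul, Real.norm_eq_abs, Real.norm_eq_abs]
  calc _ ≤ kerBound z * (C * exp (c * R) * exp (-c * rad z)) :=
        mul_le_mul (hk.bound z hz) ht (abs_nonneg _) (kerBound_nonneg z)
    _ = _ := by ring

lemma conv_aestronglyMeasurable (hk : Measurable k) (hf : Continuous f) (x : Fin 4 → ℝ) :
    AEStronglyMeasurable (fun z => k z * f (x - z)) (volume.restrict cell) :=
  (hk.mul (hf.measurable.comp (by fun_prop))).aestronglyMeasurable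

lemma integrableOn_conv (hc : 0 < c) (hk : IsKernel k) (hf : Decays c f) (x : Fin 4 → ℝ) :
    IntegrableOn (fun z => k z * f (x - z)) cell := by
  obtain ⟨C, hC, h⟩ := hf.bound_sub hc.le
  refine Integrable.mono' ((integrableOn_kerBound hc).const_mul (C * exp (c * rad x)))
    (conv_aestronglyMeasurable hk.meas hf.cont x) ?_
  filter_upwards [ae_cell_radSq_pos] with z hz
  exact hk.norm_mul_le hz (h _ x z le_rfl)

lemma continuous_conv (hc : 0 < c) (hk : IsKernel k) (hf : Decays c f) :
    Continuous (conv k f) := by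
  obtain ⟨C, hC, h⟩ := hf.bound_sub hc.le
  rw [continuous_iff_continuousAt]
  intro x
  refine continuousAt_of_dominated (bound := fun z =>
    C * exp (c * (rad x + 1)) * (kerBound z * exp (-c * rad z)))
    (Eventually.of_forall fun y => conv_aestronglyMeasurable hk.meas hf.cont y) ?_
    ((integrableOn_kerBound hc).const_mul _) ?_
  · have : ∀ᶠ y in 𝓝 x, rad y < rad x + 1 :=
      continuous_rad.continuousAt.eventually (Iio_mem_nhds (by linarith))
    filter_upwards [this] with y hy
    filter_upwards [ae_cell_radSq_pos] with z hz
    exact hk.norm_mul_le hz (h _ y z hy.le)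
  · refine Eventually.of_forall fun z => ?_
    have := hf.cont
    fun_prop

lemma periodic_conv (hf : Function.Periodic f shift) : Function.Periodic (conv k f) shift := by
  intro x
  unfold conv
  congr 1
  ext z
  rw [show x + shift - z = x - z + shift by abel, hf]

lemma conv_comm (hk : Function.Periodic k shift) (hf : Function.Periodic f shift)
    (x : Fin 4 → ℝ) : conv k f x = ∫ z in cell, k (x - z) * f z := by
  have hp : Function.Periodic (fun z => k z * f (x - z)) shift := fun z => by
    have := hf (x - (z + shift))
    rw [show x - (z + shift) + shift = x - z by abel] at this
    simp only [hk z, this]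
  rw [conv, ← setIntegral_cell_sub hp x]
  simp

lemma integrableOn_exp (hc : 0 < c) : IntegrableOn (fun z => exp (-c * rad z)) cell := by
  refine Integrable.mono' (integrableOn_kerBound hc)
    (by have := continuous_rad; exact Continuous.aestronglyMeasurable (by fun_prop))
    (Eventually.of_forall fun z => ?_)
  rw [norm_of_nonneg (exp_pos _).le]
  have := rad_nonneg z
  have : 0 ≤ (radSq z)⁻¹ := inv_nonneg.2 (radSq_nonneg z)
  have : 1 ≤ kerBound z := by unfold kerBound; nlinarith
  exact le_mul_of_one_le_left (exp_pos _).le this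

lemma Decays.integrableOn (hc : 0 < c) (hf : Decays c f) : IntegrableOn f cell := by
  obtain ⟨C, hC, h⟩ := hf.bound
  exact Integrable.mono' ((integrableOn_exp hc).const_mul C) hf.cont.aestronglyMeasurable
    (Eventually.of_forall h)

/-- Pointwise bound used to estimate singular convolutions uniformly. -/
lemma inv_radSq_mul_exp_le (hc : 0 ≤ c) (x z : Fin 4 → ℝ) :
    (radSq z)⁻¹ * exp (-c * rad (x - z)) ≤ exp (-c * rad (x - z)) + exp c * weight c z := by
  have h1 : 0 ≤ exp c * weight c z := mul_nonneg (exp_pos _).le (weight_nonneg c z)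
  have h2 := exp_pos (-c * rad (x - z))
  have hq := radSq_nonneg z
  rcases le_or_gt 1 (radSq z) with h | h
  · have : (radSq z)⁻¹ ≤ 1 := inv_le_one_of_one_le₀ h
    nlinarith
  · have hr : rad z ≤ 1 := by
      have := rad_sq z; have := rad_nonneg z; nlinarith
    have h3 : exp (-c * rad (x - z)) ≤ 1 := exp_le_one_iff.2 (by
      have := rad_nonneg (x - z); nlinarith)
    have h4 : 1 ≤ exp c * exp (-c * rad z) := by
      rw [← exp_add]; exact one_le_exp (by nlinarith)
    have hi : 0 ≤ (radSq z)⁻¹ := inv_nonneg.2 hq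
    unfold weight
    nlinarith [mul_le_mul_of_nonneg_right h3 hi, mul_le_mul_of_nonneg_right h4 hi]

lemma periodic_exp_rad (c : ℝ) : Function.Periodic (fun z => exp (-c * rad z)) shift :=
  fun z => by simp only [rad_add_shift]

/-- A uniform bound for singular convolutions. -/
lemma integral_inv_mul_exp_le (hc : 0 < c) : ∃ K, 0 ≤ K ∧ ∀ x : Fin 4 → ℝ,
    IntegrableOn (fun z => (2 + (radSq z)⁻¹) * exp (-c * rad (x - z))) cell ∧
      ∫ z in cell, (2 + (radSq z)⁻¹) * exp (-c * rad (x - z)) ≤ K := by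
  have hm : Measurable fun z => (radSq z)⁻¹ := continuous_radSq.measurable.inv
  have hInt : ∀ x : Fin 4 → ℝ, IntegrableOn (fun z => 3 * exp (-c * rad (x - z))
      + exp c * weight c z) cell := fun x =>
    ((integrableOn_cell_sub (periodic_exp_rad c) (integrableOn_exp hc) x).const_mul 3).add
      ((integrableOn_weight hc).const_mul _)
  have hle : ∀ x z : Fin 4 → ℝ, (2 + (radSq z)⁻¹) * exp (-c * rad (x - z)) ≤
      3 * exp (-c * rad (x - z)) + exp c * weight c z := fun x z => by
    have := inv_radSq_mul_exp_le hc.le x z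
    linarith
  have h0 : ∀ x z : Fin 4 → ℝ, 0 ≤ (2 + (radSq z)⁻¹) * exp (-c * rad (x - z)) := fun x z => by
    have : 0 ≤ (radSq z)⁻¹ := inv_nonneg.2 (radSq_nonneg z)
    positivity
  refine ⟨∫ z in cell, (3 * exp (-c * rad z) + exp c * weight c z), ?_, fun x => ?_⟩
  · refine integral_nonneg fun z => ?_
    have := weight_nonneg c z
    show 0 ≤ 3 * exp (-c * rad z) + exp c * weight c z
    positivity
  have hi : IntegrableOn (fun z => (2 + (radSq z)⁻¹) * exp (-c * rad (x - z))) cell := by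
    refine Integrable.mono' (hInt x) ?_ (Eventually.of_forall fun z => ?_)
    · have := continuous_rad.measurable
      exact Measurable.aestronglyMeasurable (by fun_prop)
    · rw [norm_of_nonneg (h0 x z)]; exact hle x z
  refine ⟨hi, (integral_mono hi (hInt x) (hle x)).trans (le_of_eq ?_)⟩
  rw [integral_add, integral_add]
  · congr 1
    rw [integral_const_mul, integral_const_mul,
      setIntegral_cell_sub (periodic_exp_rad c)]
  · exact (integrableOn_exp hc).const_mul 3
  · exact (integrableOn_weight hc).const_mul _
  · exact (integrableOn_cell_sub (periodic_exp_rad c) (integrableOn_exp hc) x).const_mul 3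
  · exact (integrableOn_weight hc).const_mul _

lemma abs_dker_zero_le {z : Fin 4 → ℝ} (hz : 0 < radSq z) (i : Fin 4) :
    |dker 0 i z| ≤ 2 + (radSq z)⁻¹ := by
  have := abs_dker_le le_rfl (z := z) (by linarith) i
  have := inv_sden_le le_rfl hz
  linarith

lemma abs_conv_dker_le (hc : 0 < c) : ∃ K, 0 ≤ K ∧ ∀ (f : (Fin 4 → ℝ) → ℝ) (C : ℝ), 0 ≤ C →
    (∀ x, |f x| ≤ C * exp (-c * rad x)) → ∀ i x, |conv (dker 0 i) f x| ≤ C * K := by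
  obtain ⟨K, hK, h⟩ := integral_inv_mul_exp_le hc
  refine ⟨K, hK, fun f C hC hf i x => ?_⟩
  obtain ⟨h1, h2⟩ := h x
  unfold conv
  rw [← Real.norm_eq_abs]
  refine (norm_integral_le_of_norm_le (h1.const_mul C) ?_).trans ?_
  · filter_upwards [ae_cell_radSq_pos] with z hz
    rw [norm_mul, Real.norm_eq_abs, Real.norm_eq_abs]
    have := mul_le_mul (abs_dker_zero_le hz i) (hf (x - z)) (abs_nonneg _)
      (by have := inv_pos.2 hz; positivity)
    linarith
  · rw [integral_const_mul]; gcongr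

lemma Decays.conv_dker (hc : 0 < c) (hf : Decays c f) (i : Fin 4) :
    Decays 0 (conv (dker 0 i) f) := by
  obtain ⟨K, hK, h⟩ := abs_conv_dker_le hc
  obtain ⟨C, hC, hb⟩ := hf.bound
  exact ⟨continuous_conv hc (isKernel_dker le_rfl i) hf, periodic_conv hf.periodic,
    C * K, by positivity, fun x => by simpa using h f C hC hb i x⟩

/-- The gradient map with the given partial derivatives. -/
noncomputable def gradMap (v : Fin 4 → ℝ) : (Fin 4 → ℝ) →L[ℝ] ℝ :=
  ∑ i, v i • (ContinuousLinearMap.proj (R := ℝ) (φ := fun _ : Fin 4 => ℝ) i)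

lemma gradMap_apply (v w : Fin 4 → ℝ) : gradMap v w = ∑ i, v i * w i := by
  simp [gradMap]

lemma gradMap_single (v : Fin 4 → ℝ) (i : Fin 4) : gradMap v (Pi.single i 1) = v i := by
  simp [gradMap_apply, Pi.single_apply]

lemma norm_gradMap_le (v : Fin 4 → ℝ) : ‖gradMap v‖ ≤ ∑ i, |v i| := by
  refine ContinuousLinearMap.opNorm_le_bound _ (Finset.sum_nonneg fun i _ => abs_nonneg _)
    fun w => ?_
  rw [gradMap_apply, Finset.sum_mul]
  refine (norm_sum_le _ _).trans (Finset.sum_le_sum fun i _ => ?_)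
  rw [norm_mul]
  exact mul_le_mul_of_nonneg_left (norm_le_pi_norm w i) (abs_nonneg _)

lemma gradMap_sub (v w : Fin 4 → ℝ) : gradMap v - gradMap w = gradMap fun i => v i - w i := by
  ext u; simp [gradMap_apply, Finset.sum_sub_distrib, sub_mul]

lemma measurable_gradMap {v : (Fin 4 → ℝ) → Fin 4 → ℝ} (hv : ∀ i, Measurable fun z => v z i) :
    Measurable fun z => gradMap (v z) := by
  unfold gradMap
  exact Finset.measurable_sum _ fun i _ => (hv i).smul_const _

lemma integral_gradMap {v : (Fin 4 → ℝ) → Fin 4 → ℝ} {s : Set (Fin 4 → ℝ)}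
    (hv : ∀ i, IntegrableOn (fun z => v z i) s) :
    ∫ z in s, gradMap (v z) = gradMap fun i => ∫ z in s, v z i := by
  unfold gradMap
  rw [integral_finsetSum _ fun i _ => (hv i).smul_const _]
  simp_rw [integral_smul_const]

lemma abs_dker_le_const {a : ℝ} (ha : 0 < a) (i : Fin 4) (z : Fin 4 → ℝ) :
    |dker a i z| ≤ 2 + a⁻¹ := by
  have hq := radSq_nonneg z
  refine (abs_dker_le ha.le (by linarith) i).trans ?_
  gcongr
  linarith [radSq_add_le_sden (a := a) (z := z) (by linarith)]

lemma integrableOn_conv' (hc : 0 < c) (hk : IsKernel k) (hf : Decays c f) (x : Fin 4 → ℝ) :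
    IntegrableOn (fun z => k (x - z) * f z) cell := by
  have hp : Function.Periodic (fun z => k z * f (x - z)) shift := fun z => by
    have := hf.periodic (x - (z + shift))
    rw [show x - (z + shift) + shift = x - z by abel] at this
    simp only [hk.periodic z, this]
  simpa using integrableOn_cell_sub hp (integrableOn_conv hc hk hf x) x

lemma hasFDerivAt_conv_ker_reg (hc : 0 < c) (hf : Decays c f) {a : ℝ} (ha : 0 < a) (ha1 : a ≤ 1)
    (x : Fin 4 → ℝ) :
    HasFDerivAt (conv (ker a) f) (gradMap fun i => conv (dker a i) f x) x := by
  have e : conv (ker a) f = fun x => ∫ z in cell, ker a (x - z) * f z :=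
    funext fun x => conv_comm (periodic_ker a) hf.periodic x
  have hm : ∀ y i, Measurable fun z => dker a i (y - z) * f z := fun y i =>
    ((measurable_dker a i).comp (by fun_prop)).mul hf.cont.measurable
  rw [e]
  have key := hasFDerivAt_integral_of_dominated_of_fderiv_le (s := univ)
    (μ := volume.restrict cell)
    (F := fun y z => ker a (y - z) * f z)
    (F' := fun y z => gradMap fun i => dker a i (y - z) * f z) (x₀ := x)
    (bound := fun z => 4 * (2 + a⁻¹) * |f z|)
    univ_mem (Eventually.of_forall fun y =>
      (((measurable_ker a).comp (by fun_prop)).mul hf.cont.measurable).aestronglyMeasurable)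
    (integrableOn_conv' hc (isKernel_ker ha.le ha1) hf x)
    (measurable_gradMap (hm x)).aestronglyMeasurable ?_ ?_ ?_
  · refine key.congr_fderiv ?_
    rw [integral_gradMap fun i => integrableOn_conv' hc (isKernel_dker ha.le i) hf x]
    congr 1
    ext i
    rw [conv_comm (periodic_dker a i) hf.periodic]
  · refine Eventually.of_forall fun z y _ => (norm_gradMap_le _).trans ?_
    calc ∑ i, |dker a i (y - z) * f z| ≤ ∑ i : Fin 4, (2 + a⁻¹) * |f z| := by
          refine Finset.sum_le_sum fun i _ => ?_
          rw [abs_mul]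
          gcongr
          exact abs_dker_le_const ha i _
      _ = _ := by simp; ring
  · exact (hf.integrableOn hc).abs.const_mul _
  · refine Eventually.of_forall fun z y _ => ?_
    have h0 := radSq_nonneg (y - z)
    have h1 := (hasFDerivAt_ker (a := a) (z := y - z) (by linarith)).comp y
      ((hasFDerivAt_id y).sub_const z)
    refine (h1.mul_const (f z)).congr_fderiv ?_
    ext w
    simp [gradMap_apply, Finset.mul_sum]
    refine Finset.sum_congr rfl fun i _ => by ring

lemma tendsto_inv_nat : Tendsto (fun n : ℕ => ((n : ℝ) + 1)⁻¹) atTop (𝓝 0) := by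
  simpa using tendsto_one_div_add_atTop_nhds_zero_nat (𝕜 := ℝ)

lemma inv_nat_pos (n : ℕ) : 0 < ((n : ℝ) + 1)⁻¹ := by positivity

lemma inv_nat_le_one (n : ℕ) : ((n : ℝ) + 1)⁻¹ ≤ 1 :=
  inv_le_one_of_one_le₀ (by have : (0 : ℝ) ≤ n := Nat.cast_nonneg n; linarith)

lemma tendsto_conv (hc : 0 < c) (hf : Decays c f) {k : ℝ → (Fin 4 → ℝ) → ℝ}
    (hk : ∀ a, 0 ≤ a → a ≤ 1 → IsKernel (k a))
    (hlim : ∀ z, 0 < radSq z → Tendsto (fun a => k a z) (𝓝 0) (𝓝 (k 0 z))) (x : Fin 4 → ℝ) :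
    Tendsto (fun n : ℕ => conv (k ((n : ℝ) + 1)⁻¹) f x) atTop (𝓝 (conv (k 0) f x)) := by
  obtain ⟨C, hC, h⟩ := hf.bound_sub hc.le
  refine tendsto_integral_of_dominated_convergence (fun z =>
    C * exp (c * rad x) * (kerBound z * exp (-c * rad z)))
    (fun n => conv_aestronglyMeasurable
      (hk _ (inv_nat_pos n).le (inv_nat_le_one n)).meas hf.cont x)
    ((integrableOn_kerBound hc).const_mul _) (fun n => ?_) ?_
  · filter_upwards [ae_cell_radSq_pos] with z hz
    exact (hk _ (inv_nat_pos n).le (inv_nat_le_one n)).norm_mul_le hz (h _ x z le_rfl)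
  · filter_upwards [ae_cell_radSq_pos] with z hz
    exact ((hlim z hz).comp tendsto_inv_nat).mul_const _

lemma hasFDerivAt_conv_ker (hc : 0 < c) (hf : Decays c f) (x : Fin 4 → ℝ) :
    HasFDerivAt (conv (ker 0) f) (gradMap fun i => conv (dker 0 i) f x) x := by
  obtain ⟨C, hC, h⟩ := hf.bound_sub hc.le
  set R := rad x + 1 with hR
  set s : Set (Fin 4 → ℝ) := {y | rad y < R}
  have hs : IsOpen s := isOpen_lt continuous_rad continuous_const
  set d : ℕ → Fin 4 → (Fin 4 → ℝ) → ℝ := fun n i z =>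
    |dker ((n : ℝ) + 1)⁻¹ i z - dker 0 i z| * exp (-c * rad z) with hd
  have hdm : ∀ n i, Measurable (d n i) := fun n i => by
    have := measurable_dker ((n : ℝ) + 1)⁻¹ i
    have := measurable_dker 0 i
    have := continuous_rad.measurable
    simp only [hd, ← Real.norm_eq_abs]
    fun_prop
  have hdb : ∀ n i, ∀ᵐ z ∂volume.restrict cell, ‖d n i z‖ ≤
      2 * (kerBound z * exp (-c * rad z)) := fun n i => by
    filter_upwards [ae_cell_radSq_pos] with z hz
    rw [hd, norm_mul, Real.norm_eq_abs, abs_abs, norm_of_nonneg (exp_pos _).le, ← mul_assoc]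
    gcongr
    refine (abs_sub _ _).trans ?_
    have := abs_dker_le_kerBound (inv_nat_pos n).le hz i
    have := abs_dker_le_kerBound le_rfl hz i
    linarith
  have hdi : ∀ n i, IntegrableOn (d n i) cell := fun n i =>
    Integrable.mono' ((integrableOn_kerBound hc).const_mul 2) (hdm n i).aestronglyMeasurable
      (hdb n i)
  have hlim : ∀ i, Tendsto (fun n => ∫ z in cell, d n i z) atTop (𝓝 0) := fun i => by
    have : Tendsto (fun n => ∫ z in cell, d n i z) atTop (𝓝 (∫ z in cell, (0 : ℝ))) := by
      refine tendsto_integral_of_dominated_convergence _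
        (fun n => (hdm n i).aestronglyMeasurable)
        ((integrableOn_kerBound hc).const_mul 2) (fun n => hdb n i) ?_
      filter_upwards [ae_cell_radSq_pos] with z hz
      have h1 := (((tendsto_dker hz i).comp tendsto_inv_nat).sub_const (dker 0 i z)).abs.mul_const
        (exp (-c * rad z))
      simpa [hd] using h1
    simpa using this
  have hdiff : ∀ (n : ℕ) i, ∀ y ∈ s, |conv (dker 0 i) f y - conv (dker ((n : ℝ) + 1)⁻¹ i) f y| ≤
      C * exp (c * R) * ∫ z in cell, d n i z := fun n i y hy => by
    unfold conv
    rw [← integral_sub (integrableOn_conv hc (isKernel_dker le_rfl i) hf y)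
      (integrableOn_conv hc (isKernel_dker (inv_nat_pos n).le i) hf y), ← integral_const_mul,
      ← Real.norm_eq_abs]
    refine norm_integral_le_of_norm_le ((hdi n i).const_mul _) (Eventually.of_forall fun z => ?_)
    rw [← sub_mul, norm_mul, norm_sub_rev, Real.norm_eq_abs, Real.norm_eq_abs]
    calc _ ≤ |dker ((n : ℝ) + 1)⁻¹ i z - dker 0 i z| * (C * exp (c * R) * exp (-c * rad z)) := by
          gcongr; exact h R y z (le_of_lt hy)
      _ = _ := by rw [hd]; ring
  refine hasFDerivAt_of_tendstoUniformlyOn hs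
    (f := fun n : ℕ => conv (ker ((n : ℝ) + 1)⁻¹) f)
    (f' := fun n y => gradMap fun i => conv (dker ((n : ℝ) + 1)⁻¹ i) f y)
    (g' := fun y => gradMap fun i => conv (dker 0 i) f y) (l := atTop) ?_
    (fun n y _ => hasFDerivAt_conv_ker_reg hc hf (inv_nat_pos n) (inv_nat_le_one n) y)
    (fun y _ => tendsto_conv hc hf (fun a h1 h2 => isKernel_ker h1 h2)
      (fun z hz => tendsto_ker hz) y) (show rad x < R by linarith)
  rw [Metric.tendstoUniformlyOn_iff]
  intro ε hε
  have hsum : Tendsto (fun n => ∑ i, C * exp (c * R) * ∫ z in cell, d n i z) atTop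
      (𝓝 (∑ i : Fin 4, C * exp (c * R) * 0)) :=
    tendsto_finsetSum _ fun i _ => (hlim i).const_mul _
  simp only [mul_zero, Finset.sum_const_zero] at hsum
  filter_upwards [hsum.eventually (Iio_mem_nhds hε)] with n hn y hy
  rw [dist_eq_norm, gradMap_sub]
  exact (norm_gradMap_le _).trans_lt
    ((Finset.sum_le_sum fun i _ => hdiff n i y hy).trans_lt hn)

end CylinderLiouville

namespace CylinderLiouville
open Real Set Filter Topology

/-- The `i`-th partial derivative. -/
noncomputable def par (i : Fin 4) (g : (Fin 4 → ℝ) → ℝ) (x : Fin 4 → ℝ) : ℝ :=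
  fderiv ℝ g x (Pi.single i 1)

lemma hasDerivAt_slice {g : (Fin 4 → ℝ) → ℝ} (i : Fin 4) (x : Fin 4 → ℝ)
    (hg : DifferentiableAt ℝ g x) :
    HasDerivAt (fun t => g (Function.update x i t)) (par i g x) (x i) := by
  have hu : HasDerivAt (Function.update x i) (Pi.single i 1) (x i) := hasDerivAt_update x i (x i)
  have : HasFDerivAt g (fderiv ℝ g x) (Function.update x i (x i)) := by
    rw [Function.update_eq_self]; exact hg.hasFDerivAt
  exact this.comp_hasDerivAt (x i) hu

lemma hasDerivAt_add_single {h h' : (Fin 4 → ℝ) → ℝ} {i : Fin 4}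
    (hd : ∀ z, HasDerivAt (fun t => h (Function.update z i t)) (h' z) (z i))
    (z : Fin 4 → ℝ) (t : ℝ) :
    HasDerivAt (fun s => h (z + Pi.single i s)) (h' (z + Pi.single i t)) t := by
  have h1 := hd (z + Pi.single i t)
  rw [show (z + Pi.single i t : Fin 4 → ℝ) i = z i + t by simp] at h1
  have h2 := h1.comp_const_add (z i) t
  have e : (fun s => h (Function.update (z + Pi.single i t) i (z i + s))) =
      fun s => h (z + Pi.single i s) := by
    ext s
    congr 1
    ext j
    rcases eq_or_ne j i with rfl | hj
    · simp
    · simp [hj]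
  rwa [e] at h2

lemma integral_cell_slice_deriv {h h' : (Fin 4 → ℝ) → ℝ} {i : Fin 4} {c C : ℝ} (hc : 0 < c)
    (hper : Function.Periodic h shift) (hm : Measurable h) (hm' : Measurable h')
    (hInt : IntegrableOn h cell)
    (hd : ∀ z, HasDerivAt (fun t => h (Function.update z i t)) (h' z) (z i))
    (hb : ∀ z, |h' z| ≤ C * exp (-c * rad z)) : ∫ z in cell, h' z = 0 := by
  have hC : 0 ≤ C := by
    have := (abs_nonneg _).trans (hb 0)
    exact nonneg_of_mul_nonneg_left this (exp_pos _)
  have key := (hasDerivAt_integral_of_dominated_loc_of_deriv_le (s := Ioo (-1) 1)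
    (μ := volume.restrict cell) (x₀ := (0 : ℝ))
    (F := fun t z => h (z + Pi.single i t)) (F' := fun t z => h' (z + Pi.single i t))
    (bound := fun z => C * exp (c * 2) * exp (-c * rad z))
    (Ioo_mem_nhds (by norm_num) (by norm_num))
    (Eventually.of_forall fun t => (hm.comp (by fun_prop)).aestronglyMeasurable)
    (by simpa [IntegrableOn] using hInt) (hm'.comp (by fun_prop)).aestronglyMeasurable ?_
    ((integrableOn_exp hc).const_mul _) ?_).2
  · have hconst : (fun t : ℝ => ∫ z in cell, h (z + Pi.single i t)) = fun _ => ∫ z in cell, h z :=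
      funext fun t => setIntegral_cell_add hper _
    rw [hconst] at key
    simpa using key.unique (hasDerivAt_const _ _)
  · refine Eventually.of_forall fun z t ht => (hb _).trans ?_
    rw [mul_assoc, ← exp_add]
    gcongr
    have h1 : rad z ≤ rad (z + Pi.single i t) + rad (Pi.single i t) := by
      have := rad_sub_le (z + Pi.single i t) (Pi.single i t)
      rwa [add_sub_cancel_right] at this
    have h2 : rad (Pi.single i t) ≤ 2 := by
      refine (rad_le_norm _).trans ?_
      rw [Pi.norm_single, Real.norm_eq_abs]
      have := abs_lt.2 ht
      linarith
    nlinarith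
  · exact Eventually.of_forall fun z t _ => hasDerivAt_add_single hd z t

lemma one_add_rad_mul_exp_le {c : ℝ} (hc : 0 < c) (z : Fin 4 → ℝ) :
    (1 + rad z) * exp (-c * rad z) ≤ (1 + 2 / c) * exp (-(c / 2) * rad z) := by
  have h0 := rad_nonneg z
  have h1 : 1 + rad z ≤ (1 + 2 / c) * exp (c / 2 * rad z) := by
    have e1 := add_one_le_exp (c / 2 * rad z)
    have e2 : 1 ≤ exp (c / 2 * rad z) := one_le_exp (by positivity)
    have e3 : rad z = 2 / c * (c / 2 * rad z) := by field_simp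
    have e4 : 2 / c * (c / 2 * rad z) ≤ 2 / c * exp (c / 2 * rad z) := by gcongr; linarith
    linarith
  calc _ ≤ (1 + 2 / c) * exp (c / 2 * rad z) * exp (-c * rad z) := by gcongr
    _ = _ := by rw [mul_assoc, ← exp_add]; ring_nf

variable {c : ℝ} {f g : (Fin 4 → ℝ) → ℝ}

/-- Integration by parts in a cell, for a family of kernels regularized at the singularity. -/
lemma conv_par_eq {i : Fin 4} (hc : 0 < c) (hf : Decays c f) (hf1 : Differentiable ℝ f)
    (hf' : Decays c (par i f)) {K K' : ℝ → (Fin 4 → ℝ) → ℝ}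
    (hK : ∀ a, 0 ≤ a → a ≤ 1 → IsKernel (K a)) (hK' : ∀ a, 0 ≤ a → a ≤ 1 → IsKernel (K' a))
    (hl : ∀ z, 0 < radSq z → Tendsto (fun a => K a z) (𝓝 0) (𝓝 (K 0 z)))
    (hl' : ∀ z, 0 < radSq z → Tendsto (fun a => K' a z) (𝓝 0) (𝓝 (K' 0 z)))
    (hd : ∀ a, 0 < a → ∀ z, HasDerivAt (fun t => K a (Function.update z i t)) (K' a z) (z i))
    (hb : ∀ a, 0 < a → a ≤ 1 → ∃ M, ∀ z, |K a z| ≤ M * (1 + rad z) ∧ |K' a z| ≤ M * (1 + rad z))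
    (x : Fin 4 → ℝ) : conv (K 0) (par i f) x = conv (K' 0) f x := by
  refine tendsto_nhds_unique (tendsto_conv hc hf' hK hl x) ?_
  refine (tendsto_conv hc hf hK' hl' x).congr fun n => ?_
  set a : ℝ := ((n : ℝ) + 1)⁻¹
  have ha : 0 < a := inv_nat_pos n
  have ha1 : a ≤ 1 := inv_nat_le_one n
  obtain ⟨M, hM⟩ := hb a ha ha1
  obtain ⟨C, hC, h⟩ := hf.bound_sub hc.le
  obtain ⟨C', hC', h'⟩ := hf'.bound_sub hc.le
  have hM0 : 0 ≤ M := by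
    have := (abs_nonneg _).trans (hM 0).1
    exact nonneg_of_mul_nonneg_left this (by have := rad_nonneg 0; linarith)
  have hper : Function.Periodic (fun z => K a z * f (x - z)) shift := fun z => by
    have := hf.periodic (x - (z + shift))
    rw [show x - (z + shift) + shift = x - z by abel] at this
    simp only [(hK a ha.le ha1).periodic z, this]
  have key := integral_cell_slice_deriv (i := i) (h := fun z => K a z * f (x - z))
    (h' := fun z => K' a z * f (x - z) - K a z * par i f (x - z)) (c := c / 2)
    (C := M * (C + C') * exp (c * rad x) * (1 + 2 / c)) (half_pos hc) hper
    ((hK a ha.le ha1).meas.mul (hf.cont.measurable.comp (by fun_prop)))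
    (((hK' a ha.le ha1).meas.mul (hf.cont.measurable.comp (by fun_prop))).sub
      ((hK a ha.le ha1).meas.mul (hf'.cont.measurable.comp (by fun_prop))))
    (integrableOn_conv hc (hK a ha.le ha1) hf x) ?_ ?_
  · rw [integral_sub (integrableOn_conv hc (hK' a ha.le ha1) hf x)
      (integrableOn_conv hc (hK a ha.le ha1) hf' x)] at key
    unfold conv
    linarith
  · intro z
    have h1 : HasDerivAt (fun t => f (x - Function.update z i t)) (-par i f (x - z)) (z i) := by
      have hu : HasDerivAt (fun t => x - Function.update z i t) (-Pi.single i 1) (z i) :=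
        (hasDerivAt_update z i (z i)).const_sub x
      have h2 : HasFDerivAt f (fderiv ℝ f (x - z)) (x - Function.update z i (z i)) := by
        rw [Function.update_eq_self]; exact (hf1 (x - z)).hasFDerivAt
      refine (h2.comp_hasDerivAt (z i) hu).congr_deriv ?_
      simp [par]
    refine ((hd a ha z).mul h1).congr_deriv ?_
    simp
    ring
  · intro z
    have hr := rad_nonneg z
    have hE := one_add_rad_mul_exp_le hc z
    calc _ ≤ |K' a z * f (x - z)| + |K a z * par i f (x - z)| := abs_sub _ _
      _ ≤ M * (1 + rad z) * (C * exp (c * rad x) * exp (-c * rad z)) +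
          M * (1 + rad z) * (C' * exp (c * rad x) * exp (-c * rad z)) := by
        rw [abs_mul, abs_mul]
        exact add_le_add
          (mul_le_mul (hM z).2 (h _ x z le_rfl) (abs_nonneg _) (by positivity))
          (mul_le_mul (hM z).1 (h' _ x z le_rfl) (abs_nonneg _) (by positivity))
      _ = M * (C + C') * exp (c * rad x) * ((1 + rad z) * exp (-c * rad z)) := by ring
      _ ≤ M * (C + C') * exp (c * rad x) * ((1 + 2 / c) * exp (-(c / 2) * rad z)) := by gcongr
      _ = _ := by ring

lemma inv_sden_le_inv {a : ℝ} (ha : 0 < a) (z : Fin 4 → ℝ) : (sden a z)⁻¹ ≤ a⁻¹ := by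
  have hq := radSq_nonneg z
  gcongr
  linarith [radSq_add_le_sden (a := a) (z := z) (by linarith)]

lemma abs_ker_le_const {a : ℝ} (ha : 0 < a) (ha1 : a ≤ 1) (z : Fin 4 → ℝ) :
    |ker a z| ≤ (3 + a⁻¹) * (1 + rad z) := by
  have hq := radSq_nonneg z
  have hr := rad_nonneg z
  have hs := sden_pos (a := a) (z := z) (by linarith)
  have hi := inv_pos.2 ha
  rw [abs_le]
  constructor
  · have h1 := one_sub_inv_le_log_of_pos hs
    have h2 := inv_sden_le_inv ha z
    unfold ker; nlinarith
  · have := ker_le (z := z) ha1 (by linarith)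
    nlinarith

lemma abs_dker_le_const' {a : ℝ} (ha : 0 < a) (i : Fin 4) (z : Fin 4 → ℝ) :
    |dker a i z| ≤ (3 + 8 * a⁻¹) * (1 + rad z) := by
  have h1 := abs_dker_le_const ha i z
  have hr := rad_nonneg z
  have hi := inv_pos.2 ha
  nlinarith

lemma abs_ddker_le_const {a : ℝ} (ha : 0 < a) (i : Fin 4) (z : Fin 4 → ℝ) :
    |ddker a i z| ≤ (3 + 8 * a⁻¹) * (1 + rad z) := by
  have hq := radSq_nonneg z
  have h1 := abs_ddker_le ha.le (z := z) (by linarith) i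
  have h2 := inv_sden_le_inv ha z
  have hr := rad_nonneg z
  have hi := inv_pos.2 ha
  nlinarith

lemma conv_ker_par (i : Fin 4) (hc : 0 < c) (hf : Decays c f) (hf1 : Differentiable ℝ f)
    (hf' : Decays c (par i f)) (x : Fin 4 → ℝ) :
    conv (ker 0) (par i f) x = conv (dker 0 i) f x := by
  refine conv_par_eq hc hf hf1 hf' (K := ker) (K' := fun a => dker a i)
    (fun a h1 h2 => isKernel_ker h1 h2) (fun a h1 _ => isKernel_dker h1 i)
    (fun z hz => tendsto_ker hz) (fun z hz => tendsto_dker hz i) (fun a ha z => ?_)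
    (fun a ha ha1 => ⟨3 + 8 * a⁻¹, fun z => ⟨(abs_ker_le_const ha ha1 z).trans ?_,
      abs_dker_le_const' ha i z⟩⟩) x
  · have hz : 0 < radSq z + a := by have := radSq_nonneg z; linarith
    refine (hasDerivAt_slice i z (hasFDerivAt_ker hz).differentiableAt).congr_deriv ?_
    rw [par, (hasFDerivAt_ker hz).fderiv]
    exact gradMap_single (fun i => dker a i z) i
  · have hr := rad_nonneg z
    have hi := inv_pos.2 ha
    gcongr
    linarith

lemma conv_dker_par (i : Fin 4) (hc : 0 < c) (hf : Decays c f) (hf1 : Differentiable ℝ f)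
    (hf' : Decays c (par i f)) (x : Fin 4 → ℝ) :
    conv (dker 0 i) (par i f) x = conv (ddker 0 i) f x :=
  conv_par_eq hc hf hf1 hf' (K := fun a => dker a i) (K' := fun a => ddker a i)
    (fun _ h1 _ => isKernel_dker h1 i) (fun _ h1 _ => isKernel_ddker h1 i)
    (fun _ hz => tendsto_dker hz i) (fun _ hz => tendsto_ddker hz i)
    (fun a ha z => hasDerivAt_dker (by have := radSq_nonneg z; linarith) i)
    (fun a ha _ => ⟨3 + 8 * a⁻¹, fun z => ⟨abs_dker_le_const' ha i z,
      abs_ddker_le_const ha i z⟩⟩) x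

lemma par_conv_ker (i : Fin 4) (hc : 0 < c) (hf : Decays c f) :
    par i (conv (ker 0) f) = conv (dker 0 i) f := by
  ext x
  rw [par, (hasFDerivAt_conv_ker hc hf x).fderiv, gradMap_single]

/-- Functions whose partial derivatives of order at most `k` are all `O(exp (-c r))`. -/
def SmoothDecays (c : ℝ) : ℕ → ((Fin 4 → ℝ) → ℝ) → Prop
  | 0, f => Decays c f
  | k + 1, f => Decays c f ∧ Differentiable ℝ f ∧ ∀ i, SmoothDecays c k (par i f)

lemma SmoothDecays.decays : ∀ {k : ℕ} {f : (Fin 4 → ℝ) → ℝ}, SmoothDecays c k f → Decays c f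
  | 0, _, h => h
  | _ + 1, _, h => h.1

lemma SmoothDecays.of_succ : ∀ {k : ℕ} {f : (Fin 4 → ℝ) → ℝ},
    SmoothDecays c (k + 1) f → SmoothDecays c k f
  | 0, _, h => h.1
  | _ + 1, _, h => ⟨h.1, h.2.1, fun i => (h.2.2 i).of_succ⟩

lemma differentiable_of_par (hf : Differentiable ℝ f) {k : ℕ} (h : ∀ i, ContDiff ℝ k (par i f)) :
    ContDiff ℝ (k + 1 : ℕ) f := by
  push_cast
  rw [contDiff_succ_iff_fderiv_apply]
  refine ⟨hf, by simp, fun y => ?_⟩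
  have : (fun x => fderiv ℝ f x y) = fun x => ∑ i, y i * par i f x := by
    ext x
    conv_lhs => rw [pi_eq_sum_univ' y]
    simp [par]
  rw [this]
  exact ContDiff.sum (ι := Fin 4) fun i _ => ContDiff.mul contDiff_const (h i)

lemma SmoothDecays.contDiff : ∀ {k : ℕ} {f : (Fin 4 → ℝ) → ℝ},
    SmoothDecays c k f → ContDiff ℝ k f
  | 0, _, h => by simpa using (contDiff_zero (𝕜 := ℝ)).2 h.decays.cont
  | _ + 1, _, h => differentiable_of_par h.2.1 fun i => (h.2.2 i).contDiff

lemma Decays.add (hf : Decays c f) (hg : Decays c g) : Decays c fun x => f x + g x := by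
  obtain ⟨C, hC, h⟩ := hf.bound
  obtain ⟨C', hC', h'⟩ := hg.bound
  exact ⟨hf.cont.add hg.cont, fun x => by simp only [hf.periodic x, hg.periodic x],
    C + C', by positivity, fun x => (abs_add_le _ _).trans (by linarith [h x, h' x])⟩

lemma Decays.mul (hf : Decays c f) (hg : Decays 0 g) : Decays c fun x => f x * g x := by
  obtain ⟨C, hC, h⟩ := hf.bound
  obtain ⟨C', hC', h'⟩ := hg.bound
  refine ⟨hf.cont.mul hg.cont, fun x => by simp only [hf.periodic x, hg.periodic x],
    C * C', by positivity, fun x => ?_⟩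
  have h'' := h' x
  simp only [neg_zero, zero_mul, exp_zero, mul_one] at h''
  rw [abs_mul]
  calc _ ≤ C * exp (-c * rad x) * C' := mul_le_mul (h x) h'' (abs_nonneg _) (by positivity)
    _ = _ := by ring

lemma par_add (hf : Differentiable ℝ f) (hg : Differentiable ℝ g) (i : Fin 4) :
    par i (fun x => f x + g x) = fun x => par i f x + par i g x := by
  ext x
  rw [par, fderiv_fun_add (hf x) (hg x)]
  simp [par]

lemma par_mul (hf : Differentiable ℝ f) (hg : Differentiable ℝ g) (i : Fin 4) :
    par i (fun x => f x * g x) = fun x => par i f x * g x + f x * par i g x := by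
  ext x
  rw [par, fderiv_fun_mul (hf x) (hg x)]
  simp [par]
  ring

lemma SmoothDecays.add : ∀ {k : ℕ} {f g : (Fin 4 → ℝ) → ℝ}, SmoothDecays c k f →
    SmoothDecays c k g → SmoothDecays c k fun x => f x + g x
  | 0, _, _, h, h' => Decays.add h h'
  | _ + 1, _, _, h, h' => ⟨h.1.add h'.1, h.2.1.add h'.2.1, fun i => by
      rw [par_add h.2.1 h'.2.1]; exact (h.2.2 i).add (h'.2.2 i)⟩

lemma SmoothDecays.mul : ∀ {k : ℕ} {f g : (Fin 4 → ℝ) → ℝ}, SmoothDecays c k f →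
    SmoothDecays 0 k g → SmoothDecays c k fun x => f x * g x
  | 0, _, _, h, h' => Decays.mul h h'
  | _ + 1, _, _, h, h' => ⟨h.1.mul h'.1, h.2.1.mul h'.2.1, fun i => by
      rw [par_mul h.2.1 h'.2.1]
      exact ((h.2.2 i).mul h'.of_succ).add (h.of_succ.mul (h'.2.2 i))⟩

lemma smoothDecays_const : ∀ (k : ℕ) (b : ℝ), SmoothDecays 0 k fun _ => b
  | 0, b => ⟨continuous_const, fun _ => rfl, |b|, abs_nonneg _, fun x => by simp⟩
  | k + 1, b => ⟨smoothDecays_const 0 b, differentiable_const b, fun i => by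
      have : par i (fun _ => b) = fun _ => 0 := by ext x; simp [par]
      rw [this]; exact smoothDecays_const k 0⟩

lemma SmoothDecays.const_mul {k : ℕ} (h : SmoothDecays c k f) (b : ℝ) :
    SmoothDecays c k fun x => b * f x := by
  have := h.mul (smoothDecays_const k b)
  simpa only [mul_comm] using this

lemma SmoothDecays.sum {k : ℕ} {F : Fin 4 → (Fin 4 → ℝ) → ℝ} (h : ∀ i, SmoothDecays c k (F i)) :
    SmoothDecays c k fun x => ∑ i, F i x := by
  simp only [Fin.sum_univ_four]
  exact (((h 0).add (h 1)).add (h 2)).add (h 3)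

lemma SmoothDecays.conv_dker (hc : 0 < c) : ∀ {k : ℕ} {f : (Fin 4 → ℝ) → ℝ},
    SmoothDecays c k f → ∀ i, SmoothDecays 0 k (conv (dker 0 i) f)
  | 0, _, h, i => Decays.conv_dker hc h i
  | k + 1, f, h, i => by
      have e : conv (dker 0 i) f = conv (ker 0) (par i f) :=
        funext fun x => (conv_ker_par i hc h.1 h.2.1 (h.2.2 i).decays x).symm
      refine ⟨h.1.conv_dker hc i, ?_, fun j => ?_⟩
      · rw [e]
        exact fun x => (hasFDerivAt_conv_ker hc (h.2.2 i).decays x).differentiableAt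
      · rw [e, par_conv_ker j hc (h.2.2 i).decays]
        exact (h.2.2 i).conv_dker hc j

lemma differentiable_conv_ker (hc : 0 < c) (hf : Decays c f) :
    Differentiable ℝ (conv (ker 0) f) :=
  fun x => (hasFDerivAt_conv_ker hc hf x).differentiableAt

/-- Bootstrapping for the integral equation. -/
lemma smoothDecays_of_eq (hc : 0 < c) (hf : Decays c f) {β A : ℝ}
    (h : ∀ x, f x = A * exp (-β * conv (ker 0) f x)) : ∀ k, SmoothDecays c k f
  | 0 => hf
  | k + 1 => by
      have hV := differentiable_conv_ker hc hf
      have hF : ∀ x, HasFDerivAt f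
          (A • (exp (-β * conv (ker 0) f x) • (-β • fderiv ℝ (conv (ker 0) f) x))) x := fun x => by
        have := (((hV x).hasFDerivAt.const_mul (-β)).exp).const_mul A
        rwa [← funext h] at this
      refine ⟨hf, fun x => (hF x).differentiableAt, fun i => ?_⟩
      have e : par i f = fun x => f x * (-β * conv (dker 0 i) f x) := by
        ext x
        rw [par, (hF x).fderiv, ← par_conv_ker i hc hf, h x]
        simp [par]
        ring
      rw [e]
      have := smoothDecays_of_eq hc hf h k
      exact this.mul ((this.conv_dker hc i).const_mul (-β))

/-- The Laplacian in terms of Fréchet derivatives. -/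
noncomputable def lap (g : (Fin 4 → ℝ) → ℝ) (x : Fin 4 → ℝ) : ℝ := ∑ i, par i (par i g) x

lemma lapN_eq_lap (hg : ContDiff ℝ 2 g) : lapN g = lap g := by
  ext x
  unfold lapN lap
  refine Finset.sum_congr rfl fun i _ => ?_
  have hd : Differentiable ℝ g := hg.differentiable (by norm_num)
  have h1 : ∀ t, HasDerivAt (fun t => g (Function.update x i t))
      (par i g (Function.update x i t)) t := fun t => by
    have := hasDerivAt_slice i (Function.update x i t) (hd _)
    simpa using this
  have hp : Differentiable ℝ (par i g) := by
    have : ContDiff ℝ 1 (fderiv ℝ g) := hg.fderiv_right (by norm_num)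
    have h2 : ContDiff ℝ 1 (par i g) := this.clm_apply contDiff_const
    exact h2.differentiable (by norm_num)
  rw [iteratedDeriv_succ, iteratedDeriv_one, show deriv (fun t => g (Function.update x i t)) =
    fun t => par i g (Function.update x i t) from funext fun t => (h1 t).deriv]
  exact (hasDerivAt_slice i x (hp x)).deriv

lemma SmoothDecays.lap {k : ℕ} (h : SmoothDecays c (k + 2) f) : SmoothDecays c k (lap f) :=
  SmoothDecays.sum fun i => (h.2.2 i).2.2 i

lemma conv_sum (hc : 0 < c) {k : (Fin 4 → ℝ) → ℝ} (hk : IsKernel k)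
    {F : Fin 4 → (Fin 4 → ℝ) → ℝ} (hF : ∀ i, Decays c (F i)) (x : Fin 4 → ℝ) :
    conv k (fun y => ∑ i, F i y) x = ∑ i, conv k (F i) x := by
  unfold conv
  simp_rw [Finset.mul_sum]
  exact integral_finsetSum _ fun i _ => integrableOn_conv hc hk (hF i) x

lemma par_par_conv_ker (hc : 0 < c) (h : SmoothDecays c 2 f) (i : Fin 4) :
    par i (par i (conv (ker 0) f)) = conv (ker 0) (par i (par i f)) := by
  have e : conv (dker 0 i) f = conv (ker 0) (par i f) :=
    funext fun x => (conv_ker_par i hc h.1 h.2.1 (h.2.2 i).decays x).symm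
  rw [par_conv_ker i hc h.decays, e, par_conv_ker i hc (h.2.2 i).decays]
  exact funext fun x => (conv_ker_par i hc (h.2.2 i).1 (h.2.2 i).2.1
    ((h.2.2 i).2.2 i).decays x).symm

lemma lap_conv_ker (hc : 0 < c) (h : SmoothDecays c 2 f) :
    lap (conv (ker 0) f) = conv (ker 0) (lap f) := by
  ext x
  unfold lap
  rw [conv_sum hc (isKernel_ker le_rfl zero_le_one) fun i => ((h.2.2 i).2.2 i).decays]
  simp_rw [par_par_conv_ker hc h]

lemma conv_ker_lap (hc : 0 < c) (h : SmoothDecays c 2 f) (x : Fin 4 → ℝ) :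
    conv (ker 0) (lap f) x = ∫ z in cell, 4 * (sinh (rad z) / rad z) / sden 0 z * f (x - z) := by
  unfold lap
  rw [conv_sum hc (isKernel_ker le_rfl zero_le_one) fun i => ((h.2.2 i).2.2 i).decays]
  have : ∀ i, conv (ker 0) (par i (par i f)) x = conv (ddker 0 i) f x := fun i => by
    rw [conv_ker_par i hc (h.2.2 i).1 (h.2.2 i).2.1 ((h.2.2 i).2.2 i).decays,
      conv_dker_par i hc h.1 h.2.1 (h.2.2 i).decays]
  simp_rw [this]
  unfold conv
  rw [← integral_finsetSum _ fun i _ => integrableOn_conv hc (isKernel_ddker le_rfl i) h.1 x]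
  refine integral_congr_ae ?_
  filter_upwards [ae_cell_radSq_pos] with z hz
  rw [← Finset.sum_mul, sum_ddker hz]

lemma contDiff_conv_ker (hc : 0 < c) {k : ℕ} (h : SmoothDecays c k f) :
    ContDiff ℝ (k + 1 : ℕ) (conv (ker 0) f) :=
  differentiable_of_par (differentiable_conv_ker hc h.decays) fun i => by
    rw [par_conv_ker i hc h.decays]; exact (h.conv_dker hc i).contDiff

end CylinderLiouville

namespace CylinderLiouville
open Real Set Filter Topology

/-- The squared Euclidean norm. -/
noncomputable def normSq (z : Fin 4 → ℝ) : ℝ := radSq z + z 3 ^ 2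

/-- The action of an integer translates by that many periods. -/
lemma normSq_add_zsmul_shift (z : Fin 4 → ℝ) (n : ℤ) :
    normSq (n • shift + z) = radSq z + (z 3 + 2 * π * n) ^ 2 := by
  simp only [normSq, radSq, Pi.add_apply, Pi.smul_apply, shift_apply_three]
  rw [shift_apply_of_ne (by decide), shift_apply_of_ne (by decide), shift_apply_of_ne (by decide)]
  simp; ring

lemma im_cot_half {r : ℝ} (hr : 0 < r) (y : ℝ) :
    (Complex.cot ((y + r * Complex.I) / 2)).im = -(sinh r / (cosh r - cos y)) := by
  have h2 : ((y : ℂ) + r * Complex.I) / 2 = ((y / 2 : ℝ) : ℂ) + ((r / 2 : ℝ) : ℂ) * Complex.I := by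
    push_cast; ring
  rw [h2, Complex.cot_eq_cos_div_sin, Complex.sin_add_mul_I, Complex.cos_add_mul_I]
  simp only [← Complex.ofReal_sin, ← Complex.ofReal_cos, ← Complex.ofReal_sinh,
    ← Complex.ofReal_cosh, ← Complex.ofReal_mul]
  rw [Complex.div_im]
  simp only [Complex.sub_im, Complex.add_re, Complex.add_im, Complex.sub_re, Complex.ofReal_re,
    Complex.ofReal_im, Complex.mul_re, Complex.mul_im, Complex.I_re, Complex.I_im,
    Complex.normSq_apply]
  have e1 : sinh r = 2 * sinh (r / 2) * cosh (r / 2) := by rw [← sinh_two_mul]; ring_nf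
  have e2 : cosh r = 1 + 2 * sinh (r / 2) ^ 2 := by
    have := cosh_two_mul (r / 2)
    rw [mul_div_cancel₀ r two_ne_zero, cosh_sq] at this
    linarith
  have e3 : cos y = 1 - 2 * sin (y / 2) ^ 2 := by
    have := cos_two_mul (y / 2)
    rw [mul_div_cancel₀ y two_ne_zero, cos_sq'] at this
    linarith
  have e4 := cosh_sq (r / 2)
  have e5 := sin_sq_add_cos_sq (y / 2)
  have hs : 0 < sinh (r / 2) := sinh_pos_iff.2 (by positivity)
  rw [e2, e3, e1]
  generalize sinh (r / 2) = s at *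
  generalize cosh (r / 2) = C at *
  generalize sin (y / 2) = S at *
  generalize cos (y / 2) = K at *
  have hD : 0 < s ^ 2 + S ^ 2 := by positivity
  have hD' : S ^ 2 * C ^ 2 + s ^ 2 * K ^ 2 = s ^ 2 + S ^ 2 := by
    rw [e4]; linear_combination s ^ 2 * e5
  ring_nf
  rw [hD', show S ^ 2 * 2 + s ^ 2 * 2 = 2 * (s ^ 2 + S ^ 2) by ring]
  field_simp
  linear_combination -C * e5

lemma hasSum_inv_sq {r : ℝ} (hr : 0 < r) (y : ℝ) :
    HasSum (fun n : ℤ => 4 / (r ^ 2 + (y + 2 * π * n) ^ 2))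
      (2 * (sinh r / r) / (cosh r - cos y)) := by
  set x : ℂ := (y + r * Complex.I) / (2 * π) with hx
  have hpi := pi_pos
  have hxim : x.im = r / (2 * π) := by
    rw [hx, show ((2 : ℂ) * π) = ((2 * π : ℝ) : ℂ) by push_cast; ring, Complex.div_ofReal_im]
    simp
  have hxre : x.re = y / (2 * π) := by
    rw [hx, show ((2 : ℂ) * π) = ((2 * π : ℝ) : ℂ) by push_cast; ring, Complex.div_ofReal_re]
    simp
  have hxm : x ∈ Complex.integerComplement := by
    rintro ⟨n, hn⟩
    have := congrArg Complex.im hn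
    rw [hxim] at this
    simp at this
    exact absurd this (by positivity)
  have h1 := (summable_cotTerm hxm).hasSum
  have h2 : ∑' n, cotTerm x n = π * Complex.cot (π * x) - 1 / x := (cot_series_rep' hxm).symm
  rw [h2] at h1
  have h3 := Complex.hasSum_im h1
  set g : ℤ → ℝ := fun n => 4 / (r ^ 2 + (y + 2 * π * n) ^ 2) with hg
  have hgim : ∀ n : ℤ, (1 / (x + n)).im = -(π * r / 2) * g n := fun n => by
    have hpos : 0 < r ^ 2 + (y + 2 * π * n) ^ 2 := by positivity
    simp only [one_div, Complex.inv_im, Complex.normSq_apply, Complex.add_re, Complex.add_im,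
      Complex.intCast_re, Complex.intCast_im, hxre, hxim, hg]
    have : (y / (2 * π) + n) * (y / (2 * π) + n) + (r / (2 * π) + 0) * (r / (2 * π) + 0)
       = (r ^ 2 + (y + 2 * π * n) ^ 2) / (4 * π ^ 2) := by field_simp; ring
    rw [this]; field_simp; ring
  have hgpos : ∀ n, 0 ≤ g n := fun n => by simp only [hg]; positivity
  have hcot : ∀ n : ℕ, (cotTerm x n).im = -(π * r / 2) * (g (-(n + 1 : ℕ)) + g (n + 1 : ℕ)) := fun n => by
    have e1 := hgim (-(n + 1 : ℕ))
    have e2 := hgim (n + 1 : ℕ)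
    rw [mul_add, ← e1, ← e2, ← Complex.add_im]
    simp [cotTerm, sub_eq_add_neg]
  simp_rw [hcot] at h3
  have hne : -(π * r / 2) ≠ 0 := by simp only [ne_eq, neg_eq_zero]; positivity
  have h4 := h3.mul_left (-(π * r / 2))⁻¹
  simp only [← mul_assoc, inv_mul_cancel₀ hne, one_mul] at h4
  have s1 : Summable fun n : ℕ => g (n + 1 : ℕ) :=
    Summable.of_nonneg_of_le (fun _ => hgpos _) (fun n => by linarith [hgpos (-(n + 1 : ℕ))]) h4.summable
  have s2 : Summable fun n : ℕ => g (-(n + 1 : ℕ)) :=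
    Summable.of_nonneg_of_le (fun _ => hgpos _) (fun n => by linarith [hgpos (n + 1 : ℕ)]) h4.summable
  have h5 := HasSum.of_add_one_of_neg_add_one (f := g) s1.hasSum s2.hasSum
  convert h5 using 1
  have h6 := (s2.hasSum.add s1.hasSum).unique h4
  have h7 := hgim 0
  simp only [Int.cast_zero, add_zero] at h7
  rw [show ∑' n : ℕ, g (n + 1 : ℕ) + g 0 + ∑' n : ℕ, g (-(n + 1 : ℕ)) =
    (∑' n : ℕ, g (-(n + 1 : ℕ)) + ∑' n : ℕ, g (n + 1 : ℕ)) + g 0 by ring, h6, Complex.sub_im, h7]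
  rw [show (π : ℂ) * x = (y + r * Complex.I) / 2 by
    rw [hx]; have : (π : ℂ) ≠ 0 := by exact_mod_cast hpi.ne'
    field_simp]
  rw [Complex.im_ofReal_mul, im_cot_half hr]
  have : 0 < cosh r - cos y := by
    have := one_lt_cosh.2 hr.ne'
    linarith [cos_le_one y]
  field_simp
  ring

lemma bijective_zsmul_shift :
    Function.Bijective (fun n : ℤ => (⟨n • shift, n, rfl⟩ : AddSubgroup.zmultiples shift)) := by
  refine ⟨fun m n h => ?_, fun ⟨_, n, hn⟩ => ⟨n, Subtype.ext hn⟩⟩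
  have := congrFun (congrArg Subtype.val h) 3
  simpa [shift_apply_three, pi_pos.ne'] using this

lemma lintegral_eq_tsum_cell (F : (Fin 4 → ℝ) → ENNReal) :
    ∫⁻ z, F z = ∑' n : ℤ, ∫⁻ z in cell, F (n • shift + z) := by
  rw [isAddFundamentalDomain_cell.lintegral_eq_tsum'' F,
    ← (Equiv.ofBijective _ bijective_zsmul_shift).tsum_eq]
  rfl

lemma integral_eq_tsum_cell {F : (Fin 4 → ℝ) → ℝ} (hF : Integrable F) :
    ∫ z, F z = ∑' n : ℤ, ∫ z in cell, F (n • shift + z) := by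
  rw [isAddFundamentalDomain_cell.integral_eq_tsum'' F hF,
    ← (Equiv.ofBijective _ bijective_zsmul_shift).tsum_eq]
  rfl

lemma integral_eq_integral_cell_tsum {F : (Fin 4 → ℝ) → ℝ} (hF : Integrable F) :
    ∫ z, F z = ∫ z in cell, ∑' n : ℤ, F (n • shift + z) := by
  rw [integral_eq_tsum_cell hF, integral_tsum]
  · intro n
    exact ((measurePreserving_add_left volume (n • shift)).integrable_comp_of_integrable
      hF).aestronglyMeasurable.restrict
  · rw [← lintegral_eq_tsum_cell (fun z => ‖F z‖ₑ)]
    exact hF.2.ne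

lemma normSq_nonneg (z : Fin 4 → ℝ) : 0 ≤ normSq z :=
  add_nonneg (radSq_nonneg z) (sq_nonneg _)

@[fun_prop]
lemma continuous_normSq : Continuous normSq := by unfold normSq; fun_prop

variable {c : ℝ} {f : (Fin 4 → ℝ) → ℝ}

lemma inv_normSq_le {z : Fin 4 → ℝ} (hz : 0 < radSq z) :
    (normSq z)⁻¹ ≤ (1 + (radSq z)⁻¹) * (1 + z 3 ^ 2)⁻¹ := by
  have h3 := sq_nonneg (z 3)
  unfold normSq
  rw [inv_eq_one_div, div_le_iff₀ (by positivity)]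
  field_simp
  nlinarith [mul_nonneg hz.le hz.le, mul_nonneg hz.le h3]

lemma integrable_inv_normSq_mul (hc : 0 < c) (hf : Decays c f) (x : Fin 4 → ℝ) :
    Integrable fun z => 4 / normSq z * f (x - z) := by
  obtain ⟨C, hC, h⟩ := hf.bound_sub hc.le
  refine Integrable.mono' ((integrable_weight_mul hc).const_mul (4 * (C * exp (c * rad x)))) ?_ ?_
  · have := continuous_normSq.measurable
    exact ((by fun_prop : Measurable fun z => 4 / normSq z).aestronglyMeasurable).mul
      (hf.cont.comp (by fun_prop)).aestronglyMeasurable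
  · filter_upwards [ae_radSq_pos] with z hz
    have h1 := h (rad x) x z le_rfl
    have h2 := inv_normSq_le hz
    have h3 := inv_nonneg.2 (normSq_nonneg z)
    rw [norm_mul, norm_eq_abs, norm_eq_abs, abs_of_nonneg (by rw [div_eq_mul_inv]; positivity)]
    calc 4 / normSq z * |f (x - z)|
        ≤ 4 * ((1 + (radSq z)⁻¹) * (1 + z 3 ^ 2)⁻¹) * (C * exp (c * rad x) * exp (-c * rad z)) := by
          rw [div_eq_mul_inv]; gcongr
      _ = _ := by unfold weight; ring

lemma conv_ker_lap_eq (hc : 0 < c) (h : SmoothDecays c 2 f) (x : Fin 4 → ℝ) :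
    conv (ker 0) (lap f) x = ∫ z, 4 / normSq z * f (x - z) := by
  rw [conv_ker_lap hc h, integral_eq_integral_cell_tsum (integrable_inv_normSq_mul hc h.decays x)]
  refine integral_congr_ae ?_
  filter_upwards [ae_cell_radSq_pos] with z hz
  have hp : ∀ n : ℤ, f (x - (n • shift + z)) = f (x - z) := fun n => by
    have := h.decays.periodic.sub_zsmul_eq n (x := x - z)
    rw [← this]; congr 1; abel
  have hr : 0 < rad z := Real.sqrt_pos.2 hz
  simp_rw [hp, tsum_mul_right, normSq_add_zsmul_shift, ← rad_sq z]
  rw [(hasSum_inv_sq hr (z 3)).tsum_eq, sden, reg_zero]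
  congr 1
  rw [show 2 * cosh (rad z) - 2 * cos (z 3) = 2 * (cosh (rad z) - cos (z 3)) by ring,
    show 4 * (sinh (rad z) / rad z) = 2 * (2 * (sinh (rad z) / rad z)) by ring,
    mul_div_mul_left _ _ two_ne_zero]

lemma integrable_mul_of_le (hc : 0 < c) (hf : Decays c f) (x : Fin 4 → ℝ)
    {P : (Fin 4 → ℝ) → ℝ} (hP : Continuous P) {K : ℝ} (hK : ∀ z, |P z| ≤ K * (1 + z 3 ^ 2)⁻¹) :
    Integrable fun z => P z * f (x - z) := by
  obtain ⟨C, hC, h⟩ := hf.bound_sub hc.le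
  refine Integrable.mono' ((integrable_weight_mul hc).const_mul (K * (C * exp (c * rad x)))) ?_ ?_
  · exact (hP.mul (hf.cont.comp (by fun_prop))).aestronglyMeasurable
  · refine ae_of_all _ fun z => ?_
    have h1 := h (rad x) x z le_rfl
    have hK0 : 0 ≤ K * (1 + z 3 ^ 2)⁻¹ := (abs_nonneg _).trans (hK z)
    have hq := inv_nonneg.2 (radSq_nonneg z)
    have hw : exp (-c * rad z) ≤ weight c z := le_mul_of_one_le_right (exp_pos _).le (by linarith)
    rw [norm_mul, norm_eq_abs, norm_eq_abs]
    calc |P z| * |f (x - z)| ≤ (K * (1 + z 3 ^ 2)⁻¹) * (C * exp (c * rad x) * weight c z) := by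
          gcongr
          · exact hK z
          · exact h1.trans (by gcongr)
      _ = _ := by ring

/-- Integration by parts against a decaying function, on the whole space. -/
lemma integral_mul_par_sub (hc : 0 < c) (hf : Decays c f) (hf1 : Differentiable ℝ f) {i : Fin 4}
    (hf' : Decays c (par i f)) (x : Fin 4 → ℝ) {P P' : (Fin 4 → ℝ) → ℝ}
    (hP : Differentiable ℝ P) (hP' : Continuous P') (hpar : ∀ z, par i P z = P' z) {K : ℝ}
    (hK : ∀ z, |P z| ≤ K * (1 + z 3 ^ 2)⁻¹) (hK' : ∀ z, |P' z| ≤ K * (1 + z 3 ^ 2)⁻¹) :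
    ∫ z, P z * par i f (x - z) = ∫ z, P' z * f (x - z) := by
  have hd : ∀ z, fderiv ℝ (fun z => f (x - z)) z (Pi.single i 1) = -par i f (x - z) := fun z => by
    have h1 : HasFDerivAt (fun z : Fin 4 → ℝ => x - z) (-ContinuousLinearMap.id ℝ _) z :=
      (hasFDerivAt_id z).const_sub x
    have h2 := ((hf1 (x - z)).hasFDerivAt).comp z h1
    rw [show (fun z => f (x - z)) = f ∘ fun z => x - z from rfl, h2.fderiv]
    simp [par]
  have hpar' : ∀ z, fderiv ℝ P z (Pi.single i 1) = P' z := hpar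
  have := integral_mul_fderiv_eq_neg_fderiv_mul_of_integrable (μ := (volume : Measure (Fin 4 → ℝ)))
    (f := P) (g := fun z => f (x - z)) (v := Pi.single i 1) ?_ ?_ ?_ (fun z _ => hP z)
    (fun z _ => (hf1.comp ((differentiable_const x).sub differentiable_id)) z)
  · simp_rw [hd, hpar', mul_neg, integral_neg, neg_inj] at this
    exact this
  · simp_rw [hpar']; exact integrable_mul_of_le hc hf x hP' hK'
  · simp_rw [hd, mul_neg]; exact (integrable_mul_of_le hc hf' x hP.continuous hK).neg
  · exact integrable_mul_of_le hc hf x hP.continuous hK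

lemma normSq_add_smul_single (z : Fin 4 → ℝ) (i : Fin 4) (t : ℝ) :
    normSq (z + t • Pi.single i 1) = normSq z + (2 * z i * t + t ^ 2) := by
  unfold normSq radSq
  fin_cases i <;> simp <;> ring

lemma contDiff_normSq : ContDiff ℝ 2 normSq := by unfold normSq radSq; fun_prop

lemma par_eq_of_hasDerivAt {P : (Fin 4 → ℝ) → ℝ} (hP : Differentiable ℝ P) {i : Fin 4}
    {z : Fin 4 → ℝ} {p : ℝ} (h : HasDerivAt (fun t : ℝ => P (z + t • Pi.single i 1)) p 0) :
    par i P z = p := by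
  rw [par, ← (hP z).lineDeriv_eq_fderiv]
  exact h.deriv

/-- The regularized fundamental solution. -/
noncomputable def fund (a : ℝ) (z : Fin 4 → ℝ) : ℝ := 4 * (normSq z + a)⁻¹

noncomputable def dfund (a : ℝ) (i : Fin 4) (z : Fin 4 → ℝ) : ℝ := -8 * z i * (normSq z + a)⁻¹ ^ 2

noncomputable def ddfund (a : ℝ) (i : Fin 4) (z : Fin 4 → ℝ) : ℝ :=
  -8 * (normSq z + a)⁻¹ ^ 2 + 32 * z i ^ 2 * (normSq z + a)⁻¹ ^ 3

variable {a : ℝ}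

lemma contDiff_inv_normSq (ha : 0 < a) : ContDiff ℝ 2 fun z => (normSq z + a)⁻¹ :=
  (contDiff_normSq.add contDiff_const).inv fun z => by linarith [normSq_nonneg z]

lemma differentiable_fund (ha : 0 < a) : Differentiable ℝ (fund a) :=
  ((contDiff_inv_normSq ha).differentiable (by norm_num)).const_mul 4

lemma differentiable_dfund (ha : 0 < a) (i : Fin 4) : Differentiable ℝ (dfund a i) := by
  have := (contDiff_inv_normSq ha).differentiable (by norm_num)
  unfold dfund
  fun_prop

lemma continuous_ddfund (ha : 0 < a) (i : Fin 4) : Continuous (ddfund a i) := by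
  have := (contDiff_inv_normSq ha).continuous
  unfold ddfund
  fun_prop

lemma hasDerivAt_inv_normSq (ha : 0 < a) (i : Fin 4) (z : Fin 4 → ℝ) :
    HasDerivAt (fun t : ℝ => (normSq (z + t • Pi.single i 1) + a)⁻¹)
      (-(2 * z i) * (normSq z + a)⁻¹ ^ 2) 0 := by
  have hz : normSq z + a ≠ 0 := by linarith [normSq_nonneg z]
  simp_rw [normSq_add_smul_single]
  have h1 : HasDerivAt (fun t : ℝ => normSq z + (2 * z i * t + t ^ 2) + a) (2 * z i) 0 := by
    have := ((((hasDerivAt_id (0 : ℝ)).const_mul (2 * z i)).add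
      ((hasDerivAt_id (0 : ℝ)).pow 2)).const_add (normSq z)).add_const a
    simpa using this
  have := h1.fun_inv (by simpa using hz)
  refine this.congr_deriv ?_
  simp [div_eq_mul_inv]

lemma par_fund (ha : 0 < a) (i : Fin 4) (z : Fin 4 → ℝ) : par i (fund a) z = dfund a i z :=
  par_eq_of_hasDerivAt (differentiable_fund ha)
    (((hasDerivAt_inv_normSq ha i z).const_mul 4).congr_deriv (by unfold dfund; ring))

lemma par_dfund (ha : 0 < a) (i : Fin 4) (z : Fin 4 → ℝ) :
    par i (dfund a i) z = ddfund a i z := by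
  refine par_eq_of_hasDerivAt (differentiable_dfund ha i) ?_
  have h1 : HasDerivAt (fun t : ℝ => (z + t • (Pi.single i 1 : Fin 4 → ℝ)) i) 1 0 := by
    have := (hasDerivAt_id (0 : ℝ)).const_add (z i)
    simpa using this
  have := (h1.const_mul (-8)).mul ((hasDerivAt_inv_normSq ha i z).pow 2)
  refine this.congr_deriv ?_
  simp only [Pi.pow_apply, zero_smul, add_zero, ddfund, Nat.cast_ofNat]
  ring

lemma inv_normSq_add_le (ha : 0 < a) (ha1 : a ≤ 1) (z : Fin 4 → ℝ) :
    (normSq z + a)⁻¹ ≤ a⁻¹ * (1 + z 3 ^ 2)⁻¹ := by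
  have := radSq_nonneg z
  have h3 := sq_nonneg (z 3)
  rw [← mul_inv]
  gcongr
  unfold normSq; nlinarith

lemma sq_apply_le_normSq (z : Fin 4 → ℝ) (i : Fin 4) : z i ^ 2 ≤ normSq z := by
  unfold normSq radSq
  fin_cases i <;> simp <;> nlinarith [sq_nonneg (z 0), sq_nonneg (z 1), sq_nonneg (z 2), sq_nonneg (z 3)]

lemma abs_fund_le (ha : 0 < a) (ha1 : a ≤ 1) (z : Fin 4 → ℝ) :
    |fund a z| ≤ 40 * a⁻¹ ^ 2 * (1 + z 3 ^ 2)⁻¹ ∧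
    (∀ i, |dfund a i z| ≤ 40 * a⁻¹ ^ 2 * (1 + z 3 ^ 2)⁻¹) ∧
    ∀ i, |ddfund a i z| ≤ 40 * a⁻¹ ^ 2 * (1 + z 3 ^ 2)⁻¹ := by
  have hN := normSq_nonneg z
  have hs : 0 < normSq z + a := by linarith
  have h1 := inv_normSq_add_le ha ha1 z
  have hp : 0 < (normSq z + a)⁻¹ := inv_pos.2 hs
  have hq : 0 < (1 + z 3 ^ 2)⁻¹ := by positivity
  have ha' : 1 ≤ a⁻¹ := (one_le_inv₀ ha).2 ha1
  have h2 : (normSq z + a)⁻¹ ≤ a⁻¹ := by gcongr; linarith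
  have h3 : ∀ i, z i ^ 2 * (normSq z + a)⁻¹ ≤ 1 := fun i => by
    rw [← div_eq_mul_inv, div_le_one hs]; linarith [sq_apply_le_normSq z i]
  have h4 : ∀ i, |z i| * (normSq z + a)⁻¹ ≤ a⁻¹ := fun i => by
    rw [← div_eq_mul_inv, div_le_iff₀ hs, mul_add, inv_mul_cancel₀ ha.ne']
    nlinarith [sq_apply_le_normSq z i, sq_abs (z i), sq_nonneg (|z i| - 1)]
  set p := (normSq z + a)⁻¹
  set q := (1 + z 3 ^ 2)⁻¹
  have h5 : a⁻¹ * q ≤ a⁻¹ ^ 2 * q := by nlinarith [mul_pos (inv_pos.2 ha) hq]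
  have h6 : a⁻¹ * p ≤ a⁻¹ ^ 2 * q := by nlinarith [inv_pos.2 ha]
  have h7 : p ^ 2 ≤ a⁻¹ ^ 2 * q := by nlinarith
  refine ⟨?_, fun i => ?_, fun i => ?_⟩
  · rw [fund, abs_of_nonneg (by positivity)]
    nlinarith [mul_pos (inv_pos.2 ha) hq]
  · have e8 : |dfund a i z| = 8 * (|z i| * p ^ 2) := by
      rw [dfund, abs_mul, abs_mul, abs_of_nonneg (sq_nonneg (normSq z + a)⁻¹),
        show |(-8 : ℝ)| = 8 by norm_num]
      ring
    rw [e8]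
    have : |z i| * p ^ 2 ≤ a⁻¹ * p := by nlinarith [h4 i]
    nlinarith [mul_pos (inv_pos.2 ha) hq]
  · have e : z i ^ 2 * p ^ 3 ≤ p ^ 2 := by
      have := mul_le_mul_of_nonneg_right (h3 i) (sq_nonneg p)
      nlinarith
    have e0 : 0 ≤ z i ^ 2 * p ^ 3 := by positivity
    rw [ddfund, abs_le]
    constructor <;> nlinarith [sq_nonneg p]

lemma sum_ddfund (ha : 0 < a) (z : Fin 4 → ℝ) :
    ∑ i, ddfund a i z = -32 * a * (normSq z + a)⁻¹ ^ 3 := by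
  have hs : normSq z + a ≠ 0 := by linarith [normSq_nonneg z]
  have hN : z 0 ^ 2 + z 1 ^ 2 + z 2 ^ 2 + z 3 ^ 2 = normSq z := by simp [normSq, radSq]
  simp only [Fin.sum_univ_four, ddfund]
  rw [show ∀ p q : ℝ, -8 * p + 32 * z 0 ^ 2 * q + (-8 * p + 32 * z 1 ^ 2 * q) +
    (-8 * p + 32 * z 2 ^ 2 * q) + (-8 * p + 32 * z 3 ^ 2 * q) =
    -32 * p + 32 * (z 0 ^ 2 + z 1 ^ 2 + z 2 ^ 2 + z 3 ^ 2) * q by intros; ring, hN]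
  field_simp
  ring

lemma integral_fund_mul_lap (ha : 0 < a) (ha1 : a ≤ 1) (hc : 0 < c) (h : SmoothDecays c 2 f)
    (x : Fin 4 → ℝ) :
    ∫ z, fund a z * lap f (x - z) = ∫ z, -32 * a * (normSq z + a)⁻¹ ^ 3 * f (x - z) := by
  have key : ∀ i, ∫ z, fund a z * par i (par i f) (x - z) = ∫ z, ddfund a i z * f (x - z) :=
    fun i => by
    rw [integral_mul_par_sub hc (h.2.2 i).1 (h.2.2 i).2.1 ((h.2.2 i).2.2 i).decays x
      (differentiable_fund ha) (differentiable_dfund ha i).continuous (par_fund ha i)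
      (fun z => (abs_fund_le ha ha1 z).1) (fun z => (abs_fund_le ha ha1 z).2.1 i),
      integral_mul_par_sub hc h.1 h.2.1 (h.2.2 i).decays x
      (differentiable_dfund ha i) (continuous_ddfund ha i) (par_dfund ha i)
      (fun z => (abs_fund_le ha ha1 z).2.1 i) (fun z => (abs_fund_le ha ha1 z).2.2 i)]
  simp_rw [lap, Finset.mul_sum, ← sum_ddfund ha, Finset.sum_mul]
  rw [integral_finsetSum, integral_finsetSum]
  · exact Finset.sum_congr rfl fun i _ => key i
  · exact fun i _ => integrable_mul_of_le hc h.1 x (continuous_ddfund ha i)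
      fun z => (abs_fund_le ha ha1 z).2.2 i
  · exact fun i _ => integrable_mul_of_le hc ((h.2.2 i).2.2 i).decays x
      (differentiable_fund ha).continuous fun z => (abs_fund_le ha ha1 z).1

lemma integrable_inv_normSq_pow :
    Integrable fun w : Fin 4 → ℝ => (normSq w + 1)⁻¹ ^ 3 := by
  have h := integrable_rpow_neg_one_add_norm_sq (E := Fin 4 → ℝ) (μ := volume) (r := 6)
    (by simp; norm_num)
  refine h.mono' (by
    have := (contDiff_inv_normSq one_pos).continuous
    exact (this.pow 3).aestronglyMeasurable) (ae_of_all _ fun w => ?_)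
  have hN := normSq_nonneg w
  rw [norm_of_nonneg (by positivity), show (-6 / 2 : ℝ) = -(3 : ℕ) by norm_num, rpow_neg
    (by positivity), rpow_natCast, ← inv_pow, add_comm (normSq w)]
  gcongr
  obtain ⟨i, hi⟩ : ∃ i, ‖w‖ = ‖w i‖ := by
    obtain ⟨i, -, hi⟩ := Finset.exists_mem_eq_sup (Finset.univ : Finset (Fin 4)) Finset.univ_nonempty
      (fun b => ‖w b‖₊)
    exact ⟨i, congrArg NNReal.toReal hi⟩
  rw [hi, norm_eq_abs, sq_abs]
  exact sq_apply_le_normSq w i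

lemma integral_inv_normSq_pow_pos : 0 < ∫ w : Fin 4 → ℝ, (normSq w + 1)⁻¹ ^ 3 := by
  have hp : ∀ w, 0 < (normSq w + 1)⁻¹ ^ 3 := fun w => by
    have := normSq_nonneg w
    positivity
  rw [integral_pos_iff_support_of_nonneg (fun w => (hp w).le) integrable_inv_normSq_pow]
  rw [show Function.support (fun w => (normSq w + 1)⁻¹ ^ 3) = univ from
    eq_univ_of_forall fun w => (hp w).ne']
  simp

lemma integral_scaled {ε : ℝ} (hε : 0 < ε) (x : Fin 4 → ℝ) :
    ∫ z, -32 * ε ^ 2 * (normSq z + ε ^ 2)⁻¹ ^ 3 * f (x - z) =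
      -32 * ∫ w, (normSq w + 1)⁻¹ ^ 3 * f (x - ε • w) := by
  have h := Measure.integral_comp_smul (volume : Measure (Fin 4 → ℝ))
    (fun z => -32 * ε ^ 2 * (normSq z + ε ^ 2)⁻¹ ^ 3 * f (x - z)) ε
  have h1 : ∀ w, normSq (ε • w) = ε ^ 2 * normSq w := fun w => by
    simp only [normSq, radSq, Pi.smul_apply, smul_eq_mul]; ring
  have h2 : ∀ w, -32 * ε ^ 2 * (normSq (ε • w) + ε ^ 2)⁻¹ ^ 3 * f (x - ε • w) =
      (ε ^ 4)⁻¹ * (-32 * ((normSq w + 1)⁻¹ ^ 3 * f (x - ε • w))) := fun w => by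
    have := normSq_nonneg w
    rw [h1, show ε ^ 2 * normSq w + ε ^ 2 = ε ^ 2 * (normSq w + 1) by ring]
    field_simp
  simp_rw [h2, integral_const_mul, Module.finrank_fin_fun, smul_eq_mul,
    abs_of_pos (inv_pos.2 (pow_pos hε 4))] at h
  exact (mul_left_cancel₀ (inv_pos.2 (pow_pos hε 4)).ne' h).symm

lemma integral_normSq_mul_lap (hc : 0 < c) (h : SmoothDecays c 2 f) (x : Fin 4 → ℝ) :
    ∫ z, 4 / normSq z * lap f (x - z) = -(32 * ∫ w, (normSq w + 1)⁻¹ ^ 3) * f x := by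
  have hl : SmoothDecays c 0 (lap f) := h.lap
  have hl : Decays c (lap f) := hl
  set ε : ℕ → ℝ := fun n => 1 / ((n : ℝ) + 1) with hε
  have hε0 : ∀ n, 0 < ε n := fun n => by simp only [hε]; positivity
  have hε1 : ∀ n, ε n ≤ 1 := fun n => by
    simp only [hε]; rw [div_le_one (by positivity)]; linarith [n.cast_nonneg (α := ℝ)]
  have hεt : Tendsto ε atTop (𝓝 0) := tendsto_one_div_add_atTop_nhds_zero_nat
  have hεt2 : Tendsto (fun n => ε n ^ 2) atTop (𝓝 0) := by simpa using hεt.pow 2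
  have L1 : Tendsto (fun n => ∫ z, fund (ε n ^ 2) z * lap f (x - z)) atTop
      (𝓝 (∫ z, 4 / normSq z * lap f (x - z))) := by
    refine tendsto_integral_of_dominated_convergence (fun z => ‖4 / normSq z * lap f (x - z)‖)
      (fun n => ((differentiable_fund (pow_pos (hε0 n) 2)).continuous.mul
        (hl.cont.comp (by fun_prop))).aestronglyMeasurable)
      (integrable_inv_normSq_mul hc hl x).norm (fun n => ?_) ?_
    · filter_upwards [ae_radSq_pos] with z hz
      have hN : 0 < normSq z := by unfold normSq; positivity
      have := pow_pos (hε0 n) 2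
      rw [norm_mul, norm_mul]
      refine mul_le_mul_of_nonneg_right ?_ (norm_nonneg _)
      rw [fund, div_eq_mul_inv, norm_of_nonneg (by positivity), norm_of_nonneg (by positivity)]
      gcongr
      linarith
    · filter_upwards [ae_radSq_pos] with z hz
      have hN : 0 < normSq z := by unfold normSq; positivity
      have : Tendsto (fun n => fund (ε n ^ 2) z) atTop (𝓝 (4 * (normSq z + 0)⁻¹)) :=
        ((hεt2.const_add (normSq z)).inv₀ (by simpa using hN.ne')).const_mul 4
      simpa [div_eq_mul_inv] using this.mul_const (lap f (x - z))
  have L2 : Tendsto (fun n => ∫ w, (normSq w + 1)⁻¹ ^ 3 * f (x - ε n • w)) atTop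
      (𝓝 (∫ w, (normSq w + 1)⁻¹ ^ 3 * f x)) := by
    obtain ⟨C, hC, hb⟩ := h.decays.bound
    refine tendsto_integral_of_dominated_convergence (fun w => (normSq w + 1)⁻¹ ^ 3 * C)
      (fun n => (((contDiff_inv_normSq one_pos).continuous.pow 3).mul
        (h.decays.cont.comp (by fun_prop))).aestronglyMeasurable)
      (integrable_inv_normSq_pow.mul_const C) (fun n => ae_of_all _ fun w => ?_)
      (ae_of_all _ fun w => ?_)
    · have hN := normSq_nonneg w
      rw [norm_mul, norm_of_nonneg (by positivity : 0 ≤ (normSq w + 1)⁻¹ ^ 3), norm_eq_abs]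
      gcongr
      refine (hb _).trans (mul_le_of_le_one_right hC ?_)
      rw [exp_le_one_iff]
      nlinarith [rad_nonneg (x - ε n • w)]
    · have : Tendsto (fun n => x - ε n • w) atTop (𝓝 x) := by
        simpa using (hεt.smul_const w).const_sub x
      exact ((h.decays.cont.tendsto x).comp this).const_mul _
  have L3 : ∀ n, ∫ z, fund (ε n ^ 2) z * lap f (x - z) =
      -32 * ∫ w, (normSq w + 1)⁻¹ ^ 3 * f (x - ε n • w) := fun n => by
    rw [integral_fund_mul_lap (pow_pos (hε0 n) 2) (pow_le_one₀ (hε0 n).le (hε1 n)) hc h x,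
      integral_scaled (hε0 n)]
  simp_rw [L3] at L1
  rw [tendsto_nhds_unique L1 (L2.const_mul (-32)), integral_mul_const]
  ring

/-- The convolution kernel is a fundamental solution of the squared Laplacian on the cylinder. -/
lemma exists_conv_ker_lap_lap : ∃ κ : ℝ, 0 < κ ∧ ∀ c, 0 < c → ∀ f, SmoothDecays c 4 f →
    ∀ x, conv (ker 0) (lap (lap f)) x = -κ * f x := by
  refine ⟨32 * ∫ w : Fin 4 → ℝ, (normSq w + 1)⁻¹ ^ 3,
    mul_pos (by norm_num) integral_inv_normSq_pow_pos, fun c hc f h x => ?_⟩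
  rw [conv_ker_lap_eq hc (SmoothDecays.lap h), integral_normSq_mul_lap hc h.of_succ.of_succ]

end CylinderLiouville

namespace CylinderLiouville
open Real Set Filter Topology

variable {c B Λ : ℝ} {f g : (Fin 4 → ℝ) → ℝ}

lemma abs_conv_ker_le (hc : 0 < c) : ∃ K, 0 ≤ K ∧ ∀ (f : (Fin 4 → ℝ) → ℝ) (C : ℝ), 0 ≤ C →
    (∀ x, |f x| ≤ C * exp (-c * rad x)) → ∀ x, |conv (ker 0) f x| ≤ C * K * (1 + rad x) := by
  obtain ⟨K, hK, h⟩ := integral_inv_mul_exp_le (half_pos hc)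
  refine ⟨3 * (1 + 2 / c) * K, by positivity, fun f C hC hf x => ?_⟩
  obtain ⟨h1, h2⟩ := h x
  have hx := rad_nonneg x
  unfold conv
  rw [← Real.norm_eq_abs]
  refine (norm_integral_le_of_norm_le
    (h1.const_mul (C * (3 * (1 + 2 / c)) * (1 + rad x))) ?_).trans ?_
  · filter_upwards [ae_cell_radSq_pos] with z hz
    rw [norm_mul, Real.norm_eq_abs, Real.norm_eq_abs]
    have hq := inv_pos.2 hz
    have hw := rad_nonneg (x - z)
    have h3 : |ker 0 z| ≤ 3 * (1 + rad x) * (1 + rad (x - z)) * (2 + (radSq z)⁻¹) := by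
      have e1 := abs_ker_le (a := 0) (z := z) le_rfl zero_le_one (by linarith)
      have e2 : rad z ≤ rad x + rad (x - z) := by
        have := rad_le_sub_add z x
        rw [rad_sub_comm] at this; linarith
      have e3 : 2 + (radSq z)⁻¹ ≤ (1 + rad x) * (1 + rad (x - z)) * (2 + (radSq z)⁻¹) :=
        le_mul_of_one_le_left (by positivity) (by nlinarith [mul_nonneg hx hw])
      have e4 : rad x + rad (x - z) ≤ (1 + rad x) * (1 + rad (x - z)) * (2 + (radSq z)⁻¹) := by
        have : rad x + rad (x - z) ≤ (1 + rad x) * (1 + rad (x - z)) := by nlinarith [mul_nonneg hx hw]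
        exact this.trans (le_mul_of_one_le_right (by positivity) (by linarith))
      linarith
    have h4 := one_add_rad_mul_exp_le hc (x - z)
    calc |ker 0 z| * |f (x - z)|
        ≤ (3 * (1 + rad x) * (1 + rad (x - z)) * (2 + (radSq z)⁻¹)) *
          (C * exp (-c * rad (x - z))) := mul_le_mul h3 (hf _) (abs_nonneg _) (by positivity)
      _ = 3 * C * (1 + rad x) * (2 + (radSq z)⁻¹) *
          ((1 + rad (x - z)) * exp (-c * rad (x - z))) := by ring
      _ ≤ 3 * C * (1 + rad x) * (2 + (radSq z)⁻¹) *
          ((1 + 2 / c) * exp (-(c / 2) * rad (x - z))) := by gcongr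
      _ = _ := by ring
  · rw [integral_const_mul]
    calc _ ≤ C * (3 * (1 + 2 / c)) * (1 + rad x) * K := by gcongr
      _ = _ := by ring

lemma abs_mul_log_le {t : ℝ} (ht : 0 ≤ t) : |t * log t| ≤ 2 * √t + t ^ 2 := by
  rcases ht.eq_or_lt with rfl | ht
  · simp
  rcases le_total t 1 with h | h
  · have h1 := abs_log_mul_self_lt (√t) (Real.sqrt_pos.2 ht) (Real.sqrt_le_one.2 h)
    have h2 : t * log t = 2 * √t * (log √t * √t) := by
      rw [Real.log_sqrt ht.le]
      nth_rw 1 [← Real.mul_self_sqrt ht.le]; ring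
    rw [h2, abs_mul, abs_of_nonneg (by positivity)]
    have := Real.sqrt_nonneg t
    nlinarith [sq_nonneg t]
  · have h1 := log_nonneg h
    have h2 := log_le_self ht.le
    rw [abs_of_nonneg (by positivity)]
    have := Real.sqrt_nonneg t
    nlinarith

/-- Nonnegative Lipschitz functions with prescribed symmetries and decay. -/
structure Prof (c B Λ : ℝ) (f : (Fin 4 → ℝ) → ℝ) : Prop where
  radial : ∀ x y, radSq x = radSq y → x 3 = y 3 → f x = f y
  even : ∀ x, f (-x) = f x
  periodic : Function.Periodic f shift
  nonneg : ∀ x, 0 ≤ f x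
  le : ∀ x, f x ≤ B * exp (-c * rad x)
  lip : ∀ x y, |f x - f y| ≤ Λ * ‖x - y‖

lemma Prof.cont (h : Prof c B Λ f) : Continuous f :=
  (LipschitzWith.of_dist_le' (K := Λ) fun x y => by
    rw [Real.dist_eq, dist_eq_norm]; exact h.lip x y).continuous

lemma rad_zero : rad 0 = 0 := by simp [rad, radSq]

lemma Prof.const_nonneg (h : Prof c B Λ f) : 0 ≤ B := by
  have := (h.nonneg 0).trans (h.le 0)
  simpa [rad_zero] using this

lemma Prof.abs_le (h : Prof c B Λ f) (x : Fin 4 → ℝ) : |f x| ≤ B * exp (-c * rad x) := by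
  rw [abs_of_nonneg (h.nonneg x)]; exact h.le x

lemma Prof.decays (h : Prof c B Λ f) : Decays c f :=
  ⟨h.cont, h.periodic, B, h.const_nonneg, h.abs_le⟩

/-- The entropy in one period cell. -/
noncomputable def ent (f : (Fin 4 → ℝ) → ℝ) : ℝ := ∫ z in cell, f z * log (f z)

/-- The interaction energy in one period cell. -/
noncomputable def energy (f : (Fin 4 → ℝ) → ℝ) : ℝ := ∫ z in cell, f z * conv (ker 0) f z

lemma Prof.abs_mul_log_le (h : Prof c B Λ f) (x : Fin 4 → ℝ) (hc : 0 ≤ c) :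
    |f x * log (f x)| ≤ (2 * √B + B ^ 2) * exp (-(c / 2) * rad x) := by
  have hB := h.const_nonneg
  have hx := rad_nonneg x
  refine (CylinderLiouville.abs_mul_log_le (h.nonneg x)).trans ?_
  have h1 : √(f x) ≤ √B * exp (-(c / 2) * rad x) := by
    refine (Real.sqrt_le_sqrt (h.le x)).trans (le_of_eq ?_)
    rw [Real.sqrt_mul hB, Real.sqrt_eq_iff_mul_self_eq (exp_pos _).le (exp_pos _).le |>.2]
    rw [← exp_add]; ring_nf
  have h2 : f x ^ 2 ≤ B ^ 2 * exp (-(c / 2) * rad x) := by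
    refine (pow_le_pow_left₀ (h.nonneg x) (h.le x) 2).trans ?_
    rw [mul_pow]
    gcongr
    rw [← exp_nat_mul]
    apply exp_le_exp.2
    push_cast
    nlinarith [mul_nonneg hc hx]
  linarith

lemma integrableOn_mul_log (hc : 0 < c) (h : Prof c B Λ f) :
    IntegrableOn (fun z => f z * log (f z)) cell :=
  Integrable.mono' ((integrableOn_exp (half_pos hc)).const_mul _)
    (continuous_mul_log.comp h.cont).aestronglyMeasurable
    (ae_of_all _ fun z => h.abs_mul_log_le z hc.le)

lemma integrableOn_one_add_rad_mul_exp (hc : 0 < c) :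
    IntegrableOn (fun z => (1 + rad z) * exp (-c * rad z)) cell := by
  refine Integrable.mono' ((integrableOn_exp (half_pos hc)).const_mul (1 + 2 / c))
    (by have := continuous_rad; exact Continuous.aestronglyMeasurable (by fun_prop))
    (ae_of_all _ fun z => ?_)
  have := rad_nonneg z
  rw [norm_of_nonneg (by positivity)]
  exact one_add_rad_mul_exp_le hc z

/-- A continuous function of at most linear growth is integrable against a decaying one. -/
lemma integrableOn_mul_of_growth (hc : 0 < c) (hf : Decays c f) {φ : (Fin 4 → ℝ) → ℝ}
    (hφ : AEStronglyMeasurable φ (volume.restrict cell)) {C : ℝ} (h : ∀ z, |φ z| ≤ C * (1 + rad z)) :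
    IntegrableOn (fun z => f z * φ z) cell := by
  obtain ⟨A, hA, hb⟩ := hf.bound
  refine Integrable.mono' ((integrableOn_one_add_rad_mul_exp hc).const_mul (A * C))
    (hf.cont.aestronglyMeasurable.mul hφ) (ae_of_all _ fun z => ?_)
  rw [norm_mul, norm_eq_abs, norm_eq_abs]
  calc |f z| * |φ z| ≤ (A * exp (-c * rad z)) * (C * (1 + rad z)) :=
        mul_le_mul (hb z) (h z) (abs_nonneg _) (by positivity)
    _ = _ := by ring

lemma integrableOn_mul_conv_ker (hc : 0 < c) (hf : Decays c f) (hg : Decays c g) :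
    IntegrableOn (fun z => f z * conv (ker 0) g z) cell := by
  obtain ⟨K, hK, h⟩ := abs_conv_ker_le hc
  obtain ⟨A, hA, hb⟩ := hg.bound
  exact integrableOn_mul_of_growth hc hf
    (continuous_conv hc (isKernel_ker le_rfl zero_le_one) hg).aestronglyMeasurable (h g A hA hb)

section Limits

variable {F : ℕ → (Fin 4 → ℝ) → ℝ}

lemma tendsto_integral_cell (hc : 0 < c) (hF : ∀ n, Prof c B Λ (F n))
    (hl : ∀ x, Tendsto (fun n => F n x) atTop (𝓝 (f x))) :
    Tendsto (fun n => ∫ z in cell, F n z) atTop (𝓝 (∫ z in cell, f z)) :=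
  tendsto_integral_of_dominated_convergence (fun z => B * exp (-c * rad z))
    (fun n => (hF n).cont.aestronglyMeasurable) ((integrableOn_exp hc).const_mul B)
    (fun n => ae_of_all _ fun z => (hF n).abs_le z) (ae_of_all _ hl)

lemma tendsto_ent (hc : 0 < c) (hF : ∀ n, Prof c B Λ (F n))
    (hl : ∀ x, Tendsto (fun n => F n x) atTop (𝓝 (f x))) :
    Tendsto (fun n => ent (F n)) atTop (𝓝 (ent f)) :=
  tendsto_integral_of_dominated_convergence
    (fun z => (2 * √B + B ^ 2) * exp (-(c / 2) * rad z))
    (fun n => (continuous_mul_log.comp (hF n).cont).aestronglyMeasurable)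
    ((integrableOn_exp (half_pos hc)).const_mul _)
    (fun n => ae_of_all _ fun z => (hF n).abs_mul_log_le z hc.le)
    (ae_of_all _ fun z => (continuous_mul_log.tendsto (f z)).comp (hl z))

lemma tendsto_conv_ker (hc : 0 < c) (hF : ∀ n, Prof c B Λ (F n))
    (hl : ∀ x, Tendsto (fun n => F n x) atTop (𝓝 (f x))) (x : Fin 4 → ℝ) :
    Tendsto (fun n => conv (ker 0) (F n) x) atTop (𝓝 (conv (ker 0) f x)) := by
  refine tendsto_integral_of_dominated_convergence
    (fun z => B * exp (c * rad x) * (kerBound z * exp (-c * rad z)))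
    (fun n => conv_aestronglyMeasurable (measurable_ker 0) (hF n).cont x)
    ((integrableOn_kerBound hc).const_mul _) (fun n => ?_)
    (ae_of_all _ fun z => (hl (x - z)).const_mul _)
  filter_upwards [ae_cell_radSq_pos] with z hz
  refine (isKernel_ker le_rfl zero_le_one).norm_mul_le hz (((hF n).abs_le _).trans ?_)
  rw [mul_assoc]
  exact mul_le_mul_of_nonneg_left (exp_neg_rad_sub_le hc.le x z) (hF n).const_nonneg

lemma tendsto_energy (hc : 0 < c) (hF : ∀ n, Prof c B Λ (F n))
    (hl : ∀ x, Tendsto (fun n => F n x) atTop (𝓝 (f x))) :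
    Tendsto (fun n => energy (F n)) atTop (𝓝 (energy f)) := by
  obtain ⟨K, hK, h⟩ := abs_conv_ker_le hc
  have hB := (hF 0).const_nonneg
  refine tendsto_integral_of_dominated_convergence
    (fun z => B * (B * K) * ((1 + rad z) * exp (-c * rad z))) (fun n => ?_)
    ((integrableOn_one_add_rad_mul_exp hc).const_mul _) (fun n => ae_of_all _ fun z => ?_)
    (ae_of_all _ fun z => (hl z).mul (tendsto_conv_ker hc hF hl z))
  · exact ((hF n).cont.mul (continuous_conv hc (isKernel_ker le_rfl zero_le_one)
      (hF n).decays)).aestronglyMeasurable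
  · have hz := rad_nonneg z
    rw [norm_mul, norm_eq_abs, norm_eq_abs]
    calc _ ≤ (B * exp (-c * rad z)) * (B * K * (1 + rad z)) :=
          mul_le_mul ((hF n).abs_le z) (h _ B hB (hF n).abs_le z) (abs_nonneg _) (by positivity)
      _ = _ := by ring

end Limits

/-- The functional to be minimized. -/
noncomputable def func (κ : ℝ) (f : (Fin 4 → ℝ) → ℝ) : ℝ := κ * exp (ent f) + energy f / 2

lemma isCompact_prof (c B Λ : ℝ) : IsCompact {φ : C(Fin 4 → ℝ, ℝ) | Prof c B Λ φ} := by
  refine ArzelaAscoli.isCompact_of_equicontinuous _ ?_ ?_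
  · have e : ContinuousMap.toFun '' {φ : C(Fin 4 → ℝ, ℝ) | Prof c B Λ φ} =
        {f | Prof c B Λ f} := by
      ext f
      constructor
      · rintro ⟨φ, hφ, rfl⟩; exact hφ
      · exact fun hf => ⟨⟨f, hf.cont⟩, hf, rfl⟩
    rw [e]
    have hcpt : IsCompact (univ.pi fun x : Fin 4 → ℝ => Icc 0 (B * exp (-c * rad x))) :=
      isCompact_univ_pi fun _ => isCompact_Icc
    refine hcpt.of_isClosed_subset ?_ fun f hf x _ => ⟨hf.nonneg x, hf.le x⟩
    have : {f | Prof c B Λ f} =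
        {f | ∀ x y, radSq x = radSq y → x 3 = y 3 → f x = f y} ∩ {f | ∀ x, f (-x) = f x} ∩
        {f | ∀ x, f (x + shift) = f x} ∩ {f | ∀ x, 0 ≤ f x} ∩
        {f | ∀ x, f x ≤ B * exp (-c * rad x)} ∩ {f | ∀ x y, |f x - f y| ≤ Λ * ‖x - y‖} := by
      ext f
      exact ⟨fun h => ⟨⟨⟨⟨⟨h.radial, h.even⟩, h.periodic⟩, h.nonneg⟩, h.le⟩, h.lip⟩,
        fun ⟨⟨⟨⟨⟨h1, h2⟩, h3⟩, h4⟩, h5⟩, h6⟩ => ⟨h1, h2, h3, h4, h5, h6⟩⟩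
    rw [this]
    simp only [Set.ofPred_forall]
    refine ((((IsClosed.inter ?_ ?_).inter ?_).inter ?_).inter ?_).inter ?_
    · exact isClosed_iInter fun x => isClosed_iInter fun y => isClosed_iInter fun _ =>
        isClosed_iInter fun _ => isClosed_eq (continuous_apply x) (continuous_apply y)
    · exact isClosed_iInter fun x => isClosed_eq (continuous_apply _) (continuous_apply _)
    · exact isClosed_iInter fun x => isClosed_eq (continuous_apply _) (continuous_apply _)
    · exact isClosed_iInter fun x => isClosed_le continuous_const (continuous_apply _)
    · exact isClosed_iInter fun x => isClosed_le (continuous_apply _) continuous_const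
    · exact isClosed_iInter fun x => isClosed_iInter fun y =>
        isClosed_le ((continuous_apply x).sub (continuous_apply y)).abs continuous_const
  · refine LipschitzWith.uniformEquicontinuous (K := Λ.toNNReal) _ (fun φ => ?_) |>.equicontinuous
    exact LipschitzWith.of_dist_le' fun x y => by
      rw [Real.dist_eq, dist_eq_norm]; exact φ.2.lip x y

lemma continuousOn_of_seq {S : Set C(Fin 4 → ℝ, ℝ)} {Φ : ((Fin 4 → ℝ) → ℝ) → ℝ}
    (h : ∀ (F : ℕ → C(Fin 4 → ℝ, ℝ)) (φ : C(Fin 4 → ℝ, ℝ)), (∀ n, F n ∈ S) →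
      (∀ x, Tendsto (fun n => F n x) atTop (𝓝 (φ x))) →
      Tendsto (fun n => Φ (F n)) atTop (𝓝 (Φ φ))) :
    ContinuousOn (fun φ : C(Fin 4 → ℝ, ℝ) => Φ φ) S := by
  intro φ hφ
  refine tendsto_of_seq_tendsto fun F hF => ?_
  obtain ⟨h1, h2⟩ := tendsto_nhdsWithin_iff.1 hF
  obtain ⟨N, hN⟩ := eventually_atTop.1 h2
  rw [← tendsto_add_atTop_iff_nat N]
  refine h (fun n => F (n + N)) φ (fun n => hN _ (Nat.le_add_left _ _)) fun x => ?_
  have := ((continuous_eval_const (F := C(Fin 4 → ℝ, ℝ)) x).tendsto φ).comp h1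
  exact (tendsto_add_atTop_iff_nat N).2 this

lemma exists_minimizer (hc : 0 < c) (κ : ℝ) {f₀ : (Fin 4 → ℝ) → ℝ} (h₀ : Prof c B Λ f₀)
    (hm₀ : ∫ z in cell, f₀ z = 1) : ∃ f, Prof c B Λ f ∧ ∫ z in cell, f z = 1 ∧
      ∀ g, Prof c B Λ g → ∫ z in cell, g z = 1 → func κ f ≤ func κ g := by
  set S := {φ : C(Fin 4 → ℝ, ℝ) | Prof c B Λ φ} with hS
  have hcpt : IsCompact S := isCompact_prof c B Λ
  have hmass : ContinuousOn (fun φ : C(Fin 4 → ℝ, ℝ) => ∫ z in cell, φ z) S :=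
    continuousOn_of_seq fun F φ hF hl => tendsto_integral_cell hc hF hl
  have hfunc : ContinuousOn (fun φ : C(Fin 4 → ℝ, ℝ) => func κ φ) S :=
    continuousOn_of_seq fun F φ hF hl => (((Real.continuous_exp.tendsto _).comp
      (tendsto_ent hc hF hl)).const_mul κ).add ((tendsto_energy hc hF hl).div_const 2)
  have hcl : IsClosed (S ∩ (fun φ : C(Fin 4 → ℝ, ℝ) => ∫ z in cell, φ z) ⁻¹' {1}) :=
    hmass.preimage_isClosed_of_isClosed hcpt.isClosed isClosed_singleton
  obtain ⟨φ, ⟨hφ, hφ1⟩, hmin⟩ := (hcpt.of_isClosed_subset hcl inter_subset_left).exists_isMinOn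
    ⟨⟨f₀, h₀.cont⟩, h₀, hm₀⟩ (hfunc.mono inter_subset_left)
  exact ⟨φ, hφ, hφ1, fun g hg hg1 => hmin (a := ⟨g, hg.cont⟩) ⟨hg, hg1⟩⟩

end CylinderLiouville

namespace CylinderLiouville
open Real Set Filter Topology

variable {c B Λ : ℝ} {f g : (Fin 4 → ℝ) → ℝ}

/-- The reflection along `v` in the first three coordinates. -/
noncomputable def reflect (v : Fin 4 → ℝ) : (Fin 4 → ℝ) →ₗ[ℝ] (Fin 4 → ℝ) :=
  LinearMap.id - (2 / radSq v) • LinearMap.smulRight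
    (v 0 • LinearMap.proj 0 + v 1 • LinearMap.proj 1 + v 2 • LinearMap.proj 2 :
      (Fin 4 → ℝ) →ₗ[ℝ] ℝ) v

lemma reflect_apply (v z : Fin 4 → ℝ) (i : Fin 4) :
    reflect v z i = z i - 2 / radSq v * ((v 0 * z 0 + v 1 * z 1 + v 2 * z 2) * v i) := by
  simp [reflect]

lemma reflect_reflect {v : Fin 4 → ℝ} (hv : 0 < radSq v) (z : Fin 4 → ℝ) :
    reflect v (reflect v z) = z := by
  ext i
  have h : radSq v ≠ 0 := hv.ne'
  simp only [reflect_apply]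
  field_simp
  unfold radSq
  ring

lemma radSq_reflect {v : Fin 4 → ℝ} (hv : 0 < radSq v) (z : Fin 4 → ℝ) :
    radSq (reflect v z) = radSq z := by
  have h : radSq v ≠ 0 := hv.ne'
  have e : radSq (reflect v z) = radSq z - 4 / radSq v * (v 0 * z 0 + v 1 * z 1 + v 2 * z 2) ^ 2
      + 4 / radSq v ^ 2 * (v 0 * z 0 + v 1 * z 1 + v 2 * z 2) ^ 2 * radSq v := by
    generalize hD : 2 / radSq v = D
    have h4 : 4 / radSq v = 2 * D := by rw [← hD]; ring
    have h5 : 4 / radSq v ^ 2 = D ^ 2 := by rw [← hD]; ring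
    rw [h4, h5]
    simp only [radSq, reflect_apply]
    simp only [radSq] at hD
    rw [hD]
    ring
  rw [e]
  field_simp
  ring

lemma reflect_apply_three {v : Fin 4 → ℝ} (hv : v 3 = 0) (z : Fin 4 → ℝ) :
    reflect v z 3 = z 3 := by simp [reflect_apply, hv]

lemma measurePreserving_reflect {v : Fin 4 → ℝ} (hv : 0 < radSq v) :
    MeasurePreserving (reflect v) volume volume := by
  have h1 : reflect v ∘ₗ reflect v = LinearMap.id := LinearMap.ext fun z => reflect_reflect hv z
  have h2 : LinearMap.det (reflect v) * LinearMap.det (reflect v) = 1 := by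
    rw [← LinearMap.det_comp, h1, LinearMap.det_id]
  have h3 : LinearMap.det (reflect v) ≠ 0 := left_ne_zero_of_mul_eq_one h2
  have h4 : |(LinearMap.det (reflect v))⁻¹| = 1 := by
    rcases mul_self_eq_one_iff.1 h2 with h | h <;> simp [h]
  refine ⟨(LinearMap.continuous_of_finiteDimensional _).measurable, ?_⟩
  rw [Real.map_linearMap_volume_pi_eq_smul_volume_pi h3, h4]
  simp

lemma measurableEmbedding_reflect {v : Fin 4 → ℝ} (hv : 0 < radSq v) :
    MeasurableEmbedding (reflect v) := by
  have hm : Measurable (reflect v) := (LinearMap.continuous_of_finiteDimensional _).measurable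
  exact (MeasurableEquiv.mk ⟨reflect v, reflect v, reflect_reflect hv, reflect_reflect hv⟩
    hm hm).measurableEmbedding

lemma ker_eq_of_radSq_eq {x y : Fin 4 → ℝ} (h : radSq x = radSq y) (h3 : x 3 = y 3) (a : ℝ) :
    ker a x = ker a y := by
  simp [ker, sden, reg, h, h3]

lemma conv_ker_eq_of_radSq_eq (hf : ∀ x y, radSq x = radSq y → x 3 = y 3 → f x = f y)
    {x y : Fin 4 → ℝ} (h : radSq x = radSq y) (h3 : x 3 = y 3) (a : ℝ) :
    conv (ker a) f x = conv (ker a) f y := by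
  set v := x - y with hv
  have hv3 : v 3 = 0 := by simp [hv, h3]
  rcases (radSq_nonneg v).eq_or_lt with h0 | h0
  · have hi : ∀ i : Fin 4, i ≠ 3 → v i = 0 := fun i hi => by
      have := abs_le_rad v i hi
      rw [rad, ← h0, Real.sqrt_zero] at this
      exact abs_nonpos_iff.1 this
    have : v = 0 := by
      ext i
      by_cases h : i = 3
      · rw [h]; exact hv3
      · exact hi i h
    rw [sub_eq_zero.1 (hv.symm.trans this)]
  have hR : reflect v x = y := by
    ext i
    have e : 2 * (v 0 * x 0 + v 1 * x 1 + v 2 * x 2) = radSq v := by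
      simp only [radSq] at h
      simp only [radSq, hv, Pi.sub_apply]
      linarith
    rw [reflect_apply, show 2 / radSq v * ((v 0 * x 0 + v 1 * x 1 + v 2 * x 2) * v i) =
      (2 * (v 0 * x 0 + v 1 * x 1 + v 2 * x 2)) / radSq v * v i by ring, e, div_self h0.ne']
    simp [hv]
  have hc : reflect v ⁻¹' cell = cell := by
    ext z
    simp [cell, reflect_apply_three hv3]
  unfold conv
  rw [← (measurePreserving_reflect h0).setIntegral_preimage_emb (measurableEmbedding_reflect h0)
    (fun z => ker a z * f (y - z)), hc]
  refine setIntegral_congr_fun measurableSet_cell fun z _ => ?_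
  rw [← hR, ← map_sub, ker_eq_of_radSq_eq (radSq_reflect h0 z) (reflect_apply_three hv3 z)]
  congr 1
  exact hf _ _ (radSq_reflect h0 _).symm (reflect_apply_three hv3 _).symm

lemma conv_ker_neg (hp : Function.Periodic f shift) (hf : ∀ x, f (-x) = f x) (a : ℝ)
    (x : Fin 4 → ℝ) : conv (ker a) f (-x) = conv (ker a) f x := by
  have hp' : Function.Periodic (fun z => ker a z * f (-x - z)) shift := fun z => by
    have := hp (-x - (z + shift))
    rw [show -x - (z + shift) + shift = -x - z by abel] at this
    simp only [periodic_ker a z, this]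
  unfold conv
  rw [← setIntegral_cell_sub hp' 0]
  refine setIntegral_congr_fun measurableSet_cell fun z _ => ?_
  simp only [zero_sub]
  rw [ker_neg, ← hf (x - z)]
  congr 2
  abel

instance : NeZero ((volume : Measure (Fin 4 → ℝ)).restrict cell) :=
  ⟨fun h => isAddFundamentalDomain_cell.measure_ne_zero (NeZero.ne _)
    (Measure.restrict_eq_zero.1 h)⟩

/-- The Gibbs variational inequality. -/
lemma integral_mul_le_ent_add_log {φ : (Fin 4 → ℝ) → ℝ} (h0 : ∀ z, 0 ≤ f z)
    (hf : IntegrableOn f cell) (hm : ∫ z in cell, f z = 1)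
    (hl : IntegrableOn (fun z => f z * log (f z)) cell)
    (hφ : IntegrableOn (fun z => f z * φ z) cell) (he : IntegrableOn (fun z => exp (φ z)) cell) :
    ∫ z in cell, f z * φ z ≤ ent f + log (∫ z in cell, exp (φ z)) := by
  have hZ : 0 < ∫ z in cell, exp (φ z) := integral_exp_pos he
  set Z := ∫ z in cell, exp (φ z) with hZd
  have key : ∫ z in cell, (f z * φ z - f z * log (f z) - log Z * f z) ≤
      ∫ z in cell, (exp (φ z) / Z - f z) := by
    refine integral_mono ((hφ.sub hl).sub (hf.const_mul _)) ((he.div_const _).sub hf) fun z => ?_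
    simp only
    rcases (h0 z).eq_or_lt with h | h
    · rw [← h]; simp; positivity
    · have := log_le_sub_one_of_pos (x := exp (φ z) / Z / f z) (by positivity)
      rw [log_div (by positivity) h.ne', log_div (by positivity) hZ.ne', log_exp] at this
      have h2 := mul_le_mul_of_nonneg_left this h.le
      have h3 : f z * (exp (φ z) / Z / f z - 1) = exp (φ z) / Z - f z := by field_simp
      rw [h3] at h2
      linarith
  have hs : Integrable (fun z => f z * φ z - f z * log (f z)) (volume.restrict cell) :=
    hφ.sub hl
  rw [integral_sub hs (hf.const_mul _), integral_sub hφ hl, integral_const_mul,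
    integral_sub (he.div_const _) hf, integral_div, hm, ← hZd, div_self hZ.ne'] at key
  unfold ent
  linarith

/-- The Gibbs weight used to bound the potential from below. -/
noncomputable def gibbs (z : Fin 4 → ℝ) : ℝ := exp (rad z / 2 - ker 0 z)

lemma periodic_gibbs : Function.Periodic gibbs shift := fun z => by
  simp [gibbs, rad_add_shift, periodic_ker 0 z]

lemma gibbs_le {z : Fin 4 → ℝ} (hz : 0 < radSq z) : gibbs z ≤ 2 * weight (1 / 2) z := by
  have hs := sden_pos (a := 0) (z := z) (by linarith)
  have h1 := radSq_add_le_sden (a := 0) (z := z) (by linarith)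
  have h2 : exp (rad z) ≤ sden 0 z + 2 := by
    have := cos_le_one (z 3)
    have h3 := (exp_pos (-rad z)).le
    rw [sden, reg_zero, cosh_eq]
    linarith
  have h3 : gibbs z = exp (rad z) * exp (-(1 / 2) * rad z) / sden 0 z := by
    rw [gibbs, ker, exp_sub, exp_log hs, ← exp_add]
    congr 2
    ring
  rw [h3, weight, div_le_iff₀ hs]
  have h4 : 1 ≤ (radSq z)⁻¹ * sden 0 z := by
    rw [inv_mul_eq_div, one_le_div hz]
    linarith
  have h5 := mul_le_mul_of_nonneg_right h2 (exp_pos (-(1 / 2) * rad z)).le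
  have h6 := mul_le_mul_of_nonneg_right h4 (exp_pos (-(1 / 2) * rad z)).le
  have h7 := mul_nonneg hs.le (exp_pos (-(1 / 2) * rad z)).le
  nlinarith

lemma integrableOn_gibbs : IntegrableOn gibbs cell := by
  refine Integrable.mono' ((integrableOn_weight (c := 1 / 2) (by norm_num)).const_mul 2) ?_ ?_
  · have := continuous_rad.measurable
    have := measurable_ker 0
    unfold gibbs
    exact Measurable.aestronglyMeasurable (by fun_prop)
  · filter_upwards [ae_cell_radSq_pos] with z hz
    rw [norm_of_nonneg (by unfold gibbs; positivity)]
    exact gibbs_le hz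

/-- The logarithm of the Gibbs partition function. -/
noncomputable def logGibbs : ℝ := log (∫ z in cell, gibbs z)

/-- The mean radius. -/
noncomputable def mom (f : (Fin 4 → ℝ) → ℝ) : ℝ := ∫ z in cell, f z * rad z

lemma abs_rad_sub_le (x z : Fin 4 → ℝ) : |rad (x - z)| ≤ (1 + rad x) * (1 + rad z) := by
  rw [abs_of_nonneg (rad_nonneg _)]
  nlinarith [rad_sub_le x z, mul_nonneg (rad_nonneg x) (rad_nonneg z)]

lemma integrableOn_mul_rad_sub (hc : 0 < c) (hf : Decays c f) (x : Fin 4 → ℝ) :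
    IntegrableOn (fun z => f z * rad (x - z)) cell :=
  integrableOn_mul_of_growth hc hf (by
    have := continuous_rad
    exact Continuous.aestronglyMeasurable (by fun_prop)) (abs_rad_sub_le x)

lemma integrableOn_mul_rad (hc : 0 < c) (hf : Decays c f) :
    IntegrableOn (fun z => f z * rad z) cell := by
  simpa [rad_neg] using integrableOn_mul_rad_sub hc hf 0

lemma ker_zero_le (z : Fin 4 → ℝ) : ker 0 z ≤ rad z + 3 := by
  rcases (radSq_nonneg z).eq_or_lt with h | h
  · have h1 : rad z = 0 := by rw [rad, ← h, Real.sqrt_zero]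
    have h2 : sden 0 z = 2 - 2 * cos (z 3) := by
      rw [sden, reg_zero, h1, cosh_zero, mul_one]
    have h3 := cos_le_one (z 3)
    have h4 := neg_one_le_cos (z 3)
    rcases h3.eq_or_lt with h5 | h5
    · rw [ker, h2, h5, h1]; norm_num
    · have := log_le_sub_one_of_pos (x := sden 0 z) (by rw [h2]; linarith)
      rw [ker, h1]
      linarith
  · exact ker_le zero_le_one (by linarith)

lemma conv_ker_eq (hc : 0 < c) (hf : Decays c f) (x : Fin 4 → ℝ) :
    IntegrableOn (fun z => f z * ker 0 (x - z)) cell ∧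
      conv (ker 0) f x = ∫ z in cell, f z * ker 0 (x - z) := by
  have h1 := integrableOn_conv' hc (isKernel_ker le_rfl zero_le_one) hf x
  have h2 := conv_comm (periodic_ker 0) hf.periodic x
  simp only [mul_comm (f _)]
  exact ⟨h1, h2⟩

lemma Prof.integrableOn (hc : 0 < c) (h : Prof c B Λ f) : IntegrableOn f cell :=
  h.decays.integrableOn hc

lemma le_conv_ker (hc : 0 < c) (h : Prof c B Λ f) (hm : ∫ z in cell, f z = 1)
    (x : Fin 4 → ℝ) :
    (∫ z in cell, f z * rad (x - z)) / 2 - (ent f + logGibbs) ≤ conv (ker 0) f x := by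
  obtain ⟨h1, h2⟩ := conv_ker_eq hc h.decays x
  have h3 := integrableOn_mul_rad_sub hc h.decays x
  have h4 : IntegrableOn (fun z => f z * (rad (x - z) / 2 - ker 0 (x - z))) cell := by
    refine ((h3.div_const 2).sub h1).congr (ae_of_all _ fun z => ?_)
    simp only [Pi.sub_apply]; ring
  have h5 := integral_mul_le_ent_add_log h.nonneg (h.integrableOn hc) hm
    (integrableOn_mul_log hc h) h4 (integrableOn_cell_sub periodic_gibbs integrableOn_gibbs x)
  have h6 : ∫ z in cell, exp (rad (x - z) / 2 - ker 0 (x - z)) = ∫ z in cell, gibbs z :=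
    setIntegral_cell_sub periodic_gibbs x
  have h7 : ∫ z in cell, f z * (rad (x - z) / 2 - ker 0 (x - z)) =
      (∫ z in cell, f z * rad (x - z)) / 2 - conv (ker 0) f x := by
    rw [h2, ← integral_div, ← integral_sub (h3.div_const 2) h1]
    congr 1
    ext z
    ring
  rw [h6, h7] at h5
  unfold logGibbs
  linarith

lemma conv_ker_le (hc : 0 < c) (h : Prof c B Λ f) (hm : ∫ z in cell, f z = 1)
    (x : Fin 4 → ℝ) : conv (ker 0) f x ≤ rad x + mom f + 3 := by
  obtain ⟨h1, h2⟩ := conv_ker_eq hc h.decays x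
  have h3 := integrableOn_mul_rad hc h.decays
  have h4 := h.integrableOn hc
  rw [h2]
  calc ∫ z in cell, f z * ker 0 (x - z)
      ≤ ∫ z in cell, (f z * rad z + (rad x + 3) * f z) := by
        refine integral_mono h1 (h3.add (h4.const_mul _)) fun z => ?_
        have e1 := ker_zero_le (x - z)
        have e2 := rad_sub_le x z
        have := mul_le_mul_of_nonneg_left (show ker 0 (x - z) ≤ rad z + (rad x + 3) by linarith)
          (h.nonneg z)
        simp only
        linarith
    _ = _ := by
        rw [integral_add h3 (h4.const_mul _), integral_const_mul, hm, mom]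
        ring

lemma integral_mul_rad_sub_eq (h : Prof c B Λ f) (x : Fin 4 → ℝ) :
    ∫ z in cell, f z * rad (x - z) = ∫ z in cell, f z * rad (x + z) := by
  have hp : Function.Periodic (fun z => f z * rad (x - z)) shift := fun z => by
    have := rad_add_shift (x - (z + shift))
    rw [show x - (z + shift) + shift = x - z by abel] at this
    simp only [h.periodic z, this]
  rw [← setIntegral_cell_sub hp 0]
  simp [h.even]

lemma rad_add_self (x : Fin 4 → ℝ) : rad (x + x) = 2 * rad x := by
  have h : radSq (x + x) = 2 ^ 2 * radSq x := by simp [radSq]; ring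
  rw [rad, h, Real.sqrt_mul (by norm_num), Real.sqrt_sq (by norm_num), rad]

lemma le_integral_mul_rad_sub (hc : 0 < c) (h : Prof c B Λ f) (hm : ∫ z in cell, f z = 1)
    (x : Fin 4 → ℝ) : rad x ≤ ∫ z in cell, f z * rad (x - z) ∧
      mom f ≤ ∫ z in cell, f z * rad (x - z) := by
  have h1 := integrableOn_mul_rad_sub hc h.decays x
  have h2 : IntegrableOn (fun z => f z * rad (x + z)) cell := by
    have := integrableOn_mul_rad_sub hc h.decays (-x)
    refine this.congr (ae_of_all _ fun z => ?_)
    simp only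
    rw [← rad_neg (-x - z)]
    congr 2
    abel
  have h3 : ∫ z in cell, (f z * rad (x - z) + f z * rad (x + z)) =
      2 * ∫ z in cell, f z * rad (x - z) := by
    rw [integral_add h1 h2, ← integral_mul_rad_sub_eq h x]; ring
  have h4 := integrableOn_mul_rad hc h.decays
  have h5 := h.integrableOn hc
  constructor
  · have : ∫ z in cell, 2 * rad x * f z ≤ ∫ z in cell, (f z * rad (x - z) + f z * rad (x + z)) := by
      refine integral_mono (h5.const_mul _) (h1.add h2) fun z => ?_
      have e : 2 * rad x ≤ rad (x - z) + rad (x + z) := by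
        rw [← rad_add_self, show x + x = (x - z) + (x + z) by abel]
        exact rad_add_le _ _
      have := mul_le_mul_of_nonneg_left e (h.nonneg z)
      simp only
      linarith
    rw [h3, integral_const_mul, hm] at this
    linarith
  · have : ∫ z in cell, 2 * (f z * rad z) ≤
        ∫ z in cell, (f z * rad (x - z) + f z * rad (x + z)) := by
      refine integral_mono (h4.const_mul _) (h1.add h2) fun z => ?_
      have e : 2 * rad z ≤ rad (x - z) + rad (x + z) := by
        rw [← rad_add_self, rad_sub_comm, show z + z = (z - x) + (x + z) by abel]
        exact rad_add_le _ _
      have := mul_le_mul_of_nonneg_left e (h.nonneg z)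
      simp only
      linarith
    rw [h3, integral_const_mul] at this
    unfold mom
    linarith

lemma mom_nonneg (h : Prof c B Λ f) : 0 ≤ mom f :=
  integral_nonneg fun z => mul_nonneg (h.nonneg z) (rad_nonneg z)

lemma le_energy (hc : 0 < c) (h : Prof c B Λ f) (hm : ∫ z in cell, f z = 1) :
    mom f / 2 - (ent f + logGibbs) ≤ energy f := by
  have h5 := h.integrableOn hc
  have : ∫ z in cell, (mom f / 2 - (ent f + logGibbs)) * f z ≤ energy f := by
    refine integral_mono (h5.const_mul _) (integrableOn_mul_conv_ker hc h.decays h.decays)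
      fun z => ?_
    have e1 := le_conv_ker hc h hm z
    have e2 := (le_integral_mul_rad_sub hc h hm z).2
    have := mul_le_mul_of_nonneg_left
      (show mom f / 2 - (ent f + logGibbs) ≤ conv (ker 0) f z by linarith) (h.nonneg z)
    simp only
    linarith
  rw [integral_const_mul, hm] at this
  linarith

/-- A priori bounds for competitors of negative energy. -/
lemma bounds_of_func_neg (hc : 0 < c) (h : Prof c B Λ f) (hm : ∫ z in cell, f z = 1) {κ : ℝ}
    (hκ : 0 < κ) (hneg : func κ f < 0) :
    0 < ent f + logGibbs ∧ ent f + logGibbs ≤ exp logGibbs / κ ∧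
      mom f ≤ 2 * (exp logGibbs / κ) := by
  have h1 := le_energy hc h hm
  have h2 := mom_nonneg h
  unfold func at hneg
  have h3 : 0 < κ * exp (ent f) := by positivity
  have h4 : 0 < ent f + logGibbs := by linarith
  have h5 : exp (ent f + logGibbs) = exp (ent f) * exp logGibbs := exp_add _ _
  have h6 := quadratic_le_exp_of_nonneg h4.le
  set t := ent f + logGibbs
  have hK := exp_pos logGibbs
  have h7 : κ * exp t < t / 2 * exp logGibbs := by
    rw [h5, ← mul_assoc]
    exact mul_lt_mul_of_pos_right (by linarith) hK
  have h8 : t ≤ exp logGibbs / κ := by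
    rw [le_div_iff₀ hκ]
    have h9 : κ * (t ^ 2 / 2) ≤ κ * exp t := by gcongr; linarith
    have h10 : t * (t * κ) < t * exp logGibbs := by nlinarith
    exact (lt_of_mul_lt_mul_left h10 h4.le).le
  exact ⟨h4, h8, by linarith⟩
end CylinderLiouville

namespace CylinderLiouville
open Real Set Filter Topology

variable {c B Λ : ℝ} {f g : (Fin 4 → ℝ) → ℝ}

lemma Prof.mono (h : Prof c B Λ f) {B' Λ' : ℝ} (hB : B ≤ B') (hΛ : Λ ≤ Λ') : Prof c B' Λ' f where
  radial := h.radial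
  even := h.even
  periodic := h.periodic
  nonneg := h.nonneg
  le x := (h.le x).trans (by gcongr)
  lip x y := (h.lip x y).trans (by gcongr)

/-- The Gibbs measure generated by the potential of `f`. -/
noncomputable def relax (β : ℝ) (f : (Fin 4 → ℝ) → ℝ) (x : Fin 4 → ℝ) : ℝ :=
  exp (-β * conv (ker 0) f x) / ∫ z in cell, exp (-β * conv (ker 0) f z)

lemma integrableOn_exp_neg_mul_rad_add {a : ℝ} (ha : 0 < a) (b : ℝ) :
    IntegrableOn (fun z => exp (-a * (rad z + b))) cell := by
  refine ((integrableOn_exp ha).const_mul (exp (-a * b))).congr (ae_of_all _ fun z => ?_)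
  simp only
  rw [← exp_add]
  ring_nf

/-- The relaxation map preserves a class of profiles. -/
lemma exists_prof_relax {κ : ℝ} (hκ : 0 < κ) : ∃ c, 0 < c ∧ ∀ B₀, ∃ B, B₀ ≤ B ∧ ∀ Λ₀, ∃ Λ, Λ₀ ≤ Λ ∧
    ∀ f, Prof c B Λ f → ∫ z in cell, f z = 1 → func κ f < 0 →
      0 < ∫ z in cell, exp (-(exp (-ent f) / κ) * conv (ker 0) f z) ∧
      Prof c B Λ (relax (exp (-ent f) / κ) f) ∧
        ∫ z in cell, relax (exp (-ent f) / κ) f z = 1 := by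
  set M := exp logGibbs / κ with hM
  have hM0 : 0 < M := by positivity
  set β₁ := exp (logGibbs - M) / κ with hβ₁
  have hβ₁0 : 0 < β₁ := by positivity
  set z₀ := ∫ z in cell, exp (-M * (rad z + (2 * M + 3))) with hz₀
  have hi₀ := integrableOn_exp_neg_mul_rad_add hM0 (2 * M + 3)
  have hz₀0 : 0 < z₀ := integral_exp_pos hi₀
  have hc : 0 < β₁ / 2 := half_pos hβ₁0
  obtain ⟨K, hK, hKb⟩ := abs_conv_dker_le hc
  refine ⟨β₁ / 2, hc, fun B₀ => ⟨max B₀ (exp (M * M) / z₀), le_max_left _ _, fun Λ₀ => ?_⟩⟩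
  set B := max B₀ (exp (M * M) / z₀) with hB
  have hB0 : 0 < B := lt_of_lt_of_le (by positivity) (le_max_right _ _)
  refine ⟨max Λ₀ (B * (M * (4 * (B * K)))), le_max_left _ _, fun f hf hm hneg => ?_⟩
  obtain ⟨h1, h2, h3⟩ := bounds_of_func_neg hc hf hm hκ hneg
  rw [← hM] at h2 h3
  set β := exp (-ent f) / κ with hβ
  have hβ1 : β₁ ≤ β := by
    rw [hβ, hβ₁]; gcongr; linarith
  have hβM : β ≤ M := by
    rw [hβ, hM]; gcongr; linarith
  have hβ0 : 0 < β := hβ₁0.trans_le hβ1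
  have hlow : ∀ x, rad x / 2 - M ≤ conv (ker 0) f x := fun x => by
    have e1 := le_conv_ker hc hf hm x
    have e2 := (le_integral_mul_rad_sub hc hf hm x).1
    linarith
  have hupp : ∀ x, conv (ker 0) f x ≤ rad x + (2 * M + 3) := fun x => by
    have := conv_ker_le hc hf hm x
    linarith
  have hcont : Continuous (conv (ker 0) f) :=
    continuous_conv hc (isKernel_ker le_rfl zero_le_one) hf.decays
  have hexp : ∀ x, exp (-β * conv (ker 0) f x) ≤ exp (M * M) * exp (-(β₁ / 2) * rad x) := fun x => by
    rw [← exp_add]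
    apply exp_le_exp.2
    have e1 := mul_le_mul_of_nonneg_left (hlow x) hβ0.le
    have e2 := mul_le_mul_of_nonneg_right hβ1 (rad_nonneg x)
    have e3 := mul_le_mul_of_nonneg_right hβM hM0.le
    nlinarith
  have hInt : IntegrableOn (fun x => exp (-β * conv (ker 0) f x)) cell :=
    Integrable.mono' ((integrableOn_exp hc).const_mul (exp (M * M)))
      (Continuous.aestronglyMeasurable (by fun_prop)) (ae_of_all _ fun x => by
        rw [norm_of_nonneg (exp_pos _).le]; exact hexp x)
  have hZ : z₀ ≤ ∫ z in cell, exp (-β * conv (ker 0) f z) := by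
    refine integral_mono hi₀ hInt fun x => exp_le_exp.2 ?_
    have e1 := mul_le_mul_of_nonneg_left (hupp x) hβ0.le
    have e2 := mul_le_mul_of_nonneg_right hβM
      (show 0 ≤ rad x + (2 * M + 3) by have := rad_nonneg x; positivity)
    linarith
  set Z := ∫ z in cell, exp (-β * conv (ker 0) f z) with hZd
  have hZ0 : 0 < Z := hz₀0.trans_le hZ
  have hle : ∀ x, relax β f x ≤ B * exp (-(β₁ / 2) * rad x) := fun x => by
    unfold relax
    calc exp (-β * conv (ker 0) f x) / Z ≤ exp (M * M) * exp (-(β₁ / 2) * rad x) / z₀ :=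
          div_le_div₀ (by positivity) (hexp x) hz₀0 hZ
      _ = exp (M * M) / z₀ * exp (-(β₁ / 2) * rad x) := by ring
      _ ≤ _ := by gcongr; exact le_max_right _ _
  have hpos : ∀ x, 0 ≤ relax β f x := fun x => by unfold relax; positivity
  refine ⟨hZ0, ⟨fun x y h h3 => ?_, fun x => ?_, fun x => ?_, hpos, hle, fun x y => ?_⟩, ?_⟩
  · unfold relax; rw [conv_ker_eq_of_radSq_eq hf.radial h h3]
  · unfold relax; rw [conv_ker_neg hf.periodic hf.even]
  · unfold relax; rw [periodic_conv hf.periodic x]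
  · have hd : ∀ w ∈ (univ : Set (Fin 4 → ℝ)), HasFDerivWithinAt (relax β f)
        ((relax β f w * -β) • gradMap fun i => conv (dker 0 i) f w) univ w := fun w _ => by
      have e := (((hasFDerivAt_conv_ker hc hf.decays w).const_mul (-β)).exp.mul_const Z⁻¹)
      rw [hasFDerivWithinAt_univ]
      refine (e.congr_fderiv ?_).congr_of_eventuallyEq (Eventually.of_forall fun y => ?_)
      · rw [smul_smul, smul_smul]
        congr 1
        unfold relax
        rw [← hZd]
        ring
      · unfold relax
        rw [← hZd, div_eq_mul_inv]
    have hb : ∀ w ∈ (univ : Set (Fin 4 → ℝ)),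
        ‖(relax β f w * -β) • gradMap fun i => conv (dker 0 i) f w‖ ≤
          max Λ₀ (B * (M * (4 * (B * K)))) := fun w _ => by
      refine le_trans ?_ (le_max_right _ _)
      have e1 : ‖gradMap fun i => conv (dker 0 i) f w‖ ≤ 4 * (B * K) := by
        refine (norm_gradMap_le _).trans ?_
        refine (Finset.sum_le_sum fun i _ => hKb f B hB0.le hf.abs_le i w).trans ?_
        simp
      have e2 : relax β f w ≤ B := (hle w).trans (mul_le_of_le_one_right hB0.le (by
        rw [exp_le_one_iff]
        have := mul_nonneg hc.le (rad_nonneg w)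
        linarith))
      rw [norm_smul, norm_mul, norm_neg, norm_of_nonneg (hpos w), norm_of_nonneg hβ0.le, mul_assoc]
      exact mul_le_mul e2 (mul_le_mul hβM e1 (norm_nonneg _) hM0.le)
        (mul_nonneg hβ0.le (norm_nonneg _)) hB0.le
    have := convex_univ.norm_image_sub_le_of_norm_hasFDerivWithin_le hd hb
      (mem_univ y) (mem_univ x)
    rwa [norm_eq_abs] at this
  · unfold relax
    rw [integral_div, ← hZd, div_self hZ0.ne']

lemma cell_subset_closure_interior : cell ⊆ closure (interior cell) := by
  have h1 : {x : Fin 4 → ℝ | x 3 ∈ Ioo (-π) π} ⊆ interior cell :=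
    interior_maximal (fun x hx => ⟨hx.1, hx.2.le⟩) (isOpen_Ioo.preimage (continuous_apply 3))
  refine fun x hx => closure_mono h1 ?_
  rw [mem_closure_iff_seq_limit]
  refine ⟨fun n => Function.update x 3 (x 3 * (1 - ((n : ℝ) + 2)⁻¹)), fun n => ?_, ?_⟩
  · have e1 : 0 < ((n : ℝ) + 2)⁻¹ := by positivity
    have e2 : ((n : ℝ) + 2)⁻¹ < 1 := inv_lt_one_of_one_lt₀ (by
      have : (0 : ℝ) ≤ n := Nat.cast_nonneg n
      linarith)
    have := pi_pos
    obtain ⟨h2, h3⟩ := hx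
    simp only [mem_ofPred_eq, Function.update_self, mem_Ioo]
    constructor
    · rcases le_total 0 (x 3) with h | h
      · have : 0 ≤ x 3 * (1 - ((n : ℝ) + 2)⁻¹) := mul_nonneg h (by linarith)
        linarith
      · nlinarith
    · rcases le_total 0 (x 3) with h | h
      · rcases h.eq_or_lt with h4 | h4
        · rw [← h4]; simpa using pi_pos
        · nlinarith
      · have : x 3 * (1 - ((n : ℝ) + 2)⁻¹) ≤ 0 := mul_nonpos_of_nonpos_of_nonneg h (by linarith)
        linarith
  · have e1 : Tendsto (fun n : ℕ => x 3 * (1 - ((n : ℝ) + 2)⁻¹)) atTop (𝓝 (x 3)) := by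
      have := (tendsto_add_atTop_iff_nat 1).2 tendsto_inv_nat
      have h2 : Tendsto (fun n : ℕ => ((n : ℝ) + 2)⁻¹) atTop (𝓝 0) := this.congr fun n => by
        push_cast; ring_nf
      simpa using (h2.const_sub 1).const_mul (x 3)
    have := (tendsto_const_nhds (x := x)).update 3 e1
    simpa using this

/-- A nonnegative continuous periodic function with zero mean over a cell vanishes. -/
lemma eq_zero_of_integral_cell_eq_zero (hc : Continuous f) (h0 : ∀ x, 0 ≤ f x)
    (hp : Function.Periodic f shift) (hi : IntegrableOn f cell) (h : ∫ z in cell, f z = 0)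
    (x : Fin 4 → ℝ) : f x = 0 := by
  have h1 := (integral_eq_zero_iff_of_nonneg h0 hi).1 h
  have h2 := Measure.eqOn_of_ae_eq h1 hc.continuousOn continuousOn_const
    cell_subset_closure_interior
  have h3 : ∃ n : ℤ, x + n • shift ∈ cell := by
    obtain ⟨n, hn, -⟩ := existsUnique_add_zsmul_mem_Ioc two_pi_pos (x 3) (-π)
    refine ⟨n, ?_⟩
    rw [show -π + 2 * π = π by ring] at hn
    simpa [cell, shift_apply_three] using hn
  obtain ⟨n, hn⟩ := h3
  rw [← hp.zsmul n x]
  exact h2 hn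
end CylinderLiouville

namespace CylinderLiouville
open Real Set Filter Topology

variable {c B Λ : ℝ} {f g : (Fin 4 → ℝ) → ℝ}

/-- A bump function supported near one lattice point. -/
noncomputable def bump (z : Fin 4 → ℝ) : ℝ := max 0 (1 / 8 - rad z) * max 0 (cos (z 3) - 9 / 10)

lemma bump_nonneg (z : Fin 4 → ℝ) : 0 ≤ bump z := by unfold bump; positivity

lemma abs_max_zero_sub_le (a b : ℝ) : |max 0 a - max 0 b| ≤ |a - b| := by
  simpa using abs_max_sub_max_le_max 0 a 0 b

lemma abs_bump_sub_le (x y : Fin 4 → ℝ) : |bump x - bump y| ≤ 1 * ‖x - y‖ := by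
  have h1 : |max 0 (1 / 8 - rad x) - max 0 (1 / 8 - rad y)| ≤ 2 * ‖x - y‖ := by
    refine (abs_max_zero_sub_le _ _).trans (le_trans ?_ (rad_le_norm _))
    have e1 := rad_le_sub_add x y
    have e2 := rad_le_sub_add y x
    rw [rad_sub_comm] at e2
    exact abs_le.2 ⟨by linarith, by linarith⟩
  have h2 : |max 0 (cos (x 3) - 9 / 10) - max 0 (cos (y 3) - 9 / 10)| ≤ ‖x - y‖ := by
    refine (abs_max_zero_sub_le _ _).trans ?_
    rw [sub_sub_sub_cancel_right]
    exact (abs_cos_sub_cos_le _ _).trans (norm_le_pi_norm (x - y) 3)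
  have h3 : |max 0 (1 / 8 - rad x)| ≤ 1 / 8 := by
    rw [abs_of_nonneg (le_max_left _ _)]
    exact max_le (by norm_num) (by linarith [rad_nonneg x])
  have h4 : |max 0 (cos (y 3) - 9 / 10)| ≤ 1 / 10 := by
    rw [abs_of_nonneg (le_max_left _ _)]
    exact max_le (by norm_num) (by linarith [cos_le_one (y 3)])
  unfold bump
  set a := max 0 (1 / 8 - rad x)
  set a' := max 0 (1 / 8 - rad y)
  set b := max 0 (cos (x 3) - 9 / 10)
  set b' := max 0 (cos (y 3) - 9 / 10)
  have e : a * b - a' * b' = a * (b - b') + (a - a') * b' := by ring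
  rw [e]
  refine (abs_add_le _ _).trans ?_
  rw [abs_mul, abs_mul]
  have h5 : |a| * |b - b'| ≤ 1 / 8 * ‖x - y‖ := mul_le_mul h3 h2 (abs_nonneg _) (by norm_num)
  have h6 : |a - a'| * |b'| ≤ 2 * ‖x - y‖ * (1 / 10) :=
    mul_le_mul h1 h4 (abs_nonneg _) (by positivity)
  linarith [norm_nonneg (x - y)]

lemma rad_lt_of_bump_ne_zero {z : Fin 4 → ℝ} (h : bump z ≠ 0) :
    rad z < 1 / 8 ∧ 9 / 10 < cos (z 3) := by
  unfold bump at h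
  constructor
  · by_contra! h1
    exact h (by rw [max_eq_left (by linarith), zero_mul])
  · by_contra! h1
    exact h (by rw [max_eq_left (a := (0 : ℝ)) (b := cos (z 3) - 9 / 10) (by linarith), mul_zero])

lemma prof_bump (hc : 0 < c) : Prof c (exp c) 1 bump where
  radial x y h h3 := by simp [bump, rad, h, h3]
  even x := by simp [bump, rad_neg]
  periodic x := by simp [bump, rad_add_shift, shift_apply_three]
  nonneg := bump_nonneg
  lip := abs_bump_sub_le
  le x := by
    rw [← exp_add]
    by_cases h : bump x = 0
    · rw [h]; positivity
    · have h1 := (rad_lt_of_bump_ne_zero h).1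
      have h2 : bump x ≤ 1 * 1 := by
        unfold bump
        refine mul_le_mul (max_le zero_le_one (by linarith [rad_nonneg x]))
          (max_le zero_le_one (by linarith [cos_le_one (x 3)])) (le_max_left _ _) zero_le_one
      have h3 : 1 ≤ exp (c + -c * rad x) := one_le_exp (by nlinarith)
      linarith

lemma integral_bump_pos : 0 < ∫ z in cell, bump z := by
  have hp := prof_bump one_pos
  refine (integral_nonneg bump_nonneg).lt_of_ne fun h => ?_
  have := eq_zero_of_integral_cell_eq_zero hp.cont hp.nonneg hp.periodic (hp.integrableOn one_pos)
    h.symm 0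
  have h2 : bump 0 = 1 / 8 * (1 / 10) := by
    simp only [bump, rad_zero, Pi.zero_apply, cos_zero]
    norm_num
  rw [h2] at this
  norm_num at this

lemma Prof.const_mul (h : Prof c B Λ f) {A : ℝ} (hA : 0 ≤ A) :
    Prof c (A * B) (A * Λ) fun x => A * f x where
  radial x y e e3 := by rw [h.radial x y e e3]
  even x := by rw [h.even]
  periodic x := by simp only [h.periodic x]
  nonneg x := mul_nonneg hA (h.nonneg x)
  le x := by rw [mul_assoc]; exact mul_le_mul_of_nonneg_left (h.le x) hA
  lip x y := by
    rw [← mul_sub, abs_mul, abs_of_nonneg hA, mul_assoc]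
    exact mul_le_mul_of_nonneg_left (h.lip x y) hA

lemma sden_le_of_bump_ne_zero {x z : Fin 4 → ℝ} (hx : bump x ≠ 0) (hz : bump z ≠ 0) :
    sden 0 (x - z) ≤ 9 / 10 := by
  obtain ⟨h1, h2⟩ := rad_lt_of_bump_ne_zero hx
  obtain ⟨h3, h4⟩ := rad_lt_of_bump_ne_zero hz
  have h5 : rad (x - z) ≤ 1 / 4 := by linarith [rad_sub_le x z]
  have h6 : cosh (rad (x - z)) ≤ 32 / 31 := by
    refine (cosh_le_exp_half_sq _).trans ?_
    have e1 : rad (x - z) ^ 2 / 2 ≤ 1 / 32 := by nlinarith [rad_nonneg (x - z)]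
    refine (exp_le_exp.2 e1).trans ?_
    have e2 := one_sub_le_exp_neg (1 / 32 : ℝ)
    have e3 : exp (1 / 32 : ℝ) * exp (-(1 / 32)) = 1 := by rw [← exp_add]; simp
    nlinarith [exp_pos (1 / 32 : ℝ)]
  have h7 : 62 / 100 ≤ cos (x 3 - z 3) := by
    rw [cos_sub]
    have e1 := sin_sq_add_cos_sq (x 3)
    have e2 := sin_sq_add_cos_sq (z 3)
    nlinarith [sq_nonneg (sin (x 3) + sin (z 3))]
  rw [sden, reg_zero, Pi.sub_apply]
  linarith

lemma ae_cell_radSq_sub_pos (x : Fin 4 → ℝ) :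
    ∀ᵐ z : Fin 4 → ℝ ∂(volume.restrict cell), 0 < radSq (x - z) :=
  ae_restrict_of_ae
    ((Measure.measurePreserving_sub_left (volume : Measure (Fin 4 → ℝ)) x).quasiMeasurePreserving.ae
      ae_radSq_pos)

/-- A competitor with negative interaction energy. -/
lemma exists_prof_energy_neg : ∃ f : (Fin 4 → ℝ) → ℝ, (∀ c, 0 < c → ∃ B Λ, Prof c B Λ f) ∧
    ∫ z in cell, f z = 1 ∧ energy f ≤ log (9 / 10) := by
  set A := (∫ z in cell, bump z)⁻¹ with hA
  have hA0 : 0 < A := inv_pos.2 integral_bump_pos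
  have hp : Prof 1 (A * exp 1) (A * 1) fun x => A * bump x := (prof_bump one_pos).const_mul hA0.le
  have hm : ∫ z in cell, A * bump z = 1 := by
    rw [integral_const_mul, hA, inv_mul_cancel₀ integral_bump_pos.ne']
  have hi := hp.integrableOn one_pos
  refine ⟨fun x => A * bump x, fun c hc => ⟨_, _, (prof_bump hc).const_mul hA0.le⟩, hm, ?_⟩
  have hconv : ∀ x, bump x ≠ 0 → conv (ker 0) (fun x => A * bump x) x ≤ log (9 / 10) := by
    intro x hx
    obtain ⟨h1, h2⟩ := conv_ker_eq one_pos hp.decays x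
    rw [h2, ← mul_one (log (9 / 10)), ← hm, ← integral_const_mul]
    refine integral_mono_ae h1 (hi.const_mul _) ?_
    filter_upwards [ae_cell_radSq_sub_pos x] with z hz
    rw [mul_comm]
    by_cases h : bump z = 0
    · simp [h]
    · refine mul_le_mul_of_nonneg_right ?_ (mul_nonneg hA0.le (bump_nonneg z))
      exact log_le_log (sden_pos (by linarith)) (sden_le_of_bump_ne_zero hx h)
  rw [← mul_one (log (9 / 10)), ← hm, ← integral_const_mul]
  refine integral_mono (integrableOn_mul_conv_ker one_pos hp.decays hp.decays) (hi.const_mul _)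
    fun x => ?_
  simp only
  rw [mul_comm (log _)]
  by_cases h : bump x = 0
  · simp [h]
  · exact mul_le_mul_of_nonneg_left (hconv x h) (mul_nonneg hA0.le (bump_nonneg x))

/-- Existence of a minimizer of negative energy in a class stable under relaxation. -/
lemma exists_minimizer_relax : ∃ κ c B Λ : ℝ, ∃ f : (Fin 4 → ℝ) → ℝ, 0 < κ ∧ 0 < c ∧
    Prof c B Λ f ∧ ∫ z in cell, f z = 1 ∧ func κ f < 0 ∧
    (∀ g, Prof c B Λ g → ∫ z in cell, g z = 1 → func κ f ≤ func κ g) ∧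
    0 < ∫ z in cell, exp (-(exp (-ent f) / κ) * conv (ker 0) f z) ∧
    Prof c B Λ (relax (exp (-ent f) / κ) f) ∧
    ∫ z in cell, relax (exp (-ent f) / κ) f z = 1 := by
  obtain ⟨f₀, h1, h2, h3⟩ := exists_prof_energy_neg
  have hlog : log (9 / 10) < 0 := log_neg (by norm_num) (by norm_num)
  set κ := -log (9 / 10) / 4 * exp (-ent f₀) with hκ
  have hκ0 : 0 < κ := mul_pos (by linarith) (exp_pos _)
  have hf₀ : func κ f₀ < 0 := by
    rw [func, hκ, mul_assoc, ← exp_add]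
    simp only [neg_add_cancel, exp_zero, mul_one]
    linarith
  obtain ⟨c, hc, hB⟩ := exists_prof_relax hκ0
  obtain ⟨B₀, Λ₀, hp⟩ := h1 c hc
  obtain ⟨B, hB₀, hΛ⟩ := hB B₀
  obtain ⟨Λ, hΛ₀, hrel⟩ := hΛ Λ₀
  have hp' := hp.mono hB₀ hΛ₀
  obtain ⟨f, hf, hm, hmin⟩ := exists_minimizer hc κ hp' h2
  have hneg : func κ f < 0 := (hmin f₀ hp' h2).trans_lt hf₀
  exact ⟨κ, c, B, Λ, f, hκ0, hc, hf, hm, hneg, hmin, hrel f hf hm hneg⟩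
end CylinderLiouville

namespace CylinderLiouville
open Real Set Filter Topology

variable {c B Λ : ℝ} {f g : (Fin 4 → ℝ) → ℝ}

lemma log_two_mul_cosh_sub (r t : ℝ) (hr : 0 < r) : log (2 * cosh r - 2 * cos t) =
    2 * log ‖circleMap 0 1 t - (exp r : ℂ)‖ - r := by
  have h1 : ‖circleMap 0 1 t - (exp r : ℂ)‖ ^ 2 = exp r * (2 * cosh r - 2 * cos t) := by
    have e : circleMap 0 1 t - (exp r : ℂ) = ((cos t - exp r : ℝ) : ℂ) + (sin t : ℝ) * Complex.I := by
      rw [circleMap, Complex.exp_mul_I]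
      push_cast
      ring
    rw [e, ← Complex.normSq_eq_norm_sq, Complex.normSq_add_mul_I, cosh_eq]
    have e2 : exp r * exp (-r) = 1 := by rw [← exp_add]; simp
    have e3 := sin_sq_add_cos_sq t
    linear_combination e3 - e2
  have h2 : 0 < 2 * cosh r - 2 * cos t := by
    have := one_add_sq_div_two_le_cosh r
    have := cos_le_one t
    nlinarith [pow_pos hr 2]
  have h3 : log (‖circleMap 0 1 t - (exp r : ℂ)‖ ^ 2) = r + log (2 * cosh r - 2 * cos t) := by
    rw [h1, log_mul (exp_pos r).ne' h2.ne', log_exp]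
  rw [log_pow] at h3
  simp only [Nat.cast_ofNat] at h3
  linarith

lemma integral_log_two_mul_cosh_sub (r y : ℝ) (hr : 0 < r) :
    0 ≤ ∫ t in Ioc (-π) π, log (2 * cosh r - 2 * cos (y + t)) := by
  have h1 : ∫ t in Ioc (-π) π, log (2 * cosh r - 2 * cos (y + t)) =
      ∫ t in (0 : ℝ)..(2 * π), log (2 * cosh r - 2 * cos t) := by
    rw [← intervalIntegral.integral_of_le (by linarith [pi_pos]),
      intervalIntegral.integral_comp_add_left (fun t => log (2 * cosh r - 2 * cos t)) y]
    have hp : Function.Periodic (fun t => log (2 * cosh r - 2 * cos t)) (2 * π) := fun t => by simp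
    have := hp.intervalIntegral_add_eq (y + -π) 0
    rwa [show y + -π + 2 * π = y + π by ring, zero_add] at this
  have h2 := circleAverage_log_norm_sub_const_eq_posLog (a := (exp r : ℂ))
  have h3 : ‖(exp r : ℂ)‖ = exp r := by
    rw [Complex.norm_real, norm_of_nonneg (exp_pos r).le]
  rw [h3, posLog_eq_log (by rw [abs_of_pos (exp_pos r)]; exact one_le_exp hr.le), log_exp,
    circleAverage_def, smul_eq_mul] at h2
  have h4 : ∫ t in (0 : ℝ)..(2 * π), log ‖circleMap 0 1 t - (exp r : ℂ)‖ = 2 * π * r := by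
    rwa [inv_mul_eq_iff_eq_mul₀ (by have := pi_pos; positivity)] at h2
  have hi : IntervalIntegrable (fun t => 2 * log ‖circleMap 0 1 t - (exp r : ℂ)‖) volume 0 (2 * π) := by
    have hcont : Continuous fun t : ℝ => log (2 * cosh r - 2 * cos t) + r := by
      refine (Continuous.log (by fun_prop) fun t => ?_).add_const r
      have := one_add_sq_div_two_le_cosh r
      have := cos_le_one t
      nlinarith [pow_pos hr 2]
    have e : (fun t => 2 * log ‖circleMap 0 1 t - (exp r : ℂ)‖) =
        fun t => log (2 * cosh r - 2 * cos t) + r := by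
      ext t
      rw [log_two_mul_cosh_sub r t hr]
      ring
    rw [e]
    exact hcont.intervalIntegrable _ _
  rw [h1, funext fun t => log_two_mul_cosh_sub r t hr,
    intervalIntegral.integral_sub hi (by simp), intervalIntegral.integral_const_mul, h4,
    intervalIntegral.integral_const, smul_eq_mul]
  have := pi_pos
  nlinarith

/-- The potential of a profile not depending on the last coordinate is nonnegative. -/
lemma conv_ker_nonneg_of_indep (hc : 0 < c) (hf : Decays c f) (h0 : ∀ x, 0 ≤ f x)
    (hind : ∀ x t, f (x + Pi.single 3 t) = f x) (x : Fin 4 → ℝ) : 0 ≤ conv (ker 0) f x := by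
  have hp : Function.Periodic (fun z => ker 0 z * f (x - z)) shift := fun z => by
    have := hf.periodic (x - (z + shift))
    rw [show x - (z + shift) + shift = x - z by abel] at this
    simp only [periodic_ker 0 z, this]
  have hsh : ∀ (z : Fin 4 → ℝ) t, f (x - (z + Pi.single 3 t)) = f (x - z) := fun z t => by
    have e : x - z = x - (z + Pi.single 3 t) + Pi.single 3 t := by abel
    rw [e, hind]
  have h1 : ∀ t : ℝ, ∫ z in cell, ker 0 (z + Pi.single 3 t) * f (x - z) = conv (ker 0) f x :=
    fun t => by
      rw [conv, ← setIntegral_cell_add hp (Pi.single 3 t)]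
      simp only [hsh]
  have hi := integrableOn_conv hc (isKernel_ker le_rfl zero_le_one) hf x
  have hpn : Function.Periodic (fun z => ‖ker 0 z * f (x - z)‖) shift := fun z => by
    simp only [hp z]
  have h2 : ∀ t : ℝ, ∫ z in cell, ‖ker 0 (z + Pi.single 3 t) * f (x - z)‖ =
      ∫ z in cell, ‖ker 0 z * f (x - z)‖ := fun t => by
    rw [← setIntegral_cell_add hpn (Pi.single 3 t)]
    simp only [hsh]
  have h3 : ∀ t : ℝ, IntegrableOn (fun z => ker 0 (z + Pi.single 3 t) * f (x - z)) cell :=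
    fun t => by
      have hp' : Function.Periodic (fun z => ker 0 (-z) * f (x + z)) shift := fun z => by
        simp only [ker_neg, periodic_ker 0 z, ← add_assoc, hf.periodic (x + z)]
      have hi' : IntegrableOn (fun z => ker 0 (-z) * f (x + z)) cell := by
        have := integrableOn_cell_sub hp hi 0
        simpa using this
      have := integrableOn_cell_sub hp' hi' (-Pi.single 3 t)
      refine this.congr (ae_of_all _ fun z => ?_)
      simp only
      rw [← hsh z t]
      congr 2 <;> abel
  have hInt : Integrable (Function.uncurry fun (t : ℝ) (z : Fin 4 → ℝ) =>
      ker 0 (z + Pi.single 3 t) * f (x - z))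
      ((volume.restrict (Ioc (-π) π)).prod (volume.restrict cell)) := by
    refine (integrable_prod_iff ?_).2 ⟨ae_of_all _ h3, ?_⟩
    · have e1 : Measurable fun p : ℝ × (Fin 4 → ℝ) => p.2 + Pi.single 3 p.1 := by
        have : Measurable fun t : ℝ => (Pi.single 3 t : Fin 4 → ℝ) :=
          (continuous_single 3).measurable
        fun_prop
      have e2 := hf.cont.measurable
      exact (((measurable_ker 0).comp e1).mul
        (e2.comp (by fun_prop : Measurable fun p : ℝ × (Fin 4 → ℝ) => x - p.2))).aestronglyMeasurable
    · simp only [Function.uncurry_apply_pair, h2]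
      exact integrable_const _
  have h4 := integral_integral_swap hInt
  simp only [h1] at h4
  have h5 : 0 ≤ ∫ z in cell, ∫ t in Ioc (-π) π, ker 0 (z + Pi.single 3 t) * f (x - z) := by
    refine integral_nonneg_of_ae ?_
    filter_upwards [ae_cell_radSq_pos] with z hz
    simp only [Pi.zero_apply]
    rw [integral_mul_const]
    refine mul_nonneg ?_ (h0 _)
    have e : ∀ t : ℝ, ker 0 (z + Pi.single 3 t) = log (2 * cosh (rad z) - 2 * cos (z 3 + t)) :=
      fun t => by
        have : rad (z + Pi.single 3 t) = rad z := by simp [rad, radSq]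
        rw [ker, sden, reg_zero, this]
        simp
    simp only [e]
    exact integral_log_two_mul_cosh_sub _ _ (Real.sqrt_pos.2 hz)
  rw [← h4, integral_const, smul_eq_mul] at h5
  have hπ := pi_pos
  have h6 : (volume.restrict (Ioc (-π) π)).real univ = 2 * π := by
    simp [Measure.real, Real.volume_Ioc]
    rw [ENNReal.toReal_ofReal (by linarith)]
    ring
  rw [h6] at h5
  exact nonneg_of_mul_nonneg_right h5 (by linarith)

lemma func_nonneg_of_indep (hc : 0 < c) (h : Prof c B Λ f)
    (hind : ∀ x t, f (x + Pi.single 3 t) = f x) {κ : ℝ} (hκ : 0 ≤ κ) : 0 ≤ func κ f := by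
  have : 0 ≤ energy f := integral_nonneg fun z =>
    mul_nonneg (h.nonneg z) (conv_ker_nonneg_of_indep hc h.decays h.nonneg hind z)
  unfold func
  positivity
end CylinderLiouville

namespace CylinderLiouville
open Real Set Filter Topology

variable {c B Λ : ℝ} {f g : (Fin 4 → ℝ) → ℝ}

lemma Prof.segment (hf : Prof c B Λ f) (hg : Prof c B Λ g) {t : ℝ} (h0 : 0 ≤ t) (h1 : t ≤ 1) :
    Prof c B Λ fun x => (1 - t) * f x + t * g x where
  radial x y e e3 := by rw [hf.radial x y e e3, hg.radial x y e e3]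
  even x := by rw [hf.even, hg.even]
  periodic x := by simp only [hf.periodic x, hg.periodic x]
  nonneg x := add_nonneg (mul_nonneg (by linarith) (hf.nonneg x)) (mul_nonneg h0 (hg.nonneg x))
  le x := by
    have e1 := mul_le_mul_of_nonneg_left (hf.le x) (show 0 ≤ 1 - t by linarith)
    have e2 := mul_le_mul_of_nonneg_left (hg.le x) h0
    linarith
  lip x y := by
    have e1 := mul_le_mul_of_nonneg_left (hf.lip x y) (show 0 ≤ 1 - t by linarith)
    have e2 := mul_le_mul_of_nonneg_left (hg.lip x y) h0
    have e : (1 - t) * f x + t * g x - ((1 - t) * f y + t * g y) =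
      (1 - t) * (f x - f y) + t * (g x - g y) := by ring
    rw [e]
    refine (abs_add_le _ _).trans ?_
    rw [abs_mul, abs_mul, abs_of_nonneg h0, abs_of_nonneg (show 0 ≤ 1 - t by linarith)]
    linarith

/-- The mutual interaction energy of two densities in one period cell. -/
noncomputable def interact (f g : (Fin 4 → ℝ) → ℝ) : ℝ := ∫ z in cell, f z * conv (ker 0) g z

lemma integrableOn_mul_abs_ker (hc : 0 < c) (hg : Prof c B Λ g)
    (x : Fin 4 → ℝ) : IntegrableOn (fun z => g z * ker 0 (x - z)) cell ∧
      ∫ z in cell, ‖g z * ker 0 (x - z)‖ ≤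
        2 * ((∫ z in cell, g z) * (rad x + 3) + mom g) - conv (ker 0) g x := by
  obtain ⟨h1, h2⟩ := conv_ker_eq hc hg.decays x
  have h3 := integrableOn_mul_rad hc hg.decays
  have h4 := hg.integrableOn hc
  have h5 : IntegrableOn (fun z => g z * (rad x + 3) + g z * rad z) cell :=
    (h4.mul_const _).add h3
  refine ⟨h1, ?_⟩
  have key : ∫ z in cell, ‖g z * ker 0 (x - z)‖ ≤
      ∫ z in cell, (2 * (g z * (rad x + 3) + g z * rad z) - g z * ker 0 (x - z)) := by
    refine integral_mono h1.norm ((h5.const_mul 2).sub h1) fun z => ?_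
    simp only
    rw [norm_mul, norm_of_nonneg (hg.nonneg z), norm_eq_abs]
    have e1 := ker_zero_le (x - z)
    have e2 := rad_sub_le x z
    have e3 := rad_nonneg z
    have e4 := rad_nonneg x
    have e5 : |ker 0 (x - z)| ≤ 2 * (rad x + 3 + rad z) - ker 0 (x - z) :=
      abs_le.2 ⟨by linarith, by linarith⟩
    have := mul_le_mul_of_nonneg_left e5 (hg.nonneg z)
    linarith
  rw [integral_sub (h5.const_mul 2) h1, integral_const_mul, integral_add (h4.mul_const _) h3,
    integral_mul_const, ← h2] at key
  exact key

lemma interact_comm (hc : 0 < c) (hf : Prof c B Λ f) (hg : Prof c B Λ g) :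
    interact f g = interact g f := by
  obtain ⟨K, hK, hb⟩ := abs_conv_ker_le hc
  have hB := hg.const_nonneg
  have hInt : Integrable (Function.uncurry fun x z : Fin 4 → ℝ => f x * (g z * ker 0 (x - z)))
      ((volume.restrict cell).prod (volume.restrict cell)) := by
    have hm : AEStronglyMeasurable
        (Function.uncurry fun x z : Fin 4 → ℝ => f x * (g z * ker 0 (x - z)))
        ((volume.restrict cell).prod (volume.restrict cell)) := by
      have e1 := hf.cont.measurable
      have e2 := hg.cont.measurable
      have e3 := measurable_ker 0
      refine Measurable.aestronglyMeasurable ?_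
      unfold Function.uncurry
      fun_prop
    refine (integrable_prod_iff hm).2 ⟨ae_of_all _ fun x => ?_, ?_⟩
    · exact (integrableOn_mul_abs_ker hc hg x).1.const_mul (f x)
    set m := ∫ z in cell, g z with hmd
    have hm0 : 0 ≤ m := integral_nonneg hg.nonneg
    have hmom := mom_nonneg hg
    have h1 : IntegrableOn (fun x => f x * ((2 * (3 * m + mom g) + B * K) * (1 + rad x))) cell := by
      have := continuous_rad
      refine integrableOn_mul_of_growth hc hf.decays (Continuous.aestronglyMeasurable (by fun_prop))
        (C := 2 * (3 * m + mom g) + B * K) fun z => ?_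
      have := rad_nonneg z
      rw [abs_of_nonneg (by positivity)]
    refine Integrable.mono' h1 hm.norm.integral_prod_right' (ae_of_all _ fun x => ?_)
    rw [norm_of_nonneg (integral_nonneg fun _ => norm_nonneg _)]
    simp only [Function.uncurry_apply_pair]
    have e : ∀ z, ‖f x * (g z * ker 0 (x - z))‖ = f x * ‖g z * ker 0 (x - z)‖ := fun z => by
      rw [norm_mul (f x), norm_of_nonneg (hf.nonneg x)]
    simp only [e]
    rw [integral_const_mul]
    refine mul_le_mul_of_nonneg_left ((integrableOn_mul_abs_ker hc hg x).2.trans ?_) (hf.nonneg x)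
    have e1 := (abs_le.1 (hb g B hB hg.abs_le x)).1
    have e2 := rad_nonneg x
    rw [← hmd]
    nlinarith [mul_nonneg hm0 e2, mul_nonneg hmom e2]
  have h2 := integral_integral_swap hInt
  have e1 : interact f g = ∫ x in cell, ∫ z in cell, f x * (g z * ker 0 (x - z)) := by
    unfold interact
    refine integral_congr_ae (ae_of_all _ fun x => ?_)
    simp only
    rw [integral_const_mul, (conv_ker_eq hc hg.decays x).2]
  have e2 : interact g f = ∫ z in cell, ∫ x in cell, f x * (g z * ker 0 (x - z)) := by
    unfold interact
    refine integral_congr_ae (ae_of_all _ fun z => ?_)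
    simp only
    rw [(conv_ker_eq hc hf.decays z).2, ← integral_const_mul]
    refine integral_congr_ae (ae_of_all _ fun x => ?_)
    simp only
    rw [← ker_neg 0 (z - x), neg_sub]
    ring
  rw [e1, e2, h2]

lemma conv_segment (hc : 0 < c) (hf : Decays c f) (hg : Decays c g) (t : ℝ) (x : Fin 4 → ℝ) :
    conv (ker 0) (fun x => (1 - t) * f x + t * g x) x =
      (1 - t) * conv (ker 0) f x + t * conv (ker 0) g x := by
  have h1 := integrableOn_conv hc (isKernel_ker le_rfl zero_le_one) hf x
  have h2 := integrableOn_conv hc (isKernel_ker le_rfl zero_le_one) hg x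
  unfold conv
  rw [← integral_const_mul, ← integral_const_mul,
    ← integral_add (h1.const_mul _) (h2.const_mul _)]
  refine integral_congr_ae (ae_of_all _ fun z => ?_)
  simp only
  ring

lemma energy_segment (hc : 0 < c) (hf : Prof c B Λ f) (hg : Prof c B Λ g) (t : ℝ) :
    energy (fun x => (1 - t) * f x + t * g x) = energy f + 2 * t * (interact g f - energy f) +
      t ^ 2 * (energy f - 2 * interact g f + energy g) := by
  have h1 := integrableOn_mul_conv_ker hc hf.decays hf.decays
  have h2 := integrableOn_mul_conv_ker hc hf.decays hg.decays
  have h3 := integrableOn_mul_conv_ker hc hg.decays hf.decays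
  have h4 := integrableOn_mul_conv_ker hc hg.decays hg.decays
  have e : energy (fun x => (1 - t) * f x + t * g x) = ∫ z in cell,
      (((1 - t) ^ 2 * (f z * conv (ker 0) f z) + (1 - t) * t * (f z * conv (ker 0) g z)) +
        ((1 - t) * t * (g z * conv (ker 0) f z) + t ^ 2 * (g z * conv (ker 0) g z))) := by
    unfold energy
    refine integral_congr_ae (ae_of_all _ fun z => ?_)
    simp only
    rw [conv_segment hc hf.decays hg.decays]
    ring
  have i1 : IntegrableOn (fun z => (1 - t) ^ 2 * (f z * conv (ker 0) f z) +
      (1 - t) * t * (f z * conv (ker 0) g z)) cell := (h1.const_mul _).add (h2.const_mul _)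
  have i2 : IntegrableOn (fun z => (1 - t) * t * (g z * conv (ker 0) f z) +
      t ^ 2 * (g z * conv (ker 0) g z)) cell := (h3.const_mul _).add (h4.const_mul _)
  rw [e, integral_add i1 i2, integral_add (h1.const_mul _) (h2.const_mul _),
    integral_add (h3.const_mul _) (h4.const_mul _)]
  simp only [integral_const_mul]
  have hs := interact_comm hc hf hg
  unfold interact at hs
  unfold interact energy
  rw [hs]
  ring

lemma mul_log_segment_le {a b t : ℝ} (ha : 0 ≤ a) (hb : 0 < b) (ht : 0 < t) (ht1 : t ≤ 1 / 2) :
    ((1 - t) * a + t * b) * log ((1 - t) * a + t * b) - a * log a ≤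
      t * ((b - a) * log ((1 - 1 / 2) * a + 1 / 2 * b) + (b - a)) := by
  set y := (1 - t) * a + t * b with hy
  have hy0 : 0 < y := by
    have e1 := mul_nonneg (show 0 ≤ 1 - t by linarith) ha
    have e2 := mul_pos ht hb
    linarith
  have h1 : y * log y - a * log a ≤ (y - a) * (log y + 1) := by
    rcases ha.eq_or_lt with h | h
    · rw [← h]; simp only [zero_mul, sub_zero]; linarith
    · have e := log_le_sub_one_of_pos (x := y / a) (by positivity)
      rw [log_div hy0.ne' h.ne'] at e
      have e2 := mul_le_mul_of_nonneg_left e h.le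
      have e3 : a * (y / a - 1) = y - a := by field_simp
      rw [e3] at e2
      linarith
  have h2 : y - a = t * (b - a) := by rw [hy]; ring
  rw [h2] at h1
  refine h1.trans ?_
  rw [mul_assoc, mul_add, mul_one]
  refine mul_le_mul_of_nonneg_left (add_le_add_left ?_ _) ht.le
  rcases le_total a b with h | h
  · refine mul_le_mul_of_nonneg_left (log_le_log hy0 ?_) (by linarith)
    rw [hy]; nlinarith
  · refine mul_le_mul_of_nonpos_left (log_le_log (by linarith) ?_) (by linarith)
    rw [hy]; nlinarith

end CylinderLiouville

namespace CylinderLiouville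
open Real Set Filter Topology

variable {c B Λ : ℝ} {f g : (Fin 4 → ℝ) → ℝ}

lemma Prof.le_const (hf : Prof c B Λ f) (hc : 0 < c) (x : Fin 4 → ℝ) : f x ≤ B :=
  (hf.le x).trans (mul_le_of_le_one_right hf.const_nonneg (by
    rw [exp_le_one_iff]
    have := mul_nonneg hc.le (rad_nonneg x)
    linarith))

lemma segment_half_pos (hf : Prof c B Λ f) (hg : ∀ x, 0 < g x) (x : Fin 4 → ℝ) :
    0 < (1 - 1 / 2) * f x + 1 / 2 * g x := by
  have e1 := hf.nonneg x
  have e2 := hg x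
  linarith

lemma abs_log_segment_half_le (hc : 0 < c) (hf : Prof c B Λ f) (hg : Prof c B Λ g)
    (hg0 : ∀ x, 0 < g x) {C : ℝ} (hC : ∀ z, |log (g z)| ≤ C * (1 + rad z)) (z : Fin 4 → ℝ) :
    |log ((1 - 1 / 2) * f z + 1 / 2 * g z)| ≤ (B + C + 1) * (1 + rad z) := by
  have hp := segment_half_pos hf hg0 z
  have hB := hf.const_nonneg
  have hr := rad_nonneg z
  have hCr : 0 ≤ C * (1 + rad z) := (abs_nonneg _).trans (hC z)
  have h1 : log ((1 - 1 / 2) * f z + 1 / 2 * g z) ≤ B := by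
    have e1 := log_le_sub_one_of_pos hp
    have e2 := hf.le_const hc z
    have e3 := hg.le_const hc z
    linarith
  have h2 : log (g z) - log 2 ≤ log ((1 - 1 / 2) * f z + 1 / 2 * g z) := by
    rw [← log_div (hg0 z).ne' two_ne_zero]
    refine log_le_log (by have := hg0 z; positivity) ?_
    have := hf.nonneg z
    linarith
  have h3 : log 2 ≤ 1 := by
    have := log_le_sub_one_of_pos (x := 2) two_pos
    linarith
  have h4 := (abs_le.1 (hC z)).1
  have h5 := mul_nonneg hB hr
  exact abs_le.2 ⟨by nlinarith, by nlinarith⟩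

lemma continuous_log_segment_half (hf : Prof c B Λ f) (hg : Prof c B Λ g) (hg0 : ∀ x, 0 < g x) :
    Continuous fun z => log ((1 - 1 / 2) * f z + 1 / 2 * g z) := by
  have h1 := hf.cont
  have h2 := hg.cont
  exact Continuous.log (by fun_prop) fun x => (segment_half_pos hf hg0 x).ne'

lemma ent_segment_sub_le (hc : 0 < c) (hf : Prof c B Λ f) (hg : Prof c B Λ g)
    (hg0 : ∀ x, 0 < g x) {C : ℝ} (hC : ∀ z, |log (g z)| ≤ C * (1 + rad z))
    (hm : ∫ z in cell, g z = ∫ z in cell, f z) {t : ℝ} (ht : 0 < t) (ht1 : t ≤ 1 / 2) :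
    ent (fun x => (1 - t) * f x + t * g x) - ent f ≤
      t * ∫ z in cell, (g z - f z) * log ((1 - 1 / 2) * f z + 1 / 2 * g z) := by
  have hψ := (continuous_log_segment_half hf hg hg0).aestronglyMeasurable
    (μ := volume.restrict cell)
  have hb := abs_log_segment_half_le hc hf hg hg0 hC
  have i1 : IntegrableOn (fun z => (g z - f z) * log ((1 - 1 / 2) * f z + 1 / 2 * g z)) cell := by
    refine ((integrableOn_mul_of_growth hc hg.decays hψ hb).sub
      (integrableOn_mul_of_growth hc hf.decays hψ hb)).congr (ae_of_all _ fun z => ?_)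
    simp only [Pi.sub_apply]
    ring
  have i2 : IntegrableOn (fun z => g z - f z) cell := (hg.integrableOn hc).sub (hf.integrableOn hc)
  have i3 := integrableOn_mul_log hc (hf.segment hg ht.le (show t ≤ 1 by linarith))
  have i4 := integrableOn_mul_log hc hf
  have h0 : ∫ z in cell, (g z - f z) = 0 := by
    rw [integral_sub (hg.integrableOn hc) (hf.integrableOn hc), hm, sub_self]
  unfold ent
  rw [← integral_sub i3 i4]
  refine (integral_mono (i3.sub i4) ((i1.add i2).const_mul t) fun z =>
    mul_log_segment_le (hf.nonneg z) (hg0 z) ht ht1).trans (le_of_eq ?_)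
  rw [integral_const_mul]
  simp only [Pi.add_apply]
  rw [integral_add i1 i2, h0, add_zero]

/-- The first-order condition at a minimizer, in direction of a positive profile. -/
lemma first_order {κ : ℝ} (hκ : 0 < κ) (hc : 0 < c) (hf : Prof c B Λ f) (hg : Prof c B Λ g)
    (hg0 : ∀ x, 0 < g x) {C : ℝ} (hC : ∀ z, |log (g z)| ≤ C * (1 + rad z))
    (hmf : ∫ z in cell, f z = 1) (hmg : ∫ z in cell, g z = 1)
    (hmin : ∀ g, Prof c B Λ g → ∫ z in cell, g z = 1 → func κ f ≤ func κ g) :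
    0 ≤ κ * exp (ent f) *
      (∫ z in cell, (g z - f z) * log ((1 - 1 / 2) * f z + 1 / 2 * g z)) +
      (interact g f - energy f) := by
  set I := ∫ z in cell, (g z - f z) * log ((1 - 1 / 2) * f z + 1 / 2 * g z) with hI
  set D := interact g f - energy f with hD
  set R := energy f - 2 * interact g f + energy g with hR
  set t : ℕ → ℝ := fun n => 1 / ((n : ℝ) + 1) / 2 with ht
  have ht0 : ∀ n, 0 < t n := fun n => by rw [ht]; positivity
  have ht1 : ∀ n, t n ≤ 1 / 2 := fun n => by
    simp only [ht]
    have : 1 / ((n : ℝ) + 1) ≤ 1 := by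
      rw [div_le_one (by positivity)]
      linarith [Nat.cast_nonneg (α := ℝ) n]
    linarith
  have htl : Tendsto t atTop (𝓝 0) := by
    simpa [ht] using (tendsto_one_div_add_atTop_nhds_zero_nat (𝕜 := ℝ)).div_const 2
  set F : ℕ → (Fin 4 → ℝ) → ℝ := fun n x => (1 - t n) * f x + t n * g x with hF
  have hFp : ∀ n, Prof c B Λ (F n) := fun n => hf.segment hg (ht0 n).le (by linarith [ht1 n])
  have hFl : ∀ x, Tendsto (fun n => F n x) atTop (𝓝 (f x)) := fun x => by
    have := ((htl.const_sub 1).mul_const (f x)).add (htl.mul_const (g x))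
    simpa using this
  have hFm : ∀ n, ∫ z in cell, F n z = 1 := fun n => by
    simp only [hF]
    rw [integral_add ((hf.integrableOn hc).const_mul _) ((hg.integrableOn hc).const_mul _),
      integral_const_mul, integral_const_mul, hmf, hmg]
    ring
  have hlim : Tendsto (fun n => κ * exp (ent (F n)) * I + D + t n * (R / 2)) atTop
      (𝓝 (κ * exp (ent f) * I + D)) := by
    have e1 := (continuous_exp.tendsto _).comp (tendsto_ent hc hFp hFl)
    have := (((e1.const_mul κ).mul_const I).add_const D).add (htl.mul_const (R / 2))
    simpa using this
  refine ge_of_tendsto' hlim fun n => ?_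
  have h1 := hmin _ (hFp n) (hFm n)
  have h2 : ent (F n) - ent f ≤ t n * I :=
    ent_segment_sub_le hc hf hg hg0 hC (hmg.trans hmf.symm) (ht0 n) (ht1 n)
  have h3 : energy (F n) = energy f + 2 * t n * D + t n ^ 2 * R := energy_segment hc hf hg (t n)
  have h4 : exp (ent (F n)) - exp (ent f) ≤ exp (ent (F n)) * (ent (F n) - ent f) := by
    have e1 := add_one_le_exp (ent f - ent (F n))
    have e2 : exp (ent f) = exp (ent (F n)) * exp (ent f - ent (F n)) := by
      rw [← exp_add]; congr 1; ring
    have e3 := mul_le_mul_of_nonneg_left e1 (exp_pos (ent (F n))).le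
    rw [← e2] at e3
    linarith
  have h5 := mul_le_mul_of_nonneg_left (h4.trans
    (mul_le_mul_of_nonneg_left h2 (exp_pos (ent (F n))).le)) hκ.le
  unfold func at h1
  rw [h3] at h1
  refine nonneg_of_mul_nonneg_right (a := t n) ?_ (ht0 n)
  nlinarith

lemma relax_pos {β : ℝ} (hZ : 0 < ∫ z in cell, exp (-β * conv (ker 0) f z)) (x : Fin 4 → ℝ) :
    0 < relax β f x := by unfold relax; positivity

lemma log_relax {β : ℝ} (hZ : 0 < ∫ z in cell, exp (-β * conv (ker 0) f z)) (x : Fin 4 → ℝ) :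
    log (relax β f x) =
      -β * conv (ker 0) f x - log (∫ z in cell, exp (-β * conv (ker 0) f z)) := by
  unfold relax
  rw [log_div (exp_pos _).ne' hZ.ne', log_exp]

lemma sub_mul_log_sub_nonneg {a b : ℝ} (ha : 0 ≤ a) (hb : 0 < b) :
    0 ≤ (b - a) * (log b - log ((1 - 1 / 2) * a + 1 / 2 * b)) := by
  rcases le_total a b with h | h
  · refine mul_nonneg (by linarith) (sub_nonneg.2 (log_le_log (by linarith) (by linarith)))
  · refine mul_nonneg_of_nonpos_of_nonpos (by linarith)
      (sub_nonpos.2 (log_le_log hb (by linarith)))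

lemma eq_of_sub_mul_log_sub_eq_zero {a b : ℝ} (ha : 0 ≤ a) (hb : 0 < b)
    (h : (b - a) * (log b - log ((1 - 1 / 2) * a + 1 / 2 * b)) = 0) : a = b := by
  rcases mul_eq_zero.1 h with h | h
  · linarith
  · have := log_injOn_pos (show b ∈ Ioi 0 from hb)
      (show (1 - 1 / 2) * a + 1 / 2 * b ∈ Ioi 0 by rw [mem_Ioi]; linarith) (by linarith)
    linarith

/-- A minimizer is a fixed point of the relaxation map. -/
lemma eq_relax_of_minimizer {κ : ℝ} (hκ : 0 < κ) (hc : 0 < c) (hf : Prof c B Λ f)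
    (hmf : ∫ z in cell, f z = 1)
    (hmin : ∀ g, Prof c B Λ g → ∫ z in cell, g z = 1 → func κ f ≤ func κ g)
    (hZ : 0 < ∫ z in cell, exp (-(exp (-ent f) / κ) * conv (ker 0) f z))
    (hg : Prof c B Λ (relax (exp (-ent f) / κ) f))
    (hmg : ∫ z in cell, relax (exp (-ent f) / κ) f z = 1) (x : Fin 4 → ℝ) :
    f x = relax (exp (-ent f) / κ) f x := by
  set β := exp (-ent f) / κ with hβ
  set g := relax β f with hgd
  set Z := ∫ z in cell, exp (-β * conv (ker 0) f z) with hZd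
  have hβ0 : 0 < β := by positivity
  have hg0 : ∀ x, 0 < g x := relax_pos hZ
  have hlog : ∀ x, log (g x) = -β * conv (ker 0) f x - log Z := log_relax hZ
  obtain ⟨K, hK, hb⟩ := abs_conv_ker_le hc
  have hB := hf.const_nonneg
  have hC : ∀ z, |log (g z)| ≤ (β * (B * K) + |log Z|) * (1 + rad z) := fun z => by
    rw [hlog]
    have e1 := mul_le_mul_of_nonneg_left (hb f B hB hf.abs_le z) hβ0.le
    have e2 := mul_nonneg (abs_nonneg (log Z)) (rad_nonneg z)
    refine (abs_sub _ _).trans ?_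
    rw [abs_mul, abs_neg, abs_of_pos hβ0]
    linarith
  have h1 := first_order hκ hc hf hg hg0 hC hmf hmg hmin
  have hψ := continuous_log_segment_half hf hg hg0
  have hψb := abs_log_segment_half_le hc hf hg hg0 hC
  have hlc : Continuous fun z => log (g z) := hg.cont.log fun x => (hg0 x).ne'
  have hdiff : ∀ φ : (Fin 4 → ℝ) → ℝ, IntegrableOn (fun z => g z * φ z) cell →
      IntegrableOn (fun z => f z * φ z) cell → IntegrableOn (fun z => (g z - f z) * φ z) cell ∧
      ∫ z in cell, (g z - f z) * φ z = (∫ z in cell, g z * φ z) - ∫ z in cell, f z * φ z := by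
    intro φ h1 h2
    have e : (fun z => (g z - f z) * φ z) = fun z => g z * φ z - f z * φ z := by
      funext z; ring
    rw [e]
    exact ⟨h1.sub h2, integral_sub h1 h2⟩
  obtain ⟨iψ, -⟩ := hdiff _
    (integrableOn_mul_of_growth hc hg.decays hψ.aestronglyMeasurable hψb)
    (integrableOn_mul_of_growth hc hf.decays hψ.aestronglyMeasurable hψb)
  obtain ⟨iL, -⟩ := hdiff _
    (integrableOn_mul_of_growth hc hg.decays hlc.aestronglyMeasurable hC)
    (integrableOn_mul_of_growth hc hf.decays hlc.aestronglyMeasurable hC)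
  obtain ⟨iV, eV⟩ := hdiff _ (integrableOn_mul_conv_ker hc hg.decays hf.decays)
    (integrableOn_mul_conv_ker hc hf.decays hf.decays)
  have i1 : IntegrableOn (fun z => g z - f z) cell := (hg.integrableOn hc).sub (hf.integrableOn hc)
  have e0 : ∫ z in cell, (g z - f z) = 0 := by
    rw [integral_sub (hg.integrableOn hc) (hf.integrableOn hc), hmf, hmg, sub_self]
  have eL : ∫ z in cell, (g z - f z) * log (g z) = -β * (interact g f - energy f) := by
    have e : (fun z => (g z - f z) * log (g z)) = fun z =>
        -β * ((g z - f z) * conv (ker 0) f z) - (g z - f z) * log Z := by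
      funext z; rw [hlog]; ring
    rw [e, integral_sub (iV.const_mul _) (i1.mul_const _), integral_const_mul, integral_mul_const,
      e0, zero_mul, sub_zero, eV]
    rfl
  have hκβ : κ * exp (ent f) * β = 1 := by
    rw [hβ, exp_neg]
    field_simp
  set J : (Fin 4 → ℝ) → ℝ := fun z =>
    (g z - f z) * (log (g z) - log ((1 - 1 / 2) * f z + 1 / 2 * g z)) with hJ
  have hJe : J = fun z => (g z - f z) * log (g z) -
      (g z - f z) * log ((1 - 1 / 2) * f z + 1 / 2 * g z) := by
    funext z; simp only [hJ]; ring
  have hJ0 : ∀ z, 0 ≤ J z := fun z => sub_mul_log_sub_nonneg (hf.nonneg z) (hg0 z)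
  have hJi : IntegrableOn J cell := by rw [hJe]; exact iL.sub iψ
  have hJz : ∫ z in cell, J z = 0 := by
    refine le_antisymm ?_ (integral_nonneg hJ0)
    rw [hJe, integral_sub iL iψ, eL]
    have := mul_nonneg hβ0.le h1
    linear_combination this + (∫ z in cell, (g z - f z) *
      log ((1 - 1 / 2) * f z + 1 / 2 * g z)) * hκβ
  have hJc : Continuous J := (hg.cont.sub hf.cont).mul (hlc.sub hψ)
  have hJp : Function.Periodic J shift := fun z => by
    simp only [hJ, hf.periodic z, hg.periodic z]
  exact eq_of_sub_mul_log_sub_eq_zero (hf.nonneg x) (hg0 x)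
    (eq_zero_of_integral_cell_eq_zero hJc hJ0 hJp hJi hJz x)

end CylinderLiouville

namespace CylinderLiouville
open Real Set Filter Topology

variable {c : ℝ} {f : (Fin 4 → ℝ) → ℝ}

lemma par_affine (a b : ℝ) (i : Fin 4) (g : (Fin 4 → ℝ) → ℝ) :
    par i (fun x => a * g x + b) = fun x => a * par i g x := by
  ext x
  unfold par
  have e : (fun x => a * g x) = a • g := rfl
  rw [fderiv_add_const, e, fderiv_const_smul_field]
  rfl

lemma lap_affine (a b : ℝ) (g : (Fin 4 → ℝ) → ℝ) :
    lap (fun x => a * g x + b) = fun x => a * lap g x := by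
  ext x
  unfold lap
  rw [Finset.mul_sum]
  refine Finset.sum_congr rfl fun i _ => ?_
  rw [par_affine]
  have := par_affine a 0 i (par i g)
  simp only [add_zero] at this
  rw [this]

lemma lapN_lapN_affine (hc : 0 < c) (h : ∀ k, SmoothDecays c k f) (a b : ℝ) (x : Fin 4 → ℝ) :
    lapN (lapN fun x => a * conv (ker 0) f x + b) x = a * conv (ker 0) (lap (lap f)) x := by
  have h1 : ContDiff ℝ 2 (conv (ker 0) f) := by exact_mod_cast contDiff_conv_ker hc (h 1)
  have h2 : SmoothDecays c 2 (lap f) := (h 4).lap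
  have h3 : ContDiff ℝ 2 (conv (ker 0) (lap f)) := by
    exact_mod_cast contDiff_conv_ker hc h2.of_succ
  have e := lap_affine a 0 (conv (ker 0) (lap f))
  simp only [add_zero] at e
  rw [lapN_eq_lap (contDiff_const.mul h1 |>.add contDiff_const), lap_affine,
    lap_conv_ker hc (h 2), lapN_eq_lap (contDiff_const.mul h3), e, lap_conv_ker hc h2]

lemma lintegral_eq_top_of_periodic {F : (Fin 4 → ℝ) → ENNReal} (hF : Measurable F)
    (hp : Function.Periodic F shift) (h0 : ∀ x, F x ≠ 0) : ∫⁻ z, F z = ⊤ := by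
  rw [lintegral_eq_tsum_cell]
  have e : ∀ n : ℤ, ∫⁻ z in cell, F (n • shift + z) = ∫⁻ z in cell, F z := fun n =>
    lintegral_congr fun z => by rw [add_comm]; exact hp.zsmul n z
  simp only [e]
  refine ENNReal.tsum_const_eq_top_of_ne_zero fun h => ?_
  rw [lintegral_eq_zero_iff hF] at h
  obtain ⟨x, hx⟩ := h.exists
  exact h0 x hx

lemma update_three_add (x : Fin 4 → ℝ) (t : ℝ) :
    Function.update x 3 (x 3 + t) = x + Pi.single 3 t := by
  ext j
  by_cases hj : j = 3
  · subst hj; simp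
  · simp [hj]

end CylinderLiouville

/-- The 4D Liouville equation `Δ²u = e^u` admits a `C⁴` solution on `ℝ⁴` which is radial in the
first three coordinates, bounded by `C(1 + |(x₁,x₂,x₃)|)` (so decaying at most linearly),
periodic in `x₄` of some period `T > 0` but not independent of `x₄`, and with infinite volume
`∫ e^u = ∞`. -/
theorem stmt1 :
    ∃ u : (Fin 4 → ℝ) → ℝ, ContDiff ℝ 4 u ∧
      (∀ x : Fin 4 → ℝ, lapN (lapN u) x = Real.exp (u x)) ∧
      (∀ x y : Fin 4 → ℝ,
        (x 0) ^ 2 + (x 1) ^ 2 + (x 2) ^ 2 = (y 0) ^ 2 + (y 1) ^ 2 + (y 2) ^ 2 → x 3 = y 3 →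
          u x = u y) ∧
      (∃ C : ℝ, 0 < C ∧ ∀ x : Fin 4 → ℝ,
        |u x| ≤ C * (1 + Real.sqrt ((x 0) ^ 2 + (x 1) ^ 2 + (x 2) ^ 2))) ∧
      (∃ T : ℝ, 0 < T ∧ ∀ x : Fin 4 → ℝ, u (Function.update x 3 (x 3 + T)) = u x) ∧
      (∃ x : Fin 4 → ℝ, ∃ t : ℝ, u (Function.update x 3 t) ≠ u x) ∧
      ((∫⁻ x : Fin 4 → ℝ, ENNReal.ofReal (Real.exp (u x))) = ⊤) := by
  open CylinderLiouville in
  obtain ⟨κ, c, B, Λ, f, hκ, hc, hf, hm, hneg, hmin, hZ, hg, hmg⟩ := exists_minimizer_relax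
  obtain ⟨κ', hκ', hfund⟩ := exists_conv_ker_lap_lap
  have hfix := eq_relax_of_minimizer hκ hc hf hm hmin hZ hg hmg
  set β := Real.exp (-ent f) / κ with hβ
  have hβ0 : 0 < β := by positivity
  set Z := ∫ z in cell, Real.exp (-β * conv (ker 0) f z) with hZd
  set V := conv (ker 0) f with hV
  have hfx : ∀ x, f x = Z⁻¹ * Real.exp (-β * V x) := fun x => by
    rw [hfix x, relax, ← hV, ← hZd, div_eq_inv_mul]
  have hs := smoothDecays_of_eq hc hf.decays hfx
  have hA : 0 < β * κ' * Z⁻¹ := by positivity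
  set b := Real.log (β * κ' * Z⁻¹) with hb
  have hVc : ContDiff ℝ 4 V := by exact_mod_cast contDiff_conv_ker hc (hs 3)
  have hu : ContDiff ℝ 4 fun x => -β * V x + b := (contDiff_const.mul hVc).add contDiff_const
  have hexp : ∀ x, Real.exp (-β * V x + b) = β * κ' * f x := fun x => by
    rw [Real.exp_add, hb, Real.exp_log hA, hfx]
    ring
  have hVp : Function.Periodic V shift := periodic_conv hf.periodic
  obtain ⟨K, hK, hgr⟩ := abs_conv_ker_le hc
  have hB := hf.const_nonneg
  refine ⟨fun x => -β * V x + b, hu, fun x => ?_, fun x y h h3 => ?_,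
    ⟨β * (B * K) + |b| + 1, by positivity, fun x => ?_⟩,
    ⟨2 * Real.pi, by positivity, fun x => ?_⟩, ?_, ?_⟩
  · rw [lapN_lapN_affine hc hs, hfund c hc f (hs 4), hexp]
    ring
  · simp only
    rw [hV, conv_ker_eq_of_radSq_eq hf.radial h h3]
  · have e1 := mul_le_mul_of_nonneg_left (hgr f B hB hf.abs_le x) hβ0.le
    have e2 := rad_nonneg x
    have e3 := mul_nonneg (abs_nonneg b) e2
    change |-β * V x + b| ≤ (β * (B * K) + |b| + 1) * (1 + rad x)
    refine (abs_add_le _ _).trans ?_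
    rw [abs_mul, abs_neg, abs_of_pos hβ0]
    linarith
  · simp only
    rw [update_three_add, ← shift, hVp x]
  · by_contra! hind
    have hi : ∀ x t, f (x + Pi.single 3 t) = f x := fun x t => by
      have h1 := hind x (x 3 + t)
      rw [update_three_add] at h1
      have h2 : V (x + Pi.single 3 t) = V x := by
        have := add_right_cancel h1
        exact mul_left_cancel₀ (neg_ne_zero.2 hβ0.ne') this
      rw [hfx, hfx, h2]
    exact absurd (func_nonneg_of_indep hc hf hi hκ.le) (not_le.2 hneg)
  · refine lintegral_eq_top_of_periodic ?_ (fun x => by simp only [hVp x]) fun x => ?_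
    · exact (Real.continuous_exp.comp hu.continuous).measurable.ennreal_ofReal
    · exact (ENNReal.ofReal_pos.2 (Real.exp_pos _)).ne'
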